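/- Let Φ(t) = t log(e + t) log log log(e^{e^e} + t). There exists an absolute constant c > 0 such that for every f ∈ L^Φ(𝕋), the Walsh–Carleson maximal operator satisfies ‖W f‖_{1,∞} ≤ c ‖f‖_{L^Φ(𝕋)}. In particular, the Walsh–Fourier partial sums W_n f converge to f almost everywhere for every f in the Orlicz space L log L log log log L(𝕋). -/

import Mathlib

/- The Walsh system on 𝕋 = [0,1): Rademacher functions and Walsh functions. -/

open MeasureTheory Filter

noncomputable section

/-- The `k`-th Rademacher function `r_k(x) = sign (sin (2^{k+1} π x))`. -/
def rademacher (k : ℕ) (x : ℝ) : ℝ :=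
  Real.sign (Real.sin (2 ^ (k + 1) * Real.pi * x))

/-- The `n`-th Walsh function `W_n = ∏_k r_k^{ε_k}` where `n = Σ_k ε_k 2^k`. -/
def walsh (n : ℕ) (x : ℝ) : ℝ :=
  ∏ k ∈ Finset.range n, if n.testBit k then rademacher k x else 1

/-- Lebesgue measure on `𝕋 = [0,1)`. -/
def μT : Measure ℝ := volume.restrict (Set.Ico (0 : ℝ) 1)

/-- The `n`-th partial Walsh-Fourier sum `W_n f = Σ_{m<n} (∫_𝕋 f W_m) W_m`. -/
def walshSum (f : ℝ → ℝ) (n : ℕ) (x : ℝ) : ℝ :=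
  ∑ m ∈ Finset.range n, (∫ t, f t * walsh m t ∂μT) * walsh m x

/-- The Walsh-Carleson maximal operator `W f (x) = sup_n |W_n f(x)|`. -/
def walshCarleson (f : ℝ → ℝ) (x : ℝ) : ℝ :=
  ⨆ n : ℕ, |walshSum f n x|

end


noncomputable section

/-- Antonov's Young function `Φ(t) = t log(e+t) loglooglog(e^{e^e}+t)`. -/
def PhiA (t : ℝ) : ℝ :=
  t * Real.log (Real.exp 1 + t) *
    Real.log (Real.log (Real.log (Real.exp (Real.exp (Real.exp 1)) + t)))

/-- The Luxemburg norm `‖f‖_{L^Φ(𝕋)} = inf {λ > 0 : ∫_𝕋 Φ(|f|/λ) ≤ 1}`. -/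
def luxemburgNorm (Φ : ℝ → ℝ) (f : ℝ → ℝ) : ℝ :=
  sInf {lam : ℝ | 0 < lam ∧ Integrable (fun x => Φ (|f x| / lam)) μT ∧
    (∫ x, Φ (|f x| / lam) ∂μT) ≤ 1}

end

namespace DyadicModel

open scoped Classical ENNReal

noncomputable section

/-- The dyadic cube `{0,1}^N`; it carries both the points and the frequencies of the finite model. -/
abbrev Cube (N : ℕ) := Fin N → Bool

variable {N : ℕ}

/-- Flip the `k`-th digit. -/
def flip (k : Fin N) (x : Cube N) : Cube N := Function.update x k (!x k)

theorem flip_same (k : Fin N) (x : Cube N) : flip k x k = !x k := by simp [flip]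

theorem flip_ne {i k : Fin N} (h : i ≠ k) (x : Cube N) : flip k x i = x i := by simp [flip, h]

theorem flip_involutive (k : Fin N) : Function.Involutive (flip k : Cube N → Cube N) := by
  intro x
  funext i
  by_cases h : i = k
  · subst h; simp [flip_same]
  · simp [flip_ne h]

theorem sum_flip (k : Fin N) (g : Cube N → ℝ) : ∑ x, g (flip k x) = ∑ x, g x :=
  Equiv.sum_comp (flip_involutive k).toPerm g

theorem sum_eq_zero_of_flip (k : Fin N) {g : Cube N → ℝ} (h : ∀ x, g (flip k x) = -g x) :
    ∑ x, g x = 0 := by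
  have h1 := sum_flip k g
  simp only [h, Finset.sum_neg_distrib] at h1
  linarith

/-- `x` and `y` agree on the digits below `k`: they lie in the same dyadic interval of level `k`. -/
def Agree (k : ℕ) (x y : Cube N) : Prop := ∀ i : Fin N, (i : ℕ) < k → x i = y i

/-- `x` and `y` agree on the digits above `k`. -/
def AgreeAbove (k : ℕ) (x y : Cube N) : Prop := ∀ i : Fin N, k < (i : ℕ) → x i = y i

theorem Agree.refl (k : ℕ) (x : Cube N) : Agree k x x := fun _ _ => rfl

theorem Agree.symm {k : ℕ} {x y : Cube N} (h : Agree k x y) : Agree k y x :=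
  fun i hi => (h i hi).symm

theorem Agree.trans {k : ℕ} {x y z : Cube N} (h : Agree k x y) (h' : Agree k y z) :
    Agree k x z := fun i hi => (h i hi).trans (h' i hi)

theorem Agree.mono {k l : ℕ} (hkl : l ≤ k) {x y : Cube N} (h : Agree k x y) : Agree l x y :=
  fun i hi => h i (hi.trans_le hkl)

theorem AgreeAbove.refl (k : ℕ) (x : Cube N) : AgreeAbove k x x := fun _ _ => rfl

theorem AgreeAbove.symm {k : ℕ} {x y : Cube N} (h : AgreeAbove k x y) : AgreeAbove k y x :=
  fun i hi => (h i hi).symm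

theorem AgreeAbove.trans {k : ℕ} {x y z : Cube N} (h : AgreeAbove k x y)
    (h' : AgreeAbove k y z) : AgreeAbove k x z := fun i hi => (h i hi).trans (h' i hi)

theorem AgreeAbove.mono {k l : ℕ} (hkl : k ≤ l) {x y : Cube N} (h : AgreeAbove k x y) :
    AgreeAbove l x y := fun i hi => h i (hkl.trans_lt hi)

theorem agree_flip {k : ℕ} {j : Fin N} (h : k ≤ j) (x : Cube N) : Agree k x (flip j x) := by
  intro i hi
  rw [flip_ne]
  rintro rfl
  omega

theorem agree_flip_right_iff {k : ℕ} {j : Fin N} (h : k ≤ j) (x y : Cube N) :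
    Agree k x (flip j y) ↔ Agree k x y :=
  ⟨fun h1 => h1.trans (agree_flip h y).symm, fun h1 => h1.trans (agree_flip h y)⟩

theorem agree_succ_iff (k : Fin N) (x y : Cube N) :
    Agree ((k : ℕ) + 1) x y ↔ Agree k x y ∧ x k = y k := by
  constructor
  · exact fun h => ⟨h.mono (Nat.le_succ _), h k (Nat.lt_succ_self _)⟩
  · rintro ⟨h, hk⟩ i hi
    rcases Nat.lt_succ_iff_lt_or_eq.1 hi with hi | hi
    · exact h i hi
    · rw [Fin.ext hi]; exact hk

/-- The `k`-th Rademacher function. -/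
def rad (k : Fin N) (x : Cube N) : ℝ := if x k then -1 else 1

/-- The Walsh function with frequency `n`. -/
def wal (n x : Cube N) : ℝ := ∏ k, if n k then rad k x else 1

theorem rad_mul_self (k : Fin N) (x : Cube N) : rad k x * rad k x = 1 := by
  unfold rad; split_ifs <;> norm_num

theorem abs_rad (k : Fin N) (x : Cube N) : |rad k x| = 1 := by
  unfold rad; split_ifs <;> norm_num

theorem rad_flip_same (k : Fin N) (x : Cube N) : rad k (flip k x) = -rad k x := by
  unfold rad; rw [flip_same]; cases x k <;> simp

theorem rad_flip_ne {k j : Fin N} (h : k ≠ j) (x : Cube N) : rad k (flip j x) = rad k x := by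
  unfold rad; rw [flip_ne h]

theorem rad_congr {k : Fin N} {x y : Cube N} (h : x k = y k) : rad k x = rad k y := by
  unfold rad; rw [h]

theorem wal_mul_self (n x : Cube N) : wal n x * wal n x = 1 := by
  unfold wal
  rw [← Finset.prod_mul_distrib]
  refine Finset.prod_eq_one fun i _ => ?_
  split_ifs
  · exact rad_mul_self i x
  · norm_num

theorem abs_wal (n x : Cube N) : |wal n x| = 1 := by
  have h : |wal n x| * |wal n x| = 1 := by rw [← abs_mul, wal_mul_self, abs_one]
  nlinarith [abs_nonneg (wal n x)]

theorem wal_flip (n : Cube N) (j : Fin N) (x : Cube N) :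
    wal n (flip j x) = (if n j then -1 else 1) * wal n x := by
  unfold wal
  rw [← Finset.mul_prod_erase _ _ (Finset.mem_univ j),
    ← Finset.mul_prod_erase (a := j) _ _ (Finset.mem_univ j)]
  have : ∏ i ∈ Finset.univ.erase j, (if n i then rad i (flip j x) else 1)
      = ∏ i ∈ Finset.univ.erase j, (if n i then rad i x else 1) := by
    refine Finset.prod_congr rfl fun i hi => ?_
    rw [rad_flip_ne (Finset.ne_of_mem_erase hi)]
  rw [this, rad_flip_same]
  split_ifs <;> ring

/-- The conditional expectation (average over dyadic intervals) at level `k`. -/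
def avg (k : ℕ) (g : Cube N → ℝ) (x : Cube N) : ℝ :=
  2 ^ k / 2 ^ N * ∑ y, if Agree k x y then g y else 0

theorem avg_congr {k : ℕ} (g : Cube N → ℝ) {x y : Cube N} (h : Agree k x y) :
    avg k g x = avg k g y := by
  unfold avg
  congr 1
  refine Finset.sum_congr rfl fun z _ => ?_
  congr 1
  exact propext ⟨fun h1 => h.symm.trans h1, fun h1 => h.trans h1⟩

theorem avg_succ (k : Fin N) (g : Cube N → ℝ) (x : Cube N) :
    avg ((k : ℕ) + 1) g x = avg k g x + rad k x * avg k (fun y => rad k y * g y) x := by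
  unfold avg
  rw [mul_left_comm (rad k x), ← mul_add, pow_succ, mul_div_right_comm, mul_assoc]
  congr 1
  rw [Finset.mul_sum, Finset.mul_sum, ← Finset.sum_add_distrib]
  refine Finset.sum_congr rfl fun y _ => ?_
  by_cases h : Agree k x y
  · have h2 : Agree ((k : ℕ) + 1) x y ↔ x k = y k := by rw [agree_succ_iff]; simp [h]
    simp only [h, if_true, h2]
    unfold rad
    cases hx : x k <;> cases hy : y k <;> simp <;> ring
  · have h2 : ¬ Agree ((k : ℕ) + 1) x y := fun h' => h (h'.mono (Nat.le_succ _))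
    simp [h, h2]

theorem avg_one {k : ℕ} (hk : k ≤ N) (x : Cube N) : avg k (fun _ => 1) x = 1 := by
  induction k with
  | zero =>
    unfold avg
    have : ∀ y, Agree 0 x y := fun y i hi => absurd hi (Nat.not_lt_zero _)
    simp [this]
  | succ k ih =>
    have h := avg_succ ⟨k, hk⟩ (fun _ => 1) x
    simp only at h
    rw [h, ih (by omega)]
    have h0 : avg k (fun y => rad ⟨k, hk⟩ y * 1) x = 0 := by
      unfold avg
      rw [sum_eq_zero_of_flip ⟨k, hk⟩, mul_zero]
      intro y
      simp only [rad_flip_same, agree_flip_right_iff (j := (⟨k, hk⟩ : Fin N)) (le_refl k)]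
      split_ifs <;> ring
    rw [h0]; ring

theorem sum_agree {k : ℕ} (hk : k ≤ N) (x : Cube N) :
    ∑ y, (if Agree k x y then (1 : ℝ) else 0) = 2 ^ N / 2 ^ k := by
  have h := avg_one hk x
  unfold avg at h
  field_simp at h ⊢
  linarith

theorem sum_mul_avg {k : ℕ} (hk : k ≤ N) (u g : Cube N → ℝ)
    (hu : ∀ x y, Agree k x y → u x = u y) : ∑ x, u x * avg k g x = ∑ x, u x * g x := by
  have h1 : ∀ x, u x * avg k g x = ∑ y, 2 ^ k / 2 ^ N * (if Agree k y x then u y * g y else 0) := by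
    intro x
    unfold avg
    rw [Finset.mul_sum, Finset.mul_sum]
    refine Finset.sum_congr rfl fun y _ => ?_
    by_cases h : Agree k x y
    · simp only [h, h.symm, if_true, hu x y h]; ring
    · have h' : ¬ Agree k y x := fun h' => h h'.symm
      simp [h, h']
  simp_rw [h1]
  rw [Finset.sum_comm]
  refine Finset.sum_congr rfl fun y _ => ?_
  have h2 : ∀ x, (2 ^ k / 2 ^ N * (if Agree k y x then u y * g y else 0) : ℝ)
      = u y * g y * (2 ^ k / 2 ^ N * (if Agree k y x then 1 else 0)) := by
    intro x; split_ifs <;> ring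
  simp_rw [h2]
  rw [← Finset.mul_sum, ← Finset.mul_sum]
  have := avg_one hk y
  unfold avg at this
  rw [this, mul_one]

theorem abs_avg_le (k : ℕ) (g : Cube N → ℝ) (x : Cube N) :
    |avg k g x| ≤ avg k (fun y => |g y|) x := by
  unfold avg
  rw [abs_mul, abs_of_nonneg (by positivity : (0 : ℝ) ≤ 2 ^ k / 2 ^ N)]
  refine mul_le_mul_of_nonneg_left ?_ (by positivity)
  refine (Finset.abs_sum_le_sum_abs _ _).trans (Finset.sum_le_sum fun y _ => ?_)
  split_ifs <;> simp

theorem avg_succ_le (k : ℕ) {g : Cube N → ℝ} (hg : ∀ x, 0 ≤ g x) (x : Cube N) :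
    avg (k + 1) g x ≤ 2 * avg k g x := by
  unfold avg
  rw [pow_succ, ← mul_assoc, mul_comm (2 ^ k : ℝ) 2, mul_div_assoc]
  refine mul_le_mul_of_nonneg_left (Finset.sum_le_sum fun y _ => ?_) (by positivity)
  by_cases h : Agree (k + 1) x y
  · simp [h, h.mono (Nat.le_succ k)]
  · simp only [h, if_false]
    split_ifs
    exacts [hg y, le_rfl]

/-- Martingale differences for the dyadic filtration. -/
structure IsMDiff (d : Fin N → Cube N → ℝ) : Prop where
  odd : ∀ k x, d k (flip k x) = -d k x
  meas : ∀ (k : Fin N) x y, Agree ((k : ℕ) + 1) x y → d k x = d k y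

/-- The martingale generated by a difference sequence. -/
def part (d : Fin N → Cube N → ℝ) (j : ℕ) (x : Cube N) : ℝ :=
  ∑ k : Fin N, if (k : ℕ) < j then d k x else 0

/-- The running maximum of `|part d j|`. -/
def runMax (d : Fin N → Cube N → ℝ) : ℕ → Cube N → ℝ
  | 0, _ => 0
  | j + 1, x => max (runMax d j x) |part d (j + 1) x|

theorem part_zero (d : Fin N → Cube N → ℝ) (x : Cube N) : part d 0 x = 0 := by
  simp [part]

theorem part_succ (d : Fin N → Cube N → ℝ) (j : Fin N) (x : Cube N) :
    part d ((j : ℕ) + 1) x = part d j x + d j x := by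
  have h : d j x = ∑ k : Fin N, if k = j then d k x else 0 := by simp
  unfold part
  conv_rhs => rw [h]
  rw [← Finset.sum_add_distrib]
  refine Finset.sum_congr rfl fun k _ => ?_
  by_cases hk : k = j
  · subst hk; simp
  · have : (k : ℕ) ≠ j := fun h => hk (Fin.ext h)
    have h2 : (k : ℕ) < j + 1 ↔ (k : ℕ) < j := by omega
    simp [hk, h2]

theorem part_self (d : Fin N → Cube N → ℝ) (x : Cube N) : part d N x = ∑ k, d k x := by
  simp [part]

theorem IsMDiff.part_congr {d : Fin N → Cube N → ℝ} (hd : IsMDiff d) {j : ℕ} {x y : Cube N}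
    (h : Agree j x y) : part d j x = part d j y := by
  unfold part
  refine Finset.sum_congr rfl fun k _ => ?_
  split_ifs with hk
  · exact hd.meas k x y (h.mono hk)
  · rfl

theorem IsMDiff.runMax_congr {d : Fin N → Cube N → ℝ} (hd : IsMDiff d) {j : ℕ} {x y : Cube N}
    (h : Agree j x y) : runMax d j x = runMax d j y := by
  induction j with
  | zero => rfl
  | succ j ih => simp only [runMax]; rw [ih (h.mono (Nat.le_succ j)), hd.part_congr h]

theorem runMax_nonneg (d : Fin N → Cube N → ℝ) (j : ℕ) (x : Cube N) : 0 ≤ runMax d j x := by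
  induction j with
  | zero => exact le_rfl
  | succ j ih => exact ih.trans (le_max_left _ _)

theorem abs_part_le_runMax (d : Fin N → Cube N → ℝ) {i j : ℕ} (h : i ≤ j) (x : Cube N) :
    |part d i x| ≤ runMax d j x := by
  induction j with
  | zero =>
    obtain rfl : i = 0 := by omega
    simp [part_zero, runMax]
  | succ j ih =>
    rcases Nat.lt_or_ge i (j + 1) with h' | h'
    · exact (ih (by omega)).trans (le_max_left _ _)
    · obtain rfl : i = j + 1 := by omega
      exact le_max_right _ _

theorem IsMDiff.sum_sq {d : Fin N → Cube N → ℝ} (hd : IsMDiff d) :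
    ∑ x, (∑ k, d k x) ^ 2 = ∑ x, ∑ k, d k x ^ 2 := by
  have h0 : ∀ j k : Fin N, j < k → ∑ x, d j x * d k x = 0 := by
    intro j k hjk
    refine sum_eq_zero_of_flip k fun x => ?_
    rw [hd.odd, hd.meas j x (flip k x) (agree_flip (by exact hjk) x)]
    ring
  have h1 : ∀ x, (∑ k, d k x) ^ 2 = ∑ j, ∑ k, d j x * d k x := by
    intro x
    rw [sq, Finset.sum_mul_sum]
  simp_rw [h1]
  rw [Finset.sum_comm]
  rw [Finset.sum_comm (f := fun x k => d k x ^ 2)]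
  refine Finset.sum_congr rfl fun j _ => ?_
  rw [Finset.sum_comm, Finset.sum_eq_single j]
  · exact Finset.sum_congr rfl fun x _ => by ring
  · intro k _ hk
    rcases lt_or_gt_of_ne hk with h | h
    · rw [← h0 k j h]
      exact Finset.sum_congr rfl fun x _ => mul_comm _ _
    · exact h0 j k h
  · simp

/-- Doob's maximal inequality in `L²`. -/
theorem IsMDiff.sum_runMax_sq_le {d : Fin N → Cube N → ℝ} (hd : IsMDiff d) :
    ∑ x, runMax d N x ^ 2 ≤ 4 * ∑ x, ∑ k, d k x ^ 2 := by
  have key : ∀ j, j ≤ N → 0 ≤ ∑ x, (2 * runMax d j x * |part d j x| - runMax d j x ^ 2) := by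
    intro j
    induction j with
    | zero => intro _; simp [runMax]
    | succ j ih =>
      intro hj
      set k : Fin N := ⟨j, hj⟩
      set s : Cube N → ℝ := fun x => if 0 ≤ part d j x then 1 else -1 with hs
      have hz : ∑ x, 2 * runMax d j x * s x * d k x = 0 := by
        refine sum_eq_zero_of_flip k fun x => ?_
        have ha : Agree j (flip k x) x := (agree_flip (le_refl j) x).symm
        have h2 : s (flip k x) = s x := by simp only [hs]; rw [hd.part_congr ha]
        rw [hd.odd, hd.runMax_congr ha, h2]
        ring
      refine (ih (by omega)).trans ?_
      rw [← add_zero (∑ x, _), ← hz, ← Finset.sum_add_distrib]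
      refine Finset.sum_le_sum fun x _ => ?_
      have hp : part d (j + 1) x = part d j x + d k x := part_succ d k x
      have h3 : |part d j x| + s x * d k x ≤ |part d (j + 1) x| := by
        rw [hp]
        simp only [hs]
        split_ifs with h
        · rw [abs_of_nonneg h]; linarith [le_abs_self (part d j x + d k x)]
        · rw [abs_of_neg (not_le.1 h)]; linarith [neg_le_abs (part d j x + d k x)]
      simp only [runMax]
      have h4 := runMax_nonneg d j x
      set m := runMax d j x
      set q := |part d (j + 1) x|
      have h5 : 2 * m * (|part d j x| + s x * d k x) ≤ 2 * m * q :=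
        mul_le_mul_of_nonneg_left h3 (by linarith)
      rcases le_total m q with h | h
      · rw [max_eq_right h]; nlinarith [sq_nonneg (q - m)]
      · rw [max_eq_left h]; nlinarith
  have h := key N le_rfl
  rw [← hd.sum_sq]
  have h2 : ∀ x, 2 * runMax d N x * |part d N x| - runMax d N x ^ 2
      ≤ 2 * (∑ k, d k x) ^ 2 - runMax d N x ^ 2 / 2 := by
    intro x
    rw [← part_self, ← sq_abs (part d N x)]
    nlinarith [sq_nonneg (runMax d N x - 2 * |part d N x|)]
  have h3 := h.trans (Finset.sum_le_sum fun x _ => h2 x)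
  rw [Finset.sum_sub_distrib, ← Finset.mul_sum, ← Finset.sum_div] at h3
  linarith

/-- The martingale differences of `g` over dyadic intervals on which (and on whose ancestors)
the averages of `|g|` are at most `lam` are square integrable with a bound linear in `lam`. -/
theorem sum_good_sq_le (g : Cube N → ℝ) {lam : ℝ} (hlam : 0 ≤ lam) {l : ℕ} (hl : l ≤ N)
    (a : Cube N) :
    ∑ x, ∑ k : Fin N, (if l ≤ (k : ℕ) ∧ Agree l a x ∧
        (∀ j ≤ (k : ℕ), avg j (fun y => |g y|) x ≤ lam)
      then avg k (fun y => rad k y * g y) x ^ 2 else 0) ≤ (3 * lam) ^ 2 * (2 ^ N / 2 ^ l) := by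
  set c : Fin N → Cube N → Prop := fun k x => l ≤ (k : ℕ) ∧ Agree l a x ∧
        (∀ j ≤ (k : ℕ), avg j (fun y => |g y|) x ≤ lam) with hc
  set d : Fin N → Cube N → ℝ := fun k x =>
    if c k x then rad k x * avg k (fun y => rad k y * g y) x else 0 with hdd
  have hcc : ∀ (k : Fin N) x y, Agree k x y → (c k x ↔ c k y) := by
    have : ∀ (k : Fin N) x y, Agree k x y → c k x → c k y := by
      intro k x y h ⟨h1, h2, h3⟩
      refine ⟨h1, h2.trans (h.mono h1), fun j hj => ?_⟩
      rw [← avg_congr _ (h.mono hj)]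
      exact h3 j hj
    exact fun k x y h => ⟨this k x y h, this k y x h.symm⟩
  have hd : IsMDiff d := by
    constructor
    · intro k x
      have ha := (agree_flip (le_refl (k : ℕ)) x).symm
      simp only [hdd]
      rw [rad_flip_same, avg_congr _ ha]
      simp only [hcc k _ _ ha]
      split_ifs <;> ring
    · intro k x y h
      have ha := h.mono (Nat.le_succ k)
      simp only [hdd]
      rw [rad_congr (h k (Nat.lt_succ_self _)), avg_congr _ ha]
      simp only [hcc k _ _ ha]
  have hsq : ∀ x (k : Fin N), (if c k x then avg k (fun y => rad k y * g y) x ^ 2 else 0)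
      = d k x ^ 2 := by
    intro x k
    simp only [hdd]
    split_ifs
    · rw [mul_pow, sq (rad k x), rad_mul_self, one_mul]
    · ring
  refine (Finset.sum_congr rfl fun x _ => Finset.sum_congr rfl fun k _ => hsq x k).trans_le ?_
  rw [← hd.sum_sq]
  have hbound : ∀ x, (∑ k, d k x) ^ 2 ≤ (3 * lam) ^ 2 * (if Agree l a x then 1 else 0) := by
    intro x
    split_ifs with hx
    swap
    · have : ∀ k, d k x = 0 := fun k => by simp [hdd, hc, hx]
      simp [this]
    rw [← part_self]
    have h0 : ∀ j, j ≤ l → part d j x = 0 := by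
      intro j hj
      unfold part
      refine Finset.sum_eq_zero fun k _ => ?_
      split_ifs with hk
      · simp only [hdd, hc]
        rw [if_neg]
        intro h
        have := h.1
        omega
      · rfl
    have key : ∀ j, j ≤ N → |part d j x| ≤ 3 * lam ∧
        (l ≤ j → (∀ i < j, avg i (fun y => |g y|) x ≤ lam) →
          part d j x = avg j g x - avg l g x) := by
      intro j
      induction j with
      | zero =>
        intro _
        rw [h0 0 (Nat.zero_le _)]
        refine ⟨by simpa using hlam, fun h _ => ?_⟩
        obtain rfl : l = 0 := by omega
        simp
      | succ j ih =>
        intro hj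
        obtain ⟨h1, h2⟩ := ih (by omega)
        have hp : part d (j + 1) x = part d j x + d ⟨j, hj⟩ x := part_succ d ⟨j, hj⟩ x
        by_cases hcj : c ⟨j, hj⟩ x
        · have hlj : l ≤ j := hcj.1
          have hgood : ∀ i ≤ j, avg i (fun y => |g y|) x ≤ lam := hcj.2.2
          have h3 := avg_succ ⟨j, hj⟩ g x
          have h4 : part d (j + 1) x = avg (j + 1) g x - avg l g x := by
            rw [hp, h2 hlj fun i hi => hgood i hi.le]
            simp only [hdd, hcj, if_true]
            simp only at h3
            rw [h3]; ring
          refine ⟨?_, fun _ _ => h4⟩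
          rw [h4]
          have h5 := (abs_avg_le (j + 1) g x).trans
            (avg_succ_le j (fun y => abs_nonneg (g y)) x)
          have h6 := abs_avg_le l g x
          have h7 := abs_sub (avg (j + 1) g x) (avg l g x)
          linarith [hgood j le_rfl, hgood l hlj]
        · have h3 : part d (j + 1) x = part d j x := by
            rw [hp]; simp [hdd, hcj]
          refine ⟨h3 ▸ h1, fun hl' hg => ?_⟩
          rcases Nat.lt_or_ge j l with h | h
          · obtain rfl : l = j + 1 := by omega
            rw [h0 _ le_rfl]; simp
          · exact absurd ⟨h, hx, fun i hi => hg i (by simp only at hi; omega)⟩ hcj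
    have h := (key N le_rfl).1
    rw [mul_one, ← sq_abs (part d N x)]
    exact pow_le_pow_left₀ (abs_nonneg _) h 2
  refine (Finset.sum_le_sum fun x _ => hbound x).trans ?_
  rw [← Finset.mul_sum, sum_agree hl]

/-- The dyadic maximal function is of weak type `(1,1)`. -/
theorem card_maximal_le (g : Cube N → ℝ) (hg : ∀ x, 0 ≤ g x) {lam : ℝ} :
    lam * (Finset.univ.filter fun x => ∃ j ≤ N, lam < avg j g x).card ≤ ∑ x, g x := by
  set u : ℕ → Cube N → Prop := fun j x => lam < avg j g x ∧ ∀ i < j, ¬ lam < avg i g x with hu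
  have hone : ∀ x, ∑ j ∈ Finset.range (N + 1), (if u j x then (1 : ℝ) else 0)
      = if ∃ j ≤ N, lam < avg j g x then 1 else 0 := by
    intro x
    split_ifs with h
    · obtain ⟨h1, h2⟩ := Nat.find_spec h
      rw [Finset.sum_eq_single (Nat.find h)]
      · rw [if_pos]
        exact ⟨h2, fun i hi hlt => Nat.find_min h hi ⟨hi.le.trans h1, hlt⟩⟩
      · intro j hj hne
        rw [if_neg]
        rintro ⟨h3, h4⟩
        rcases lt_or_gt_of_ne hne with h5 | h5
        · exact Nat.find_min h h5 ⟨by simpa [Nat.lt_succ_iff] using hj, h3⟩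
        · exact h4 _ h5 h2
      · intro hn
        exact absurd (Finset.mem_range.2 (Nat.lt_succ_of_le h1)) hn
    · refine Finset.sum_eq_zero fun j hj => ?_
      rw [if_neg]
      exact fun h' => h ⟨j, by simpa [Nat.lt_succ_iff] using hj, h'.1⟩
  have hj : ∀ j ∈ Finset.range (N + 1), lam * ∑ x, (if u j x then (1 : ℝ) else 0)
      ≤ ∑ x, (if u j x then (1 : ℝ) else 0) * g x := by
    intro j hj
    rw [← sum_mul_avg (k := j) (by simpa [Nat.lt_succ_iff] using hj), Finset.mul_sum]
    · refine Finset.sum_le_sum fun x _ => ?_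
      split_ifs with h
      · linarith [h.1]
      · simp
    · intro x y hxy
      have : u j x ↔ u j y := by
        simp only [hu]
        rw [avg_congr g hxy]
        refine and_congr_right fun _ => forall₂_congr fun i hi => ?_
        rw [avg_congr g (hxy.mono hi.le)]
      simp only [this]
  have hsum := Finset.sum_le_sum hj
  rw [← Finset.mul_sum, Finset.sum_comm,
    Finset.sum_comm (f := fun j x => (if u j x then (1 : ℝ) else 0) * g x)] at hsum
  simp only [← Finset.sum_mul, hone] at hsum
  rw [Finset.sum_boole] at hsum
  refine hsum.trans (Finset.sum_le_sum fun x _ => ?_)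
  split_ifs
  · linarith
  · simpa using hg x

/-- The modulus of the wave packet coefficient of `f` on the tile of level `k` at `(x, n)`. -/
def blk (f : Cube N → ℝ) (k : Fin N) (n x : Cube N) : ℝ :=
  avg k (fun y => rad k y * (wal n y * f y)) x

/-- The wave packet component of `f` at level `k` at `(x, n)`. -/
def coef (f : Cube N → ℝ) (k : Fin N) (n x : Cube N) : ℝ :=
  wal n x * rad k x * blk f k n x

/-- A family of tiles, as a predicate on level, point and frequency. -/
abbrev Fam (N : ℕ) := Fin N → Cube N → Cube N → Prop

/-- The predicate depends only on the tile containing the point and the frequency. -/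
def Fam.Inv (P : Fam N) : Prop :=
  ∀ (k : Fin N) x y n m, Agree k x y → AgreeAbove k n m → P k x n → P k y m

theorem Fam.Inv.iff {P : Fam N} (hP : P.Inv) {k : Fin N} {x y n m : Cube N}
    (h : Agree k x y) (h' : AgreeAbove k n m) : P k x n ↔ P k y m :=
  ⟨hP k x y n m h h', hP k y x m n h.symm h'.symm⟩

/-- The full tree with top interval of level `l` around `a` and top frequency `ξ`. -/
def Tree (l : ℕ) (a ξ : Cube N) : Fam N := fun k x n =>
  l ≤ (k : ℕ) ∧ Agree l a x ∧ AgreeAbove k ξ n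

theorem tree_inv (l : ℕ) (a ξ : Cube N) : (Tree l a ξ).Inv :=
  fun _ _ _ _ _ h h' ⟨h1, h2, h3⟩ => ⟨h1, h2.trans (h.mono h1), h3.trans h'⟩

theorem Fam.Inv.and {P Q : Fam N} (hP : P.Inv) (hQ : Q.Inv) :
    Fam.Inv (fun k x n => P k x n ∧ Q k x n) :=
  fun k x y n m h h' hh => ⟨hP k x y n m h h' hh.1, hQ k x y n m h h' hh.2⟩

theorem Fam.Inv.not {P : Fam N} (hP : P.Inv) : Fam.Inv (fun k x n => ¬ P k x n) :=
  fun _ _ _ _ _ h h' hh hp => hh ((hP.iff h h').2 hp)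

/-- The part of the Carleson sum at frequency `n` supported on the tiles of `P`. -/
def carl (f : Cube N → ℝ) (P : Fam N) (n x : Cube N) : ℝ :=
  ∑ k, if n k = true ∧ P k x n then coef f k n x else 0

/-- The linearized Carleson functional of the family `P`. -/
def Lam (f : Cube N → ℝ) (G : Finset (Cube N)) (ν : Cube N → Cube N) (P : Fam N) : ℝ :=
  ∑ x ∈ G, |carl f P (ν x) x|

/-- The square sum of the coefficients over the lacunary part of a tree. -/
def energy (f : Cube N → ℝ) (P : Fam N) (ξ : Cube N) (l : ℕ) (a : Cube N) : ℝ :=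
  ∑ x, ∑ k : Fin N, if l ≤ (k : ℕ) ∧ Agree l a x ∧ ξ k = true ∧ P k x ξ then blk f k ξ x ^ 2 else 0

/-- The size of the family is at most `s`. -/
def SizeLE (f : Cube N → ℝ) (s : ℝ) (P : Fam N) : Prop :=
  ∀ l ≤ N, ∀ a ξ, energy f P ξ l a ≤ s ^ 2 * (2 ^ N / 2 ^ l)

/-- The points of `G` over the interval of level `l` around `x` whose frequency lies in the
frequency interval around `m`. -/
def mass (G : Finset (Cube N)) (ν : Cube N → Cube N) (l : ℕ) (x m : Cube N) : Finset (Cube N) :=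
  G.filter fun y => Agree l x y ∧ AgreeAbove l m (ν y)

/-- The density of the family is at most `δ`. -/
def DensLE (G : Finset (Cube N)) (ν : Cube N → Cube N) (δ : ℝ) (P : Fam N) : Prop :=
  ∀ (k : Fin N) x m, P k x m → ∀ l ≤ (k : ℕ), ∀ m', AgreeAbove k m m' →
    ((mass G ν l x m').card : ℝ) ≤ δ * (2 ^ N / 2 ^ l)

theorem blk_congr (f : Cube N → ℝ) {k : Fin N} (n : Cube N) {x y : Cube N} (h : Agree k x y) :
    blk f k n x = blk f k n y := avg_congr _ h

theorem abs_coef (f : Cube N → ℝ) (k : Fin N) (n x : Cube N) : |coef f k n x| = |blk f k n x| := by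
  unfold coef
  rw [abs_mul, abs_mul, abs_wal, abs_rad, one_mul, one_mul]

theorem coef_eq_sum (f : Cube N → ℝ) (k : Fin N) (n x : Cube N) :
    coef f k n x = 2 ^ (k : ℕ) / 2 ^ N * ∑ y, if Agree k x y then
      (rad k x * rad k y) * (wal n x * wal n y) * f y else 0 := by
  unfold coef blk avg
  rw [mul_left_comm, Finset.mul_sum]
  congr 1
  refine Finset.sum_congr rfl fun y _ => ?_
  split_ifs
  · ring
  · ring

theorem coef_congr (f : Cube N → ℝ) {k : Fin N} {n m : Cube N} (h : n k = m k)
    (h' : AgreeAbove k n m) (x : Cube N) : coef f k n x = coef f k m x := by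
  rw [coef_eq_sum, coef_eq_sum]
  congr 1
  refine Finset.sum_congr rfl fun y _ => ?_
  split_ifs with hxy
  swap
  · rfl
  have : wal n x * wal n y = wal m x * wal m y := by
    unfold wal
    rw [← Finset.prod_mul_distrib, ← Finset.prod_mul_distrib]
    refine Finset.prod_congr rfl fun i _ => ?_
    rcases lt_trichotomy i k with hi | hi | hi
    · have hr := rad_mul_self i y
      rw [rad_congr (hxy i hi)]
      split_ifs <;> simp [hr]
    · rw [hi, h]
    · rw [h' i hi]
  rw [this]

theorem coef_flip_gt (f : Cube N → ℝ) {k j : Fin N} (h : k < j) (n x : Cube N) :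
    coef f k n (flip j x) = (if n j then -1 else 1) * coef f k n x := by
  unfold coef
  rw [wal_flip, rad_flip_ne h.ne, blk_congr f n (agree_flip (le_of_lt h) x).symm]
  ring

theorem coef_flip_same (f : Cube N → ℝ) {k : Fin N} {n : Cube N} (h : n k = true) (x : Cube N) :
    coef f k n (flip k x) = coef f k n x := by
  unfold coef
  rw [wal_flip, rad_flip_same, blk_congr f n (agree_flip le_rfl x).symm, if_pos h]
  ring

theorem energy_nonneg (f : Cube N → ℝ) (P : Fam N) (ξ : Cube N) (l : ℕ) (a : Cube N) :
    0 ≤ energy f P ξ l a :=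
  Finset.sum_nonneg fun _ _ => Finset.sum_nonneg fun _ _ => by split_ifs <;> positivity

theorem energy_mono (f : Cube N → ℝ) {P Q : Fam N} (h : ∀ k x n, P k x n → Q k x n) (ξ : Cube N)
    (l : ℕ) (a : Cube N) : energy f P ξ l a ≤ energy f Q ξ l a := by
  refine Finset.sum_le_sum fun x _ => Finset.sum_le_sum fun k _ => ?_
  by_cases h1 : l ≤ (k : ℕ) ∧ Agree l a x ∧ ξ k = true ∧ P k x ξ
  · rw [if_pos h1, if_pos ⟨h1.1, h1.2.1, h1.2.2.1, h _ _ _ h1.2.2.2⟩]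
  · rw [if_neg h1]; split_ifs <;> positivity

theorem SizeLE.mono {f : Cube N → ℝ} {s : ℝ} {P Q : Fam N} (hQ : SizeLE f s Q)
    (h : ∀ k x n, P k x n → Q k x n) : SizeLE f s P :=
  fun l hl a ξ => (energy_mono f h ξ l a).trans (hQ l hl a ξ)

theorem DensLE.mono {G : Finset (Cube N)} {ν : Cube N → Cube N} {δ : ℝ} {P Q : Fam N}
    (hQ : DensLE G ν δ Q) (h : ∀ k x n, P k x n → Q k x n) : DensLE G ν δ P :=
  fun k x m hp => hQ k x m (h k x m hp)

theorem SizeLE.abs_blk_le {f : Cube N → ℝ} {s : ℝ} {P : Fam N} (hs : SizeLE f s P) (hs0 : 0 ≤ s)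
    (hP : P.Inv) {k : Fin N} {n x : Cube N} (hn : n k = true) (hp : P k x n) :
    |blk f k n x| ≤ s := by
  have h1 : blk f k n x ^ 2 * (2 ^ N / 2 ^ (k : ℕ)) ≤ energy f P n k x := by
    rw [← sum_agree k.2.le x, Finset.mul_sum]
    refine Finset.sum_le_sum fun y _ => ?_
    refine le_trans ?_ (Finset.single_le_sum (f := fun j : Fin N =>
      if (k : ℕ) ≤ (j : ℕ) ∧ Agree k x y ∧ n j = true ∧ P j y n then blk f j n y ^ 2 else 0)
      (fun j _ => by split_ifs <;> positivity) (Finset.mem_univ k))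
    by_cases h : Agree k x y
    · rw [if_pos h, if_pos ⟨le_rfl, h, hn, hP k x y n n h (AgreeAbove.refl _ _) hp⟩,
        blk_congr f n h, mul_one]
    · rw [if_neg h, mul_zero]
      split_ifs <;> positivity
  have h2 := h1.trans (hs k k.2.le x n)
  have h3 := le_of_mul_le_mul_right h2 (by positivity)
  exact abs_le_of_sq_le_sq h3 hs0

theorem Lam_le_add (f : Cube N → ℝ) (G : Finset (Cube N)) (ν : Cube N → Cube N) (P Q : Fam N) :
    Lam f G ν P ≤ Lam f G ν (fun k x n => P k x n ∧ ¬ Q k x n)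
      + Lam f G ν (fun k x n => P k x n ∧ Q k x n) := by
  unfold Lam
  rw [← Finset.sum_add_distrib]
  refine Finset.sum_le_sum fun x _ => ?_
  have : carl f P (ν x) x = carl f (fun k x n => P k x n ∧ ¬ Q k x n) (ν x) x
      + carl f (fun k x n => P k x n ∧ Q k x n) (ν x) x := by
    unfold carl
    rw [← Finset.sum_add_distrib]
    refine Finset.sum_congr rfl fun k _ => ?_
    by_cases h : Q k x (ν x) <;> simp [h]
  rw [this]
  exact abs_add_le _ _

/-- The martingale differences attached to the lacunary part of a tree. -/
def treeDiff (f : Cube N → ℝ) (P : Fam N) (ξ : Cube N) (l : ℕ) (a : Cube N) (k : Fin N)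
    (x : Cube N) : ℝ :=
  if l ≤ (k : ℕ) ∧ Agree l a x ∧ ξ k = true ∧ P k x ξ then rad k x * blk f k ξ x else 0

theorem treeDiff_cond_iff {P : Fam N} (hP : P.Inv) (ξ : Cube N) (l : ℕ) (a : Cube N) {k : Fin N}
    {x y : Cube N} (h : Agree k x y) :
    (l ≤ (k : ℕ) ∧ Agree l a x ∧ ξ k = true ∧ P k x ξ) ↔
      (l ≤ (k : ℕ) ∧ Agree l a y ∧ ξ k = true ∧ P k y ξ) := by
  rw [hP.iff h (AgreeAbove.refl _ _)]
  refine and_congr_right fun hl => and_congr_left fun _ => ?_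
  exact ⟨fun h1 => h1.trans (h.mono hl), fun h1 => h1.trans (h.mono hl).symm⟩

theorem isMDiff_treeDiff (f : Cube N → ℝ) {P : Fam N} (hP : P.Inv) (ξ : Cube N) (l : ℕ)
    (a : Cube N) : IsMDiff (treeDiff f P ξ l a) := by
  constructor
  · intro k x
    have ha := (agree_flip (le_refl (k : ℕ)) x).symm
    unfold treeDiff
    rw [rad_flip_same, blk_congr f ξ ha]
    simp only [treeDiff_cond_iff hP ξ l a ha]
    split_ifs <;> ring
  · intro k x y h
    have ha := h.mono (Nat.le_succ k)
    unfold treeDiff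
    rw [rad_congr (h k (Nat.lt_succ_self _)), blk_congr f ξ ha]
    simp only [treeDiff_cond_iff hP ξ l a ha]

theorem sum_treeDiff_sq (f : Cube N → ℝ) (P : Fam N) (ξ : Cube N) (l : ℕ) (a : Cube N) :
    ∑ x, ∑ k, treeDiff f P ξ l a k x ^ 2 = energy f P ξ l a := by
  refine Finset.sum_congr rfl fun x _ => Finset.sum_congr rfl fun k _ => ?_
  unfold treeDiff
  split_ifs
  · rw [mul_pow, sq (rad k x), rad_mul_self, one_mul]
  · ring

/-- Pointwise bound of a tree's Carleson sum by the maximal function of its martingale. -/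
theorem abs_carl_tree_le {f : Cube N → ℝ} {P : Fam N} (hP : P.Inv) {s : ℝ} (hs0 : 0 ≤ s)
    (hs : SizeLE f s P) (l : ℕ) (a ξ n x : Cube N) :
    |carl f (fun k x n => P k x n ∧ Tree l a ξ k x n) n x| ≤
      if ∃ k, P k x n ∧ Tree l a ξ k x n then
        2 * runMax (treeDiff f P ξ l a) N x + s else 0 := by
  split_ifs with hact
  swap
  · have : ∀ k, ¬ (P k x n ∧ Tree l a ξ k x n) := fun k hk => hact ⟨k, hk⟩
    simp [carl, this]
  obtain ⟨k0, hk0, hT0⟩ := hact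
  obtain ⟨κ, hκ, hmin⟩ := Finset.exists_min_image
    (Finset.univ.filter fun k : Fin N => l ≤ (k : ℕ) ∧ AgreeAbove k ξ n) id
    ⟨k0, by simpa using ⟨hT0.1, hT0.2.2⟩⟩
  simp only [Finset.mem_filter, Finset.mem_univ, true_and, id] at hκ hmin
  set d := treeDiff f P ξ l a with hd
  set t : ℝ := if n κ = true ∧ P κ x n ∧ Tree l a ξ κ x n then coef f κ n x else 0 with ht
  have hterm : ∀ k : Fin N, (if n k = true ∧ P k x n ∧ Tree l a ξ k x n then coef f k n x else 0)
      = (if k = κ then t else 0) + wal ξ x * (d k x - if (k : ℕ) < κ + 1 then d k x else 0) := by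
    intro k
    rcases lt_trichotomy k κ with hk | hk | hk
    · have h1 : (k : ℕ) < κ + 1 := Nat.lt_succ_of_lt hk
      rw [if_neg, if_neg hk.ne, if_pos h1]
      · ring
      · rintro ⟨_, _, h2⟩
        exact absurd (hmin k ⟨h2.1, h2.2.2⟩) (not_le.2 hk)
    · subst hk
      simp [ht]
    · have h1 : ¬ (k : ℕ) < κ + 1 := by
        have : (κ : ℕ) < k := hk
        omega
      rw [if_neg hk.ne', if_neg h1, sub_zero, zero_add]
      have hkn : ξ k = n k := hκ.2 k hk
      have hab : AgreeAbove k ξ n := hκ.2.mono (le_of_lt hk)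
      have hl : l ≤ (k : ℕ) := hκ.1.trans (le_of_lt hk)
      have hiff : (n k = true ∧ P k x n ∧ Tree l a ξ k x n) ↔
          (l ≤ (k : ℕ) ∧ Agree l a x ∧ ξ k = true ∧ P k x ξ) := by
        rw [hP.iff (Agree.refl _ _) hab, hkn]
        unfold Tree
        tauto
      simp only [hd, treeDiff, hiff]
      split_ifs
      · rw [← coef_congr f hkn hab, coef]; ring
      · ring
  have hsum : carl f (fun k x n => P k x n ∧ Tree l a ξ k x n) n x
      = t + wal ξ x * (part d N x - part d (κ + 1) x) := by
    unfold carl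
    refine (Finset.sum_congr rfl fun k _ =>
      (show _ = _ by convert hterm k)).trans ?_
    rw [Finset.sum_add_distrib, ← Finset.mul_sum, Finset.sum_sub_distrib, part_self]
    simp [part]
  have htle : |t| ≤ s := by
    simp only [ht]
    split_ifs with h
    · rw [abs_coef]; exact hs.abs_blk_le hs0 hP h.1 h.2.1
    · simpa using hs0
  rw [hsum]
  have h1 := abs_part_le_runMax d (le_refl N) x
  have h2 := abs_part_le_runMax d (show (κ : ℕ) + 1 ≤ N from κ.2) x
  have h3 := abs_sub (part d N x) (part d (κ + 1) x)
  refine (abs_add_le _ _).trans ?_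
  rw [abs_mul, abs_wal, one_mul]
  linarith

theorem sum_agree_split {j : ℕ} (hj : j < N) (b : Cube N) (u : Cube N → ℝ) :
    ∑ x, (if Agree j b x then u x else 0) = (∑ x, if Agree (j + 1) b x then u x else 0)
      + ∑ x, if Agree (j + 1) (flip ⟨j, hj⟩ b) x then u x else 0 := by
  rw [← Finset.sum_add_distrib]
  refine Finset.sum_congr rfl fun x _ => ?_
  have h1 := agree_succ_iff ⟨j, hj⟩ b x
  have h2 := agree_succ_iff ⟨j, hj⟩ (flip ⟨j, hj⟩ b) x
  simp only at h1 h2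
  have h3 : Agree j (flip ⟨j, hj⟩ b) x ↔ Agree j b x :=
    ⟨fun h => ((agree_flip (j := ⟨j, hj⟩) le_rfl b)).trans h,
      fun h => ((agree_flip (j := ⟨j, hj⟩) le_rfl b)).symm.trans h⟩
  rw [h3, flip_same] at h2
  simp only [h1, h2]
  by_cases h : Agree j b x
  · cases hb : b ⟨j, hj⟩ <;> cases hx : x ⟨j, hj⟩ <;> simp [h]
  · simp [h]

/-- The tree estimate. -/
theorem Lam_tree_le {f : Cube N → ℝ} {G : Finset (Cube N)} {ν : Cube N → Cube N} {P : Fam N}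
    (hP : P.Inv) {s δ : ℝ} (hs0 : 0 < s) (hδ : 0 ≤ δ) (hs : SizeLE f s P) (hD : DensLE G ν δ P)
    {l : ℕ} (hl : l ≤ N) (a ξ : Cube N) :
    Lam f G ν (fun k x n => P k x n ∧ Tree l a ξ k x n) ≤ 10 * δ * s * (2 ^ N / 2 ^ l) := by
  set d := treeDiff f P ξ l a with hd
  have hmd : IsMDiff d := isMDiff_treeDiff f hP ξ l a
  set H : Cube N → ℝ := fun x => 2 * runMax d N x + s with hH
  have hH0 : ∀ x, 0 ≤ H x := fun x => by have := runMax_nonneg d N x; simp only [hH]; linarith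
  set act : Cube N → Prop := fun x => x ∈ G ∧ ∃ k, P k x (ν x) ∧ Tree l a ξ k x (ν x) with hact
  have hLam : Lam f G ν (fun k x n => P k x n ∧ Tree l a ξ k x n)
      ≤ ∑ x, if Agree l a x then (if act x then H x else 0) else 0 := by
    unfold Lam
    rw [← Finset.sum_filter_add_sum_filter_not Finset.univ (fun x => x ∈ G)]
    rw [Finset.filter_univ_mem]
    refine le_add_of_le_of_nonneg (Finset.sum_le_sum fun x hx => ?_) (Finset.sum_nonneg fun x _ => ?_)
    · refine (abs_carl_tree_le hP hs0.le hs l a ξ (ν x) x).trans (le_of_eq ?_)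
      by_cases h : ∃ k, P k x (ν x) ∧ Tree l a ξ k x (ν x)
      · have h2 := h
        obtain ⟨k, -, hk⟩ := h
        rw [if_pos h2, if_pos hk.2.1, if_pos ⟨hx, h2⟩]
      · rw [if_neg h, if_neg (fun h' : act x => h h'.2), ite_self]
    · split_ifs
      exacts [hH0 x, le_rfl, le_rfl]
  have claim : ∀ i j : ℕ, i + j = N → l ≤ j → ∀ b, Agree l a b →
      (∃ (k : Fin N) (x : Cube N), j ≤ (k : ℕ) ∧ Agree j b x ∧ P k x ξ) →
      ∑ x, (if Agree j b x then (if act x then H x else 0) else 0)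
        ≤ 2 * δ * ∑ x, if Agree j b x then H x else 0 := by
    intro i
    induction i with
    | zero =>
      rintro j hij - b - ⟨k, _, hk, -⟩
      have := k.2
      omega
    | succ i ih =>
      rintro j hij hlj b hab ⟨k, x0, hjk, hbx0, hP0⟩
      have hjN : j < N := by omega
      have child : ∀ c, Agree j b c →
          ∑ x, (if Agree (j + 1) c x then (if act x then H x else 0) else 0)
            ≤ 2 * δ * ∑ x, if Agree (j + 1) c x then H x else 0 := by
        intro c hbc
        have hac : Agree l a c := hab.trans (hbc.mono hlj)
        by_cases hlive : ∃ (k : Fin N) (x : Cube N), j + 1 ≤ (k : ℕ) ∧ Agree (j + 1) c x ∧ P k x ξ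
        · exact ih (j + 1) (by omega) (by omega) c hac hlive
        have hHc : ∀ x, Agree (j + 1) c x → H x = H c := by
          intro x hx
          have hz : ∀ y, Agree (j + 1) c y → ∀ m, j + 1 ≤ m →
              part d m y = part d (j + 1) y := by
            intro y hy m hm
            unfold part
            refine Finset.sum_congr rfl fun k _ => ?_
            by_cases hk : (k : ℕ) < j + 1
            · rw [if_pos hk, if_pos (by omega)]
            · rw [if_neg hk]
              split_ifs
              · simp only [hd, treeDiff]
                rw [if_neg]
                rintro ⟨_, _, _, hp⟩
                exact hlive ⟨k, y, by omega, hy, hp⟩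
              · rfl
          have hpart : ∀ m, part d m x = part d m c := by
            intro m
            rcases Nat.lt_or_ge m (j + 1) with hm | hm
            · exact hmd.part_congr (hx.symm.mono hm.le)
            · rw [hz x hx m hm, hz c (Agree.refl _ _) m hm]
              exact hmd.part_congr hx.symm
          have hrun : ∀ m, runMax d m x = runMax d m c := by
            intro m
            induction m with
            | zero => rfl
            | succ m ihm => simp only [runMax]; rw [ihm, hpart]
          simp only [hH, hrun]
        have h1 : ∑ x, (if Agree (j + 1) c x then (if act x then H x else 0) else 0)
            ≤ H c * (mass G ν j x0 ξ).card := by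
          unfold mass
          rw [Finset.card_filter, Nat.cast_sum, Finset.mul_sum]
          rw [← Finset.sum_filter_add_sum_filter_not Finset.univ (fun x => x ∈ G),
            Finset.filter_univ_mem]
          have hzero : ∑ x ∈ Finset.univ.filter (fun x => x ∉ G),
              (if Agree (j + 1) c x then (if act x then H x else 0) else 0) = 0 := by
            refine Finset.sum_eq_zero fun x hx => ?_
            have hx' : x ∉ G := (Finset.mem_filter.1 hx).2
            rw [if_neg (fun h' : act x => hx' h'.1), ite_self]
          rw [hzero, add_zero]
          refine Finset.sum_le_sum fun x hx => ?_
          by_cases h : Agree (j + 1) c x ∧ act x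
          · obtain ⟨hcx, -, k', hk', hT⟩ := h
            have hkj : (k' : ℕ) ≤ j := by
              by_contra hlt
              exact hlive ⟨k', x, by omega, hcx,
                (hP.iff (Agree.refl _ _) hT.2.2).2 hk'⟩
            rw [if_pos hcx, if_pos ⟨hx, k', hk', hT⟩, hHc x hcx, if_pos]
            · simp
            · exact ⟨hbx0.symm.trans (hbc.trans (hcx.mono (Nat.le_succ j))), hT.2.2.mono hkj⟩
          · have : (if Agree (j + 1) c x then (if act x then H x else 0) else 0) = 0 := by
              by_cases h1 : Agree (j + 1) c x
              · rw [if_pos h1, if_neg fun h2 => h ⟨h1, h2⟩]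
              · rw [if_neg h1]
            rw [this]
            exact mul_nonneg (hH0 c) (Nat.cast_nonneg _)
        have h2 : ∑ x, (if Agree (j + 1) c x then H x else 0) = H c * (2 ^ N / 2 ^ (j + 1)) := by
          rw [← sum_agree (show j + 1 ≤ N by omega) c, Finset.mul_sum]
          refine Finset.sum_congr rfl fun x _ => ?_
          split_ifs with h
          · rw [hHc x h, mul_one]
          · rw [mul_zero]
        refine h1.trans ?_
        rw [h2]
        have h3 := hD k x0 ξ hP0 j hjk ξ (AgreeAbove.refl _ _)
        refine (mul_le_mul_of_nonneg_left h3 (hH0 c)).trans (le_of_eq ?_)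
        rw [pow_succ]
        field_simp
      rw [sum_agree_split hjN b, sum_agree_split hjN b, mul_add]
      exact add_le_add (child b (Agree.refl _ _)) (child _ (agree_flip (j := ⟨j, hjN⟩) (le_refl j) b))
  have hmain : ∑ x, (if Agree l a x then (if act x then H x else 0) else 0)
      ≤ 2 * δ * ∑ x, if Agree l a x then H x else 0 := by
    by_cases hlive : ∃ (k : Fin N) (x : Cube N), l ≤ (k : ℕ) ∧ Agree l a x ∧ P k x ξ
    · exact claim (N - l) l (by omega) le_rfl a (Agree.refl _ _) hlive
    · have : ∀ x, ¬ act x := by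
        rintro x ⟨_, k, hk, hT⟩
        exact hlive ⟨k, x, hT.1, hT.2.1, (hP.iff (Agree.refl _ _) hT.2.2).2 hk⟩
      simp only [this, if_false, ite_self, Finset.sum_const_zero]
      refine mul_nonneg (by linarith) (Finset.sum_nonneg fun x _ => ?_)
      split_ifs
      exacts [hH0 x, le_rfl]
  have hHsum : ∑ x, (if Agree l a x then H x else 0) ≤ 5 * s * (2 ^ N / 2 ^ l) := by
    have h1 : ∀ x, (if Agree l a x then H x else 0)
        ≤ 1 / (2 * s) * runMax d N x ^ 2 + 3 * s * (if Agree l a x then 1 else 0) := by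
      intro x
      split_ifs
      · simp only [hH]
        have : 2 * runMax d N x ≤ 1 / (2 * s) * runMax d N x ^ 2 + 2 * s := by
          have h2 : 0 ≤ 1 / (2 * s) * (runMax d N x - 2 * s) ^ 2 := by positivity
          have h3 : 1 / (2 * s) * (runMax d N x - 2 * s) ^ 2
              = 1 / (2 * s) * runMax d N x ^ 2 - 2 * runMax d N x + 2 * s := by
            field_simp
            ring
          linarith
        linarith
      · have : 0 ≤ 1 / (2 * s) * runMax d N x ^ 2 := by positivity
        linarith
    refine (Finset.sum_le_sum fun x _ => h1 x).trans ?_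
    rw [Finset.sum_add_distrib, ← Finset.mul_sum, ← Finset.mul_sum, sum_agree hl]
    have h2 := hmd.sum_runMax_sq_le
    rw [hd, sum_treeDiff_sq] at h2
    have h3 := h2.trans (mul_le_mul_of_nonneg_left (hs l hl a ξ) (by norm_num : (0 : ℝ) ≤ 4))
    have h4 := mul_le_mul_of_nonneg_left h3 (by positivity : 0 ≤ 1 / (2 * s))
    have h5 : 1 / (2 * s) * (4 * (s ^ 2 * (2 ^ N / 2 ^ l))) = 2 * s * (2 ^ N / 2 ^ l : ℝ) := by
      field_simp
      ring
    rw [h5] at h4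
    linarith
  refine (hLam.trans hmain).trans ?_
  have := mul_le_mul_of_nonneg_left hHsum (by linarith : 0 ≤ 2 * δ)
  linarith

/-- The wave packet projection of `f` onto the lacunary part of a tree. -/
def treeFun (f : Cube N → ℝ) (P : Fam N) (ξ : Cube N) (l : ℕ) (a : Cube N) (x : Cube N) : ℝ :=
  ∑ k : Fin N, if l ≤ (k : ℕ) ∧ Agree l a x ∧ ξ k = true ∧ P k x ξ then coef f k ξ x else 0

theorem sum_mul_treeFun (f : Cube N → ℝ) {P : Fam N} (hP : P.Inv) (ξ : Cube N) (l : ℕ)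
    (a : Cube N) : ∑ x, f x * treeFun f P ξ l a x = energy f P ξ l a := by
  unfold treeFun energy
  simp_rw [Finset.mul_sum]
  rw [Finset.sum_comm, Finset.sum_comm (s := (Finset.univ : Finset (Cube N)))]
  refine Finset.sum_congr rfl fun k _ => ?_
  have h := sum_mul_avg k.2.le
    (fun x => if l ≤ (k : ℕ) ∧ Agree l a x ∧ ξ k = true ∧ P k x ξ then blk f k ξ x else 0)
    (fun y => rad k y * (wal ξ y * f y)) (fun x y hxy => by
      simp only [treeDiff_cond_iff hP ξ l a hxy, blk_congr f ξ hxy])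
  refine Eq.trans ?_ (h.symm.trans ?_)
  · refine Finset.sum_congr rfl fun x _ => ?_
    split_ifs
    · unfold coef; ring
    · ring
  · refine Finset.sum_congr rfl fun x _ => ?_
    split_ifs
    · rw [sq]; rfl
    · ring

theorem sum_treeFun_sq (f : Cube N → ℝ) {P : Fam N} (hP : P.Inv) (ξ : Cube N) (l : ℕ)
    (a : Cube N) : ∑ x, treeFun f P ξ l a x ^ 2 = energy f P ξ l a := by
  rw [← sum_treeDiff_sq, ← (isMDiff_treeDiff f hP ξ l a).sum_sq]
  refine Finset.sum_congr rfl fun x _ => ?_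
  have : treeFun f P ξ l a x = wal ξ x * part (treeDiff f P ξ l a) N x := by
    rw [part_self, Finset.mul_sum]
    refine Finset.sum_congr rfl fun k _ => ?_
    unfold treeDiff coef
    split_ifs <;> ring
  rw [this, mul_pow, sq (wal ξ x), wal_mul_self, one_mul, part_self]

/-- The integer with binary digits `ξ`. -/
def val (ξ : Cube N) : ℕ := Nat.ofBits ξ

theorem val_lt_of_agreeAbove {ξ η : Cube N} {k : Fin N} (h : AgreeAbove k ξ η)
    (hξ : ξ k = false) (hη : η k = true) : val ξ < val η := by
  refine Nat.lt_of_testBit k ?_ ?_ ?_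
  · rw [val, Nat.testBit_ofBits_lt _ _ k.2]; exact hξ
  · rw [val, Nat.testBit_ofBits_lt _ _ k.2]; exact hη
  · intro j hj
    by_cases hjN : j < N
    · rw [val, val, Nat.testBit_ofBits_lt _ _ hjN, Nat.testBit_ofBits_lt _ _ hjN]
      exact h ⟨j, hjN⟩ hj
    · rw [val, val, Nat.testBit_ofBits_ge _ _ (by omega), Nat.testBit_ofBits_ge _ _ (by omega)]

theorem treeFun_term_flip_gt (f : Cube N → ℝ) {P : Fam N} (hP : P.Inv) (ξ : Cube N) (l : ℕ)
    (a : Cube N) {k j : Fin N} (h : k < j) (x : Cube N) :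
    (if l ≤ (k : ℕ) ∧ Agree l a (flip j x) ∧ ξ k = true ∧ P k (flip j x) ξ
      then coef f k ξ (flip j x) else 0)
    = (if ξ j then -1 else 1) *
      (if l ≤ (k : ℕ) ∧ Agree l a x ∧ ξ k = true ∧ P k x ξ then coef f k ξ x else 0) := by
  simp only [treeDiff_cond_iff hP ξ l a (agree_flip (le_of_lt h) x).symm, coef_flip_gt f h]
  split_ifs <;> ring

theorem treeFun_term_flip_same (f : Cube N → ℝ) {P : Fam N} (hP : P.Inv) (ξ : Cube N) (l : ℕ)
    (a : Cube N) (k : Fin N) (x : Cube N) :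
    (if l ≤ (k : ℕ) ∧ Agree l a (flip k x) ∧ ξ k = true ∧ P k (flip k x) ξ
      then coef f k ξ (flip k x) else 0)
    = (if l ≤ (k : ℕ) ∧ Agree l a x ∧ ξ k = true ∧ P k x ξ then coef f k ξ x else 0) := by
  simp only [treeDiff_cond_iff hP ξ l a (agree_flip (le_refl (k : ℕ)) x).symm]
  split_ifs with h
  · exact coef_flip_same f h.2.2.1 x
  · rfl

/-- Tree projections are orthogonal when the later tree avoids the earlier one. -/
theorem sum_treeFun_mul_eq_zero (f : Cube N → ℝ) {P Q : Fam N} (hP : P.Inv) (hQ : Q.Inv)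
    {ξ η : Cube N} {l m : ℕ} {a b : Cube N} (hval : val ξ ≤ val η)
    (hdisj : ∀ k x n, Q k x n → ¬ Tree l a ξ k x n) :
    ∑ x, treeFun f P ξ l a x * treeFun f Q η m b x = 0 := by
  unfold treeFun
  simp_rw [Finset.sum_mul_sum]
  rw [Finset.sum_comm]
  refine Finset.sum_eq_zero fun k _ => ?_
  rw [Finset.sum_comm]
  refine Finset.sum_eq_zero fun j _ => ?_
  by_cases hag : ∃ i : Fin N, k < i ∧ j < i ∧ ξ i ≠ η i
  · obtain ⟨i, hki, hji, hne⟩ := hag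
    refine sum_eq_zero_of_flip i fun x => ?_
    rw [treeFun_term_flip_gt f hP ξ l a hki, treeFun_term_flip_gt f hQ η m b hji]
    have hs : ((if ξ i then -1 else 1) * (if η i then -1 else 1) : ℝ) = -1 := by
      cases hξ : ξ i <;> cases hη : η i <;> simp_all
    rw [mul_mul_mul_comm, hs, neg_one_mul]
  push Not at hag
  rcases lt_or_ge j k with hjk | hkj
  · by_cases hηk : η k = true
    · refine sum_eq_zero_of_flip k fun x => ?_
      rw [treeFun_term_flip_same f hP, treeFun_term_flip_gt f hQ η m b hjk, if_pos hηk]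
      ring
    · refine Finset.sum_eq_zero fun x _ => ?_
      rw [if_neg, zero_mul]
      rintro ⟨_, _, hξk, _⟩
      have := val_lt_of_agreeAbove (k := k) (ξ := η) (η := ξ)
        (fun i hi => (hag i hi (lt_trans hjk hi)).symm) (by simpa using hηk) hξk
      omega
  · refine Finset.sum_eq_zero fun x _ => ?_
    by_cases h1 : l ≤ (k : ℕ) ∧ Agree l a x ∧ ξ k = true ∧ P k x ξ
    · rw [if_neg (c := m ≤ (j : ℕ) ∧ _), mul_zero]
      rintro ⟨_, _, _, h2⟩
      exact hdisj j x η h2 ⟨h1.1.trans hkj, h1.2.1, fun i hi => hag i (lt_of_le_of_lt hkj hi) hi⟩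
    · rw [if_neg h1, zero_mul]

theorem energy_eq_zero_of_disjoint (f : Cube N → ℝ) {P : Fam N} {ξ : Cube N} {l : ℕ} {a : Cube N}
    (h : ∀ k x n, P k x n → ¬ Tree l a ξ k x n) : energy f P ξ l a = 0 := by
  refine Finset.sum_eq_zero fun x _ => Finset.sum_eq_zero fun k _ => ?_
  rw [if_neg]
  rintro ⟨h1, h2, _, h4⟩
  exact h k x ξ h4 ⟨h1, h2, AgreeAbove.refl _ _⟩

theorem exists_peel_finset {f : Cube N → ℝ} {G : Finset (Cube N)} {ν : Cube N → Cube N}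
    {σ δ : ℝ} (hσ : 0 < σ) (hδ : 0 ≤ δ) (s : Finset (Fin N × Cube N × Cube N)) :
    ∀ P : Fam N, P.Inv → DensLE G ν δ P → SizeLE f (2 * σ) P →
      ∃ (P' : Fam N) (g : Cube N → ℝ) (A : ℝ), P'.Inv ∧ (∀ k x n, P' k x n → P k x n) ∧ 0 ≤ A ∧
        (∀ t ∈ s, energy f P' t.2.2 t.1 t.2.1 ≤ σ ^ 2 * (2 ^ N / 2 ^ (t.1 : ℕ))) ∧
        Lam f G ν P ≤ Lam f G ν P' + 20 * δ * σ * A ∧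
        ∑ x, f x * g x = ∑ x, g x ^ 2 ∧ σ ^ 2 * A ≤ ∑ x, g x ^ 2 ∧
        ∀ (l : ℕ) (a ξ : Cube N), (∀ t ∈ s, val ξ ≤ val t.2.2) →
          (∀ k x n, P k x n → ¬ Tree l a ξ k x n) →
          ∀ R : Fam N, R.Inv → ∑ x, treeFun f R ξ l a x * g x = 0 := by
  refine Finset.induction_on_min_value (fun t : Fin N × Cube N × Cube N => val t.2.2) s ?_ ?_
  · intro P hP _ _
    exact ⟨P, 0, 0, hP, fun _ _ _ h => h, le_rfl, by simp, by simp, by simp, by simp, by simp⟩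
  · intro t s ht hmin ih P hP hD hS
    obtain ⟨l, a, ξ⟩ := t
    by_cases hE : energy f P ξ l a ≤ σ ^ 2 * (2 ^ N / 2 ^ (l : ℕ))
    · obtain ⟨P', g, A, h1, h2, h3, h4, h5, h6, h7, h8⟩ := ih P hP hD hS
      refine ⟨P', g, A, h1, h2, h3, ?_, h5, h6, h7, ?_⟩
      · intro t ht
        rcases Finset.mem_insert.1 ht with rfl | ht
        · exact (energy_mono f h2 _ _ _).trans hE
        · exact h4 t ht
      · exact fun l' a' ξ' hv => h8 l' a' ξ' fun t ht => hv t (Finset.mem_insert_of_mem ht)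
    set P1 : Fam N := fun k x n => P k x n ∧ ¬ Tree l a ξ k x n with hP1
    have hP1P : ∀ k x n, P1 k x n → P k x n := fun _ _ _ h => h.1
    have hP1T : ∀ k x n, P1 k x n → ¬ Tree l a ξ k x n := fun _ _ _ h => h.2
    obtain ⟨P', g, A, h1, h2, h3, h4, h5, h6, h7, h8⟩ :=
      ih P1 (hP.and (tree_inv _ _ _).not) (hD.mono hP1P) (hS.mono hP1P)
    have horth : ∑ x, treeFun f P ξ l a x * g x = 0 := h8 l a ξ hmin hP1T P hP
    have hfT := sum_mul_treeFun f hP ξ l a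
    have hTT := sum_treeFun_sq f hP ξ l a
    have hsq : ∑ x, (treeFun f P ξ l a x + g x) ^ 2 = energy f P ξ l a + ∑ x, g x ^ 2 := by
      have : ∀ x, (treeFun f P ξ l a x + g x) ^ 2
          = treeFun f P ξ l a x ^ 2 + 2 * (treeFun f P ξ l a x * g x) + g x ^ 2 := fun x => by ring
      simp_rw [this, Finset.sum_add_distrib]
      rw [← Finset.mul_sum, horth, hTT]
      ring
    refine ⟨P', fun x => treeFun f P ξ l a x + g x, 2 ^ N / 2 ^ (l : ℕ) + A, h1,
      fun k x n h => hP1P k x n (h2 k x n h), by positivity, ?_, ?_, ?_, ?_, ?_⟩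
    · intro t ht
      rcases Finset.mem_insert.1 ht with rfl | ht
      · rw [energy_eq_zero_of_disjoint f fun k x n h => hP1T k x n (h2 k x n h)]
        positivity
      · exact h4 t ht
    · have h9 := Lam_le_add f G ν P (Tree l a ξ)
      have h10 := Lam_tree_le hP (by linarith : 0 < 2 * σ) hδ hS hD l.2.le a ξ
      linarith
    · simp_rw [mul_add, Finset.sum_add_distrib]
      rw [hsq, hfT, h6]
    · rw [hsq]
      push Not at hE
      linarith
    · intro l' a' ξ' hv hT R hR
      simp_rw [mul_add, Finset.sum_add_distrib]
      rw [sum_treeFun_mul_eq_zero f hR hP (hv _ (Finset.mem_insert_self _ _)) hT, zero_add]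
      exact h8 l' a' ξ' (fun t ht => hv t (Finset.mem_insert_of_mem ht))
        (fun k x n h => hT k x n (hP1P k x n h)) R hR

/-- Halving the size of a family by removing trees. -/
theorem exists_peel {f : Cube N → ℝ} {G : Finset (Cube N)} {ν : Cube N → Cube N}
    {σ δ : ℝ} (hσ : 0 < σ) (hδ : 0 ≤ δ) {P : Fam N} (hP : P.Inv) (hD : DensLE G ν δ P)
    (hS : SizeLE f (2 * σ) P) :
    ∃ P' : Fam N, P'.Inv ∧ (∀ k x n, P' k x n → P k x n) ∧ SizeLE f σ P' ∧
      Lam f G ν P ≤ Lam f G ν P' + 20 * δ * (∑ x, f x ^ 2) / σ := by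
  obtain ⟨P', g, A, h1, h2, h3, h4, h5, h6, h7, -⟩ :=
    exists_peel_finset hσ hδ Finset.univ P hP hD hS
  refine ⟨P', h1, h2, ?_, ?_⟩
  · intro l hl a ξ
    rcases hl.lt_or_eq with hl | rfl
    · exact h4 (⟨l, hl⟩, a, ξ) (Finset.mem_univ _)
    · have : energy f P' ξ l a = 0 :=
        Finset.sum_eq_zero fun x _ => Finset.sum_eq_zero fun k _ => by
          rw [if_neg]
          rintro ⟨h, _⟩
          have := k.2
          omega
      rw [this]
      positivity
  · have hfg : 2 * ∑ x, f x * g x ≤ ∑ x, f x ^ 2 + ∑ x, g x ^ 2 := by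
      rw [Finset.mul_sum, ← Finset.sum_add_distrib]
      exact Finset.sum_le_sum fun x _ => by nlinarith [sq_nonneg (f x - g x)]
    have hA : σ ^ 2 * A ≤ ∑ x, f x ^ 2 := by linarith
    have : σ * A ≤ (∑ x, f x ^ 2) / σ := by
      rw [le_div_iff₀ hσ]
      linarith
    have h9 := mul_le_mul_of_nonneg_left this (by linarith : 0 ≤ 20 * δ)
    rw [mul_div_assoc]
    linarith

theorem exists_peel_iterate {f : Cube N → ℝ} {G : Finset (Cube N)} {ν : Cube N → Cube N}
    {σ δ : ℝ} (hσ : 0 < σ) (hδ : 0 ≤ δ) (m : ℕ) : ∀ {P : Fam N}, P.Inv → DensLE G ν δ P →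
    SizeLE f (2 ^ m * σ) P →
    ∃ P' : Fam N, P'.Inv ∧ (∀ k x n, P' k x n → P k x n) ∧ SizeLE f σ P' ∧
      Lam f G ν P ≤ Lam f G ν P' + 40 * δ * (∑ x, f x ^ 2) / σ * (1 - (1 / 2) ^ m) := by
  induction m with
  | zero =>
    intro P hP _ hS
    exact ⟨P, hP, fun _ _ _ h => h, by simpa using hS, by simp⟩
  | succ m ih =>
    intro P hP hD hS
    obtain ⟨P1, h1, h2, h3, h4⟩ := exists_peel (σ := 2 ^ m * σ) (by positivity) hδ hP hD
      (by rwa [pow_succ, mul_comm (2 ^ m : ℝ) 2, mul_assoc] at hS)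
    obtain ⟨P2, h5, h6, h7, h8⟩ := ih h1 (hD.mono h2) h3
    refine ⟨P2, h5, fun k x n h => h2 k x n (h6 k x n h), h7, ?_⟩
    have : 20 * δ * (∑ x, f x ^ 2) / (2 ^ m * σ)
        = 20 * δ * (∑ x, f x ^ 2) / σ * (1 / 2) ^ m := by
      rw [one_div, inv_pow]
      field_simp
    rw [this] at h4
    rw [pow_succ]
    have e : 40 * δ * (∑ x, f x ^ 2) / σ = 2 * (20 * δ * (∑ x, f x ^ 2) / σ) := by ring
    rw [e] at h8 ⊢
    linarith

theorem exists_sizeLE (f : Cube N → ℝ) {σ : ℝ} (hσ : 0 < σ) (P : Fam N) :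
    ∃ m : ℕ, SizeLE f (2 ^ m * σ) P := by
  set M : ℝ := ∑ ξ : Cube N, ∑ l ∈ Finset.range (N + 1), ∑ a : Cube N, energy f P ξ l a with hM
  have hle : ∀ l ≤ N, ∀ a ξ, energy f P ξ l a ≤ M := by
    intro l hl a ξ
    refine le_trans ?_ (Finset.single_le_sum (fun ξ _ => Finset.sum_nonneg fun l _ =>
      Finset.sum_nonneg fun a _ => energy_nonneg f P ξ l a) (Finset.mem_univ ξ))
    refine le_trans ?_ (Finset.single_le_sum (fun l _ =>
      Finset.sum_nonneg fun a _ => energy_nonneg f P ξ l a)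
      (Finset.mem_range.2 (Nat.lt_succ_of_le hl)))
    exact Finset.single_le_sum (fun a _ => energy_nonneg f P ξ l a) (Finset.mem_univ a)
  obtain ⟨m, hm⟩ := pow_unbounded_of_one_lt (max (M / σ ^ 2) 1) (one_lt_two)
  refine ⟨m, fun l hl a ξ => (hle l hl a ξ).trans ?_⟩
  have h1 : M / σ ^ 2 < 2 ^ m := (le_max_left _ _).trans_lt hm
  rw [div_lt_iff₀ (by positivity)] at h1
  have h2 : (1 : ℝ) ≤ 2 ^ m := one_le_pow₀ one_le_two
  have h3 : (1 : ℝ) ≤ 2 ^ N / 2 ^ l := by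
    rw [le_div_iff₀ (by positivity), one_mul]
    exact pow_le_pow_right₀ one_le_two hl
  have h4 : (2 : ℝ) ^ m * σ ^ 2 ≤ (2 ^ m * σ) ^ 2 := by
    rw [mul_pow]
    exact mul_le_mul_of_nonneg_right (by nlinarith) (sq_nonneg _)
  calc M ≤ 2 ^ m * σ ^ 2 := h1.le
    _ ≤ (2 ^ m * σ) ^ 2 := h4
    _ ≤ _ := le_mul_of_one_le_right (sq_nonneg _) h3

/-- Reduction of a family to one of small size. -/
theorem exists_sizeLE_subfamily {f : Cube N → ℝ} {G : Finset (Cube N)} {ν : Cube N → Cube N}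
    {σ δ : ℝ} (hσ : 0 < σ) (hδ : 0 ≤ δ) {P : Fam N} (hP : P.Inv) (hD : DensLE G ν δ P) :
    ∃ P' : Fam N, P'.Inv ∧ (∀ k x n, P' k x n → P k x n) ∧ SizeLE f σ P' ∧
      Lam f G ν P ≤ Lam f G ν P' + 40 * δ * (∑ x, f x ^ 2) / σ := by
  obtain ⟨m, hm⟩ := exists_sizeLE f hσ P
  obtain ⟨P', h1, h2, h3, h4⟩ := exists_peel_iterate hσ hδ m hP hD hm
  refine ⟨P', h1, h2, h3, h4.trans ?_⟩
  have h5 : 0 ≤ 40 * δ * (∑ x, f x ^ 2) / σ :=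
    div_nonneg (mul_nonneg (by linarith) (Finset.sum_nonneg fun x _ => sq_nonneg _)) hσ.le
  have h6 : (0 : ℝ) ≤ (1 / 2) ^ m := by positivity
  nlinarith

theorem mass_inter_tree {G : Finset (Cube N)} {ν : Cube N → Cube N} {l l' : ℕ} (hl : l' ≤ l)
    {a b ξ η y : Cube N} (hy : y ∈ mass G ν l a ξ) (hy' : y ∈ mass G ν l' b η) {k : Fin N}
    {x n : Cube N} (h : Tree l a ξ k x n) : Tree l' b η k x n := by
  obtain ⟨-, h1, h2⟩ := Finset.mem_filter.1 hy
  obtain ⟨-, h3, h4⟩ := Finset.mem_filter.1 hy'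
  refine ⟨hl.trans h.1, h3.trans ((h1.mono hl).symm.trans (h.2.1.mono hl)), ?_⟩
  exact (h4.mono (hl.trans h.1)).trans ((h2.mono h.1).symm.trans h.2.2)

theorem Lam_congr (f : Cube N → ℝ) (G : Finset (Cube N)) (ν : Cube N → Cube N) {P Q : Fam N}
    (h : ∀ k x n, P k x n ↔ Q k x n) : Lam f G ν P = Lam f G ν Q := by
  congr 1
  funext k x n
  exact propext (h k x n)

theorem Lam_eq_zero (f : Cube N → ℝ) {G : Finset (Cube N)} {ν : Cube N → Cube N} {P : Fam N}
    (h : ∀ k, ∀ x ∈ G, ¬ P k x (ν x)) : Lam f G ν P = 0 := by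
  refine Finset.sum_eq_zero fun x hx => ?_
  rw [carl, Finset.sum_eq_zero fun k _ => if_neg fun hk => h k x hx hk.2, abs_zero]

theorem Fam.inv_not_exists_tree (s : Finset (Fin N × Cube N × Cube N)) :
    Fam.Inv (fun k x n => ¬ ∃ q ∈ s, Tree q.1 q.2.1 q.2.2 k x n) :=
  Fam.Inv.not (P := fun k x n => ∃ q ∈ s, Tree q.1 q.2.1 q.2.2 k x n)
    fun k x y n m h h' ⟨q, hq, hT⟩ => ⟨q, hq, tree_inv _ _ _ k x y n m h h' hT⟩

theorem exists_cover_finset {f : Cube N → ℝ} {G : Finset (Cube N)} {ν : Cube N → Cube N}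
    {σ δ : ℝ} (hσ : 0 < σ) (hδ : 0 ≤ δ) {H : Fam N} (hH : H.Inv) (hD : DensLE G ν (2 * δ) H)
    (hS : SizeLE f σ H) (s : Finset (Fin N × Cube N × Cube N)) :
    (∀ q ∈ s, δ * (2 ^ N / 2 ^ (q.1 : ℕ)) < (mass G ν q.1 q.2.1 q.2.2).card) →
      ∃ A : ℝ, 0 ≤ A ∧ δ * A ≤ (s.biUnion fun q => mass G ν q.1 q.2.1 q.2.2).card ∧
        Lam f G ν H ≤ Lam f G ν (fun k x n => H k x n ∧ ¬ ∃ q ∈ s, Tree q.1 q.2.1 q.2.2 k x n)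
          + 20 * σ * (δ * A) := by
  refine Finset.induction_on_max_value (fun q : Fin N × Cube N × Cube N => q.1) s ?_ ?_
  · exact fun _ => ⟨0, le_rfl, by simp, by simp⟩
  · intro q s hq hmax ih hheavy
    obtain ⟨A, hA, hA1, hA2⟩ := ih fun q hq => hheavy q (Finset.mem_insert_of_mem hq)
    by_cases hint : ∃ p ∈ s, ∃ y, y ∈ mass G ν q.1 q.2.1 q.2.2 ∧ y ∈ mass G ν p.1 p.2.1 p.2.2
    · obtain ⟨p, hp, y, hy, hy'⟩ := hint
      refine ⟨A, hA, hA1.trans ?_, hA2.trans (le_of_eq ?_)⟩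
      · exact_mod_cast Finset.card_le_card
          (Finset.biUnion_subset_biUnion_of_subset_left _ (Finset.subset_insert q s))
      · congr 1
        refine Lam_congr f G ν fun k x n => and_congr_right fun _ => not_congr ⟨?_, ?_⟩
        · rintro ⟨r, hr, hT⟩
          exact ⟨r, Finset.mem_insert_of_mem hr, hT⟩
        · rintro ⟨r, hr, hT⟩
          rcases Finset.mem_insert.1 hr with rfl | hr
          · exact ⟨p, hp, mass_inter_tree (hmax p hp) hy hy' hT⟩
          · exact ⟨r, hr, hT⟩
    · refine ⟨2 ^ N / 2 ^ (q.1 : ℕ) + A, by positivity, ?_, ?_⟩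
      · rw [Finset.biUnion_insert, Finset.card_union_of_disjoint, Nat.cast_add, mul_add]
        · exact add_le_add (hheavy q (Finset.mem_insert_self _ _)).le hA1
        · rw [Finset.disjoint_left]
          intro y hy hy'
          obtain ⟨p, hp, hyp⟩ := Finset.mem_biUnion.1 hy'
          exact hint ⟨p, hp, y, hy, hyp⟩
      · set H1 : Fam N := fun k x n => H k x n ∧ ¬ ∃ q ∈ s, Tree q.1 q.2.1 q.2.2 k x n with hH1
        have hH1H : ∀ k x n, H1 k x n → H k x n := fun _ _ _ h => h.1
        have h1 := Lam_le_add f G ν H1 (Tree q.1 q.2.1 q.2.2)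
        have h2 := Lam_tree_le (hH.and (Fam.inv_not_exists_tree s)) hσ (by linarith : 0 ≤ 2 * δ)
          (hS.mono hH1H) (hD.mono hH1H) q.1.2.le q.2.1 q.2.2
        have h3 : Lam f G ν (fun k x n => H1 k x n ∧ ¬ Tree q.1 q.2.1 q.2.2 k x n)
            = Lam f G ν (fun k x n => H k x n ∧
              ¬ ∃ p ∈ insert q s, Tree p.1 p.2.1 p.2.2 k x n) := by
          refine Lam_congr f G ν fun k x n => ?_
          simp only [hH1, Finset.exists_mem_insert]
          exact ⟨fun h => ⟨h.1.1, fun h' => h'.elim h.2 h.1.2⟩,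
            fun h => ⟨⟨h.1, fun h' => h.2 (Or.inr h')⟩, fun h' => h.2 (Or.inl h')⟩⟩
        rw [h3] at h1
        change Lam f G ν (fun k x n => H1 k x n ∧ Tree q.1 q.2.1 q.2.2 k x n) ≤ _ at h2
        linarith

/-- The tile lies below a tree top of density more than `δ`. -/
def Heavy (G : Finset (Cube N)) (ν : Cube N → Cube N) (δ : ℝ) : Fam N := fun k x n =>
  ∃ l : Fin N, l ≤ k ∧ ∃ m, AgreeAbove k n m ∧ δ * (2 ^ N / 2 ^ (l : ℕ)) < (mass G ν l x m).card

theorem mass_congr (G : Finset (Cube N)) (ν : Cube N → Cube N) {l : ℕ} {x y : Cube N}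
    (h : Agree l x y) (m : Cube N) : mass G ν l x m = mass G ν l y m := by
  refine Finset.filter_congr fun z _ => and_congr_left fun _ => ?_
  exact ⟨fun h1 => h.symm.trans h1, fun h1 => h.trans h1⟩

theorem heavy_inv (G : Finset (Cube N)) (ν : Cube N → Cube N) (δ : ℝ) : (Heavy G ν δ).Inv := by
  rintro k x y n m h h' ⟨l, hl, p, hp, hc⟩
  exact ⟨l, hl, p, h'.symm.trans hp, by rwa [← mass_congr G ν (h.mono hl)]⟩

theorem densLE_not_heavy (G : Finset (Cube N)) (ν : Cube N → Cube N) (δ : ℝ) :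
    DensLE G ν δ (fun k x n => ¬ Heavy G ν δ k x n) := by
  intro k x m h l hl m' hm'
  by_contra hc
  push Not at hc
  exact h ⟨⟨l, hl.trans_lt k.2⟩, hl, m', hm', hc⟩

theorem Lam_heavy_le {f : Cube N → ℝ} {G : Finset (Cube N)} {ν : Cube N → Cube N}
    {σ δ : ℝ} (hσ : 0 < σ) (hδ : 0 ≤ δ) {H : Fam N} (hH : H.Inv) (hD : DensLE G ν (2 * δ) H)
    (hS : SizeLE f σ H) (hheavy : ∀ k x n, H k x n → Heavy G ν δ k x n) :
    Lam f G ν H ≤ 20 * σ * G.card := by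
  obtain ⟨A, hA, hA1, hA2⟩ := exists_cover_finset hσ hδ hH hD hS
    (Finset.univ.filter fun q : Fin N × Cube N × Cube N =>
      δ * (2 ^ N / 2 ^ (q.1 : ℕ)) < (mass G ν q.1 q.2.1 q.2.2).card)
    fun q hq => (Finset.mem_filter.1 hq).2
  refine hA2.trans ((add_le_add (Lam_eq_zero f ?_).le ?_).trans_eq (zero_add _))
  rotate_left
  · have h1 : δ * A ≤ G.card := by
      refine hA1.trans ?_
      exact_mod_cast Finset.card_le_card
        (Finset.biUnion_subset.2 fun q _ => Finset.filter_subset _ _)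
    exact mul_le_mul_of_nonneg_left h1 (by linarith)
  · rintro k x - ⟨h1, h2⟩
    obtain ⟨l, hl, m, hm, hc⟩ := hheavy _ _ _ h1
    exact h2 ⟨(l, x, m), Finset.mem_filter.2 ⟨Finset.mem_univ _, hc⟩, hl, Agree.refl _ _, hm.symm⟩

theorem exists_level {f : Cube N → ℝ} {G : Finset (Cube N)} {ν : Cube N → Cube N} {σ₀ : ℝ}
    (hσ₀ : 0 < σ₀) {P : Fam N} (hP : P.Inv) (hD : DensLE G ν 1 P) (hS : SizeLE f σ₀ P)
    (b : ℕ → ℝ) (hb : ∀ i, 20 * σ₀ * G.card ≤ b i ∨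
      ∃ σ > 0, 20 * σ * G.card + 40 * (1 / 2) ^ i * (∑ x, f x ^ 2) / σ ≤ b i) (J : ℕ) :
    ∃ P' : Fam N, P'.Inv ∧ (∀ k x n, P' k x n → P k x n) ∧ DensLE G ν ((1 / 2) ^ J) P' ∧
      Lam f G ν P ≤ Lam f G ν P' + ∑ i ∈ Finset.range J, b i := by
  induction J with
  | zero => exact ⟨P, hP, fun _ _ _ h => h, by simpa using hD, by simp⟩
  | succ J ih =>
    obtain ⟨P', h1, h2, h3, h4⟩ := ih
    set δ : ℝ := (1 / 2) ^ (J + 1) with hδ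
    have hδ0 : 0 ≤ δ := by positivity
    have hδ2 : (1 / 2) ^ J = 2 * δ := by rw [hδ, pow_succ]; ring
    rw [hδ2] at h3
    set H : Fam N := fun k x n => P' k x n ∧ Heavy G ν δ k x n with hHdef
    have hHP : ∀ k x n, H k x n → P' k x n := fun _ _ _ h => h.1
    have hHh : ∀ k x n, H k x n → Heavy G ν δ k x n := fun _ _ _ h => h.2
    have hHi : H.Inv := h1.and (heavy_inv G ν δ)
    refine ⟨fun k x n => P' k x n ∧ ¬ Heavy G ν δ k x n, h1.and (heavy_inv G ν δ).not,
      fun k x n h => h2 k x n h.1, (densLE_not_heavy G ν δ).mono fun _ _ _ h => h.2, ?_⟩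
    have h5 := Lam_le_add f G ν P' (Heavy G ν δ)
    have h6 : Lam f G ν H ≤ b J := by
      rcases hb J with h | ⟨σ, hσ, h⟩
      · exact (Lam_heavy_le hσ₀ hδ0 hHi (h3.mono hHP)
          (hS.mono fun k x n h => h2 k x n (hHP k x n h)) hHh).trans h
      · obtain ⟨Q, hQ1, hQ2, hQ3, hQ4⟩ := exists_sizeLE_subfamily hσ (by linarith : 0 ≤ 2 * δ) hHi
          (h3.mono hHP)
        have h7 := Lam_heavy_le hσ hδ0 hQ1 (h3.mono fun k x n h => hHP k x n (hQ2 k x n h)) hQ3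
          fun k x n h => hHh k x n (hQ2 k x n h)
        rw [hδ2] at h
        linarith
    rw [Finset.sum_range_succ]
    change Lam f G ν P' ≤ _ + Lam f G ν H at h5
    linarith

theorem mass_card_le (G : Finset (Cube N)) (ν : Cube N → Cube N) {l : ℕ} (hl : l ≤ N)
    (x m : Cube N) : ((mass G ν l x m).card : ℝ) ≤ 2 ^ N / 2 ^ l := by
  rw [← sum_agree hl x, ← Finset.sum_filter, Finset.sum_const, nsmul_eq_mul, mul_one]
  refine Nat.cast_le.2 (Finset.card_le_card fun y hy => ?_)
  exact Finset.mem_filter.2 ⟨Finset.mem_univ _, (Finset.mem_filter.1 hy).2.1⟩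

theorem Lam_le_of_sizeLE {f : Cube N → ℝ} {G : Finset (Cube N)} {ν : Cube N → Cube N} {σ₀ : ℝ}
    (hσ₀ : 0 < σ₀) {P : Fam N} (hP : P.Inv) (hS : SizeLE f σ₀ P)
    (b : ℕ → ℝ) (hb : ∀ i, 20 * σ₀ * G.card ≤ b i ∨
      ∃ σ > 0, 20 * σ * G.card + 40 * (1 / 2) ^ i * (∑ x, f x ^ 2) / σ ≤ b i) :
    ∃ J : ℕ, Lam f G ν P ≤ ∑ i ∈ Finset.range J, b i := by
  have hD : DensLE G ν 1 P := fun k x m _ l hl m' _ => by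
    rw [one_mul]; exact mass_card_le G ν (hl.trans k.2.le) x m'
  obtain ⟨P', h1, h2, h3, h4⟩ := exists_level hσ₀ hP hD hS b hb (N + 1)
  refine ⟨N + 1, h4.trans (le_of_eq (add_eq_right.2 (Lam_eq_zero f ?_)))⟩
  intro k x hx hk
  have h5 := h3 k x (ν x) hk k le_rfl (ν x) (AgreeAbove.refl _ _)
  have hx' : x ∈ mass G ν k x (ν x) :=
    Finset.mem_filter.2 ⟨hx, Agree.refl _ _, AgreeAbove.refl _ _⟩
  have h6 : 1 ≤ ((mass G ν k x (ν x)).card : ℝ) :=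
    Nat.one_le_cast.2 (Finset.card_pos.2 ⟨x, hx'⟩)
  have h7 : (2 : ℝ) ^ N / 2 ^ (k : ℕ) ≤ 2 ^ N :=
    div_le_self (by positivity) (one_le_pow₀ one_le_two)
  have h8 : ((1 / 2) ^ (N + 1) : ℝ) * 2 ^ N = 1 / 2 := by
    rw [one_div, inv_pow, pow_succ]
    field_simp
  have h9 := mul_le_mul_of_nonneg_left h7 (by positivity : (0 : ℝ) ≤ (1 / 2) ^ (N + 1))
  have h10 := (h6.trans h5).trans (h9.trans h8.le)
  norm_num at h10

/-- The partial Walsh sums in the finite model. -/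
def cubeSum (f : Cube N → ℝ) (n x : Cube N) : ℝ := ∑ k, if n k = true then coef f k n x else 0

/-- The set of points over which `f` has a controlled dyadic maximal function. -/
def good (f : Cube N → ℝ) (lam : ℝ) : Fam N := fun k x _ =>
  ∀ j ≤ (k : ℕ), avg j (fun y => |f y|) x ≤ lam

theorem good_inv (f : Cube N → ℝ) (lam : ℝ) : (good f lam).Inv := by
  intro k x y n m h _ hg j hj
  rw [← avg_congr _ (h.mono hj)]
  exact hg j hj

theorem sizeLE_good (f : Cube N → ℝ) {lam : ℝ} (hlam : 0 ≤ lam) :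
    SizeLE f (3 * lam) (good f lam) := by
  intro l hl a ξ
  refine le_trans ?_ (sum_good_sq_le (fun y => wal ξ y * f y) hlam hl a)
  refine Finset.sum_le_sum fun x _ => Finset.sum_le_sum fun k _ => ?_
  have : ∀ y, |wal ξ y * f y| = |f y| := fun y => by rw [abs_mul, abs_wal, one_mul]
  simp only [this]
  by_cases h : l ≤ (k : ℕ) ∧ Agree l a x ∧ ξ k = true ∧ good f lam k x ξ
  · rw [if_pos h, if_pos ⟨h.1, h.2.1, h.2.2.2⟩]
    rfl
  · rw [if_neg h]
    split_ifs <;> positivity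

theorem sum_geom_le {r : ℝ} (h0 : 0 ≤ r) (h1 : r < 1) (J : ℕ) :
    ∑ i ∈ Finset.range J, r ^ i ≤ 1 / (1 - r) := by
  rw [geom_sum_eq h1.ne, one_div, ← neg_div_neg_eq, neg_sub, neg_sub, ← one_div]
  exact div_le_div_of_nonneg_right (by linarith [pow_nonneg h0 J]) (by linarith)

/-- The restricted weak type estimate for the maximal partial sums in the finite model. -/
theorem mul_card_cubeSum_le {f : Cube N → ℝ} {α : ℝ} (hα : 0 < α) (hf1 : ∀ x, |f x| ≤ 1)
    (hfα : ∑ x, |f x| ≤ α * 2 ^ N) {i₀ : ℕ} (hi₀ : 1 ≤ 2 ^ i₀ * α) {lam : ℝ} (hlam : 0 ≤ lam) :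
    lam * (Finset.univ.filter fun x : Cube N => ∃ n, lam < |cubeSum f n x|).card
      ≤ 400 * α * (i₀ + 1) * 2 ^ N := by
  set G := Finset.univ.filter fun x : Cube N => ∃ n, lam < |cubeSum f n x| with hG
  rcases Finset.eq_empty_or_nonempty G with hGe | hGn
  · rw [hGe]
    simp only [Finset.card_empty, Nat.cast_zero, mul_zero]
    positivity
  have hg : (0 : ℝ) < G.card := by exact_mod_cast Finset.card_pos.2 hGn
  set M : ℝ := α * 2 ^ N with hM
  have hM0 : 0 < M := by positivity
  set lam0 : ℝ := 2 * M / G.card with hlam0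
  have hlam0p : 0 < lam0 := by positivity
  set Ω := Finset.univ.filter fun x : Cube N => ∃ j ≤ N, lam0 < avg j (fun y => |f y|) x with hΩ
  have hΩc : (Ω.card : ℝ) ≤ G.card / 2 := by
    have h1 := (card_maximal_le (fun y => |f y|) (fun y => abs_nonneg _) (lam := lam0)).trans hfα
    rw [← hΩ, hlam0, div_mul_eq_mul_div, div_le_iff₀ hg] at h1
    have : M * (2 * Ω.card) ≤ M * G.card := by linarith
    have := le_of_mul_le_mul_left this hM0
    linarith
  have hch : ∀ x : Cube N, ∃ n, x ∈ G → lam < |cubeSum f n x| := by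
    intro x
    by_cases hx : x ∈ G
    · obtain ⟨n, hn⟩ := (Finset.mem_filter.1 hx).2
      exact ⟨n, fun _ => hn⟩
    · exact ⟨x, fun h => absurd h hx⟩
  choose ν hν using hch
  have hF : ∑ x, f x ^ 2 ≤ M := by
    refine (Finset.sum_le_sum fun x _ => ?_).trans hfα
    rw [← sq_abs, sq]
    exact mul_le_of_le_one_left (abs_nonneg _) (hf1 x)
  have hsub : ((G \ Ω).card : ℝ) ≤ G.card := by
    exact_mod_cast Finset.card_le_card Finset.sdiff_subset
  have hGN : (G.card : ℝ) ≤ 2 ^ N := by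
    have : G.card ≤ Fintype.card (Cube N) := Finset.card_le_univ _
    simp only [Fintype.card_fun, Fintype.card_fin, Fintype.card_bool] at this
    exact_mod_cast this
  obtain ⟨J, hJ⟩ := Lam_le_of_sizeLE (G := G \ Ω) (ν := ν) (by linarith : 0 < 3 * lam0)
    (good_inv f lam0) (sizeLE_good f hlam0p.le)
    (fun i => if i < i₀ then 120 * M
      else 20 * M * (3 / 4) ^ (i - i₀) + 40 * M * (2 / 3) ^ (i - i₀)) (by
    intro i
    by_cases hi : i < i₀
    · left
      rw [if_pos hi]
      have : lam0 * G.card = 2 * M := by rw [hlam0]; field_simp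
      nlinarith
    · right
      obtain ⟨j, rfl⟩ : ∃ j, i = i₀ + j := ⟨i - i₀, by omega⟩
      rw [if_neg hi, Nat.add_sub_cancel_left]
      refine ⟨M / G.card * (3 / 4) ^ j, by positivity, add_le_add ?_ ?_⟩
      · calc 20 * (M / G.card * (3 / 4) ^ j) * ((G \ Ω).card : ℝ)
            ≤ 20 * (M / G.card * (3 / 4) ^ j) * G.card :=
              mul_le_mul_of_nonneg_left hsub (by positivity)
          _ = 20 * M * (3 / 4) ^ j := by field_simp
      · have h1 : 40 * (1 / 2) ^ (i₀ + j) * (∑ x, f x ^ 2) / (M / G.card * (3 / 4) ^ j)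
            ≤ 40 * (1 / 2) ^ (i₀ + j) * M / (M / G.card * (3 / 4) ^ j) :=
          div_le_div_of_nonneg_right (mul_le_mul_of_nonneg_left hF (by positivity)) (by positivity)
        refine h1.trans ?_
        have h2 : 40 * (1 / 2) ^ (i₀ + j) * M / (M / G.card * (3 / 4) ^ j)
            = 40 * (2 / 3 : ℝ) ^ j * ((1 / 2) ^ i₀ * G.card) := by
          have : (2 / 3 : ℝ) ^ j = (1 / 2) ^ j / (3 / 4) ^ j := by
            rw [← div_pow]; norm_num
          rw [this, pow_add]
          field_simp
        have h3 : (1 / 2) ^ i₀ * (G.card : ℝ) ≤ M := by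
          have h4 : (1 / 2) ^ i₀ * (1 : ℝ) ≤ (1 / 2) ^ i₀ * (2 ^ i₀ * α) :=
            mul_le_mul_of_nonneg_left hi₀ (by positivity)
          have h5 : (1 / 2 : ℝ) ^ i₀ * (2 ^ i₀ * α) = α := by
            rw [← mul_assoc, ← mul_pow]; norm_num
          rw [h5, mul_one] at h4
          exact mul_le_mul h4 hGN hg.le hα.le
        rw [h2]
        have := mul_le_mul_of_nonneg_left h3 (by positivity : (0 : ℝ) ≤ 40 * (2 / 3) ^ j)
        linarith)
  have hsum : ∀ J, ∑ i ∈ Finset.range J, (if i < i₀ then 120 * M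
      else 20 * M * (3 / 4) ^ (i - i₀) + 40 * M * (2 / 3) ^ (i - i₀)) ≤ 120 * M * i₀ + 200 * M := by
    intro J
    have hle : ∑ i ∈ Finset.range J, (if i < i₀ then 120 * M
        else 20 * M * (3 / 4) ^ (i - i₀) + 40 * M * (2 / 3) ^ (i - i₀))
        ≤ ∑ i ∈ Finset.range (i₀ + J), (if i < i₀ then 120 * M
        else 20 * M * (3 / 4) ^ (i - i₀) + 40 * M * (2 / 3) ^ (i - i₀)) := by
      refine Finset.sum_le_sum_of_subset_of_nonneg
        (Finset.range_subset_range.2 (Nat.le_add_left _ _)) fun i _ _ => ?_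
      split_ifs <;> positivity
    refine hle.trans ?_
    rw [Finset.sum_range_add]
    refine add_le_add ?_ ?_
    · rw [Finset.sum_congr rfl fun i hi => if_pos (Finset.mem_range.1 hi), Finset.sum_const,
        Finset.card_range, nsmul_eq_mul]
      linarith
    · have h1 := sum_geom_le (r := 3 / 4) (by norm_num) (by norm_num) J
      have h2 := sum_geom_le (r := 2 / 3) (by norm_num) (by norm_num) J
      norm_num at h1 h2
      simp only [Nat.not_lt.2 (Nat.le_add_right i₀ _), if_false, Nat.add_sub_cancel_left]
      rw [Finset.sum_add_distrib, ← Finset.mul_sum, ← Finset.mul_sum]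
      nlinarith
  have hlow : lam * (G \ Ω).card ≤ Lam f (G \ Ω) ν (good f lam0) := by
    rw [mul_comm, ← nsmul_eq_mul]
    refine Finset.card_nsmul_le_sum _ _ _ fun x hx => ?_
    obtain ⟨hxG, hxΩ⟩ := Finset.mem_sdiff.1 hx
    refine (hν x hxG).le.trans (le_of_eq ?_)
    congr 1
    refine Finset.sum_congr rfl fun k _ => ?_
    have : good f lam0 k x (ν x) := by
      intro j hj
      by_contra hc
      exact hxΩ (Finset.mem_filter.2 ⟨Finset.mem_univ _, j, hj.trans k.2.le, not_le.1 hc⟩)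
    simp [this]
  have hcard : (G.card : ℝ) ≤ 2 * (G \ Ω).card := by
    have h1 : G.card ≤ (G \ Ω).card + Ω.card := by
      have := Finset.le_card_sdiff Ω G
      omega
    have h2 : (G.card : ℝ) ≤ (G \ Ω).card + Ω.card := by exact_mod_cast h1
    linarith
  have h1 := mul_le_mul_of_nonneg_left hcard hlam
  have h2 := hlow.trans (hJ.trans (hsum J))
  have h3 : 400 * α * (i₀ + 1) * 2 ^ N = 400 * M * i₀ + 400 * M := by rw [hM]; ring
  rw [h3]
  have h4 : 0 ≤ M * i₀ := by positivity
  linarith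

/-- The Walsh product of the sequence `r` at frequency `n`, truncated to `K` digits. -/
def walProd (K : ℕ) (r : ℕ → ℝ) (n : ℕ) : ℝ :=
  ∏ k ∈ Finset.range K, if n.testBit k then r k else 1

theorem walProd_succ_even (K : ℕ) (r : ℕ → ℝ) (n : ℕ) :
    walProd (K + 1) r (2 * n) = walProd K (fun i => r (i + 1)) n := by
  unfold walProd
  rw [Finset.prod_range_succ']
  simp [Nat.testBit_succ]

theorem walProd_succ_odd (K : ℕ) (r : ℕ → ℝ) (n : ℕ) :
    walProd (K + 1) r (2 * n + 1) = r 0 * walProd K (fun i => r (i + 1)) n := by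
  unfold walProd
  rw [Finset.prod_range_succ', mul_comm]
  have : (2 * n + 1) / 2 = n := by omega
  simp [Nat.testBit_succ, this]

theorem sum_range_two_mul (u : ℕ → ℝ) (n : ℕ) :
    ∑ m ∈ Finset.range (2 * n), u m = ∑ m ∈ Finset.range n, (u (2 * m) + u (2 * m + 1)) := by
  induction n with
  | zero => simp
  | succ n ih =>
    rw [Finset.sum_range_succ, ← ih, show 2 * (n + 1) = 2 * n + 1 + 1 by ring,
      Finset.sum_range_succ, Finset.sum_range_succ, add_assoc]

/-- Closed form of the Walsh–Dirichlet kernel. -/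
theorem sum_walProd (K : ℕ) : ∀ (r : ℕ → ℝ), (∀ i, r i * r i = 1) → ∀ n < 2 ^ K,
    ∑ m ∈ Finset.range n, walProd K r m = walProd K r n *
      ∑ k ∈ Finset.range K,
        if n.testBit k then r k * ∏ i ∈ Finset.range k, (1 + r i) else 0 := by
  induction K with
  | zero =>
    intro r _ n hn
    obtain rfl : n = 0 := by simpa using hn
    simp
  | succ K ih =>
    intro r hr n hn
    set q : ℕ → ℝ := fun i => r (i + 1) with hq
    have heven : ∀ m < 2 ^ K, ∑ i ∈ Finset.range (2 * m), walProd (K + 1) r i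
        = (1 + r 0) * (walProd K q m * ∑ k ∈ Finset.range K,
          if m.testBit k then q k * ∏ i ∈ Finset.range k, (1 + q i) else 0) := by
      intro m hm
      rw [sum_range_two_mul, ← ih q (fun i => hr _) m hm, Finset.mul_sum]
      refine Finset.sum_congr rfl fun i _ => ?_
      rw [walProd_succ_even, walProd_succ_odd]
      ring
    have hsum : ∀ m c, (∀ k, c = 2 * m ∨ c = 2 * m + 1 → c.testBit (k + 1) = m.testBit k) →
        (c = 2 * m ∨ c = 2 * m + 1) →
        ∑ k ∈ Finset.range K, (if c.testBit (k + 1) then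
          r (k + 1) * ∏ i ∈ Finset.range (k + 1), (1 + r i) else 0)
        = (1 + r 0) * ∑ k ∈ Finset.range K,
          if m.testBit k then q k * ∏ i ∈ Finset.range k, (1 + q i) else 0 := by
      intro m c h hc
      rw [Finset.mul_sum]
      refine Finset.sum_congr rfl fun k _ => ?_
      rw [h k hc, Finset.prod_range_succ']
      split_ifs
      · simp only [hq]; ring
      · ring
    have hbit : ∀ m c, ∀ k, c = 2 * m ∨ c = 2 * m + 1 → c.testBit (k + 1) = m.testBit k := by
      intro m c k hc
      rw [Nat.testBit_succ]
      congr 1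
      omega
    rw [Finset.sum_range_succ']
    obtain ⟨m, hm | hm⟩ : ∃ m, n = 2 * m ∨ n = 2 * m + 1 := ⟨n / 2, by omega⟩
    · rw [hsum m n (hbit m n) (Or.inl hm)]
      subst hm
      have hm : m < 2 ^ K := by rw [pow_succ] at hn; omega
      rw [heven m hm, walProd_succ_even]
      simp
      ring
    · rw [hsum m n (hbit m n) (Or.inr hm)]
      subst hm
      have hm : m < 2 ^ K := by rw [pow_succ] at hn; omega
      rw [Finset.sum_range_succ, heven m hm, walProd_succ_even, walProd_succ_odd]
      have h0 := hr 0
      have h1 : (2 * m + 1).testBit 0 = true := by simp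
      simp only [h1, if_true, Finset.range_zero, Finset.prod_empty, mul_one]
      have h2 : r 0 * (1 + r 0) = 1 + r 0 := by rw [mul_add, h0]; ring
      generalize (∑ k ∈ Finset.range K,
          if m.testBit k then q k * ∏ i ∈ Finset.range k, (1 + q i) else 0) = S
      generalize walProd K q m = W
      linear_combination (-W) * h0 - (W * S) * h2

/-- The binary digits of `n`. -/
def bits (N n : ℕ) : Cube N := fun i => n.testBit i

/-- Extension of the product of the Rademacher functions to all indices. -/
def radSeq (x y : Cube N) (i : ℕ) : ℝ := if h : i < N then rad ⟨i, h⟩ x * rad ⟨i, h⟩ y else 1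

theorem radSeq_mul_self (x y : Cube N) (i : ℕ) : radSeq x y i * radSeq x y i = 1 := by
  unfold radSeq
  split_ifs with h
  · have h1 := rad_mul_self ⟨i, h⟩ x
    have h2 := rad_mul_self ⟨i, h⟩ y
    linear_combination (rad ⟨i, h⟩ y * rad ⟨i, h⟩ y) * h1 + h2
  · norm_num

theorem radSeq_fin (x y : Cube N) (i : Fin N) : radSeq x y i = rad i x * rad i y := by
  simp [radSeq]

theorem walProd_radSeq (x y : Cube N) (n : ℕ) :
    walProd N (radSeq x y) n = wal (bits N n) x * wal (bits N n) y := by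
  unfold walProd wal
  rw [Finset.prod_range, ← Finset.prod_mul_distrib]
  refine Finset.prod_congr rfl fun i _ => ?_
  rw [radSeq_fin, show n.testBit i = bits N n i from rfl]
  cases bits N n i <;> simp

theorem prod_one_add_radSeq (x y : Cube N) {k : ℕ} (hk : k ≤ N) :
    ∏ i ∈ Finset.range k, (1 + radSeq x y i) = if Agree k x y then 2 ^ k else 0 := by
  induction k with
  | zero => simp [Agree]
  | succ k ih =>
    rw [Finset.prod_range_succ, ih (by omega)]
    have h := agree_succ_iff ⟨k, hk⟩ x y
    simp only at h
    simp only [h]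
    have h2 := radSeq_fin x y ⟨k, hk⟩
    simp only at h2
    rw [h2]
    by_cases h1 : Agree k x y
    · unfold rad
      cases hx : x ⟨k, hk⟩ <;> cases hy : y ⟨k, hk⟩ <;> simp [h1] <;> ring
    · simp [h1]

/-- Partial sums of the Walsh expansion on the cube. -/
theorem sum_wal_eq_cubeSum (F : Cube N → ℝ) {n : ℕ} (hn : n < 2 ^ N) (x : Cube N) :
    ∑ m ∈ Finset.range n, (1 / 2 ^ N * ∑ y, F y * wal (bits N m) y) * wal (bits N m) x
      = cubeSum F (bits N n) x := by
  unfold cubeSum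
  have h1 : ∀ y, ∑ m ∈ Finset.range n, wal (bits N m) x * wal (bits N m) y
      = ∑ k : Fin N, if bits N n k = true then (wal (bits N n) x * wal (bits N n) y) *
        (rad k x * rad k y) * (if Agree k x y then 2 ^ (k : ℕ) else 0) else 0 := by
    intro y
    have := sum_walProd N (radSeq x y) (radSeq_mul_self x y) n hn
    simp only [walProd_radSeq] at this
    rw [this, Finset.mul_sum, Finset.sum_range]
    refine Finset.sum_congr rfl fun k _ => ?_
    rw [prod_one_add_radSeq x y k.2.le, radSeq_fin]
    rw [show n.testBit k = bits N n k from rfl]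
    cases bits N n k
    · simp
    · simp only [if_true]; ring
  calc ∑ m ∈ Finset.range n, (1 / 2 ^ N * ∑ y, F y * wal (bits N m) y) * wal (bits N m) x
      = ∑ y, 1 / 2 ^ N * F y * ∑ m ∈ Finset.range n, wal (bits N m) x * wal (bits N m) y := by
        simp_rw [Finset.mul_sum, Finset.sum_mul]
        rw [Finset.sum_comm]
        exact Finset.sum_congr rfl fun y _ => Finset.sum_congr rfl fun m _ => by ring
    _ = _ := by
        simp_rw [h1, Finset.mul_sum]
        rw [Finset.sum_comm]
        refine Finset.sum_congr rfl fun k _ => ?_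
        split_ifs
        · rw [coef_eq_sum, Finset.mul_sum]
          refine Finset.sum_congr rfl fun y _ => ?_
          split_ifs
          · ring
          · ring
        · simp

/-- The `i`-th binary digit of `x`. -/
def dig (i : ℕ) (x : ℝ) : Bool := ⌊2 ^ (i + 1) * x⌋₊.testBit 0

/-- The first `N` binary digits of `x`. -/
def code (N : ℕ) (x : ℝ) : Cube N := fun i => dig i x

/-- Points of `[0,1)` that are not dyadic rationals. -/
def Regular (x : ℝ) : Prop := x ∈ Set.Ico (0 : ℝ) 1 ∧ ∀ (k : ℕ) (m : ℤ), (2 : ℝ) ^ k * x ≠ m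

theorem ae_regular : ∀ᵐ x ∂μT, Regular x := by
  have h1 : ∀ᵐ x ∂μT, x ∈ Set.Ico (0 : ℝ) 1 := ae_restrict_mem measurableSet_Ico
  have h2 : ∀ (k : ℕ) (m : ℤ), ∀ᵐ x ∂μT, (2 : ℝ) ^ k * x ≠ m := by
    intro k m
    refine ae_restrict_of_ae ?_
    rw [ae_iff]
    refine measure_mono_null (t := {(m : ℝ) / 2 ^ k}) ?_ (measure_singleton _)
    intro x hx
    simp only [ne_eq, not_not, Set.mem_ofPred_eq] at hx
    rw [Set.mem_singleton_iff, ← hx]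
    field_simp
  filter_upwards [h1, ae_all_iff.2 fun k => ae_all_iff.2 (h2 k)] with x hx hx2
  exact ⟨hx, hx2⟩

theorem Regular.rademacher_eq {x : ℝ} (hx : Regular x) (k : ℕ) :
    rademacher k x = if dig k x then -1 else 1 := by
  unfold rademacher dig
  set t : ℝ := 2 ^ (k + 1) * x with ht
  set m := ⌊t⌋₊ with hm
  have ht0 : 0 ≤ t := mul_nonneg (by positivity) hx.1.1
  have h1 : (m : ℝ) ≤ t := Nat.floor_le ht0
  have h2 : t < m + 1 := Nat.lt_floor_add_one t
  have h3 : (m : ℝ) ≠ t := fun h => hx.2 (k + 1) m (by rw [← ht, ← h]; simp)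
  have h4 : 0 < t - m := sub_pos.2 (lt_of_le_of_ne h1 h3)
  have h5 : 0 < Real.sin ((t - m) * Real.pi) :=
    Real.sin_pos_of_pos_of_lt_pi (mul_pos h4 Real.pi_pos)
      (by nlinarith [Real.pi_pos])
  have h6 : (2 : ℝ) ^ (k + 1) * Real.pi * x = (t - m) * Real.pi + m * Real.pi := by
    rw [ht]; ring
  rw [h6, Real.sin_add_nat_mul_pi, Nat.testBit_zero]
  rcases Nat.mod_two_eq_zero_or_one m with hm2 | hm2
  · rw [(Nat.even_iff.2 hm2).neg_one_pow, one_mul, Real.sign_of_pos h5]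
    simp [hm2]
  · rw [(Nat.odd_iff.2 hm2).neg_one_pow, neg_one_mul, Real.sign_of_neg (by linarith)]
    simp [hm2]

theorem Regular.walsh_eq {x : ℝ} (hx : Regular x) {n : ℕ} (hn : n < 2 ^ N) :
    walsh n x = wal (bits N n) (code N x) := by
  have h1 : wal (bits N n) (code N x)
      = ∏ k ∈ Finset.range N, if n.testBit k then rademacher k x else 1 := by
    unfold wal
    rw [Finset.prod_range]
    refine Finset.prod_congr rfl fun i _ => ?_
    rw [hx.rademacher_eq, show n.testBit i = bits N n i from rfl]
    rfl
  rw [h1]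
  unfold walsh
  have hbig : ∀ K, n ≤ K → ∏ k ∈ Finset.range K, (if n.testBit k then rademacher k x else 1)
      = ∏ k ∈ Finset.range n, if n.testBit k then rademacher k x else 1 := by
    intro K hK
    refine (Finset.prod_subset (Finset.range_subset_range.2 hK) fun k _ hk => ?_).symm
    have : n < 2 ^ k := (Nat.lt_two_pow_self).trans_le
      (Nat.pow_le_pow_right (by norm_num) (by simpa using hk))
    simp [Nat.testBit_lt_two_pow this]
  have hbig2 : ∀ K, N ≤ K → ∏ k ∈ Finset.range K, (if n.testBit k then rademacher k x else 1)
      = ∏ k ∈ Finset.range N, if n.testBit k then rademacher k x else 1 := by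
    intro K hK
    refine (Finset.prod_subset (Finset.range_subset_range.2 hK) fun k _ hk => ?_).symm
    have : n < 2 ^ k := hn.trans_le (Nat.pow_le_pow_right (by norm_num) (by simpa using hk))
    simp [Nat.testBit_lt_two_pow this]
  rw [← hbig (max n N) (le_max_left _ _), hbig2 (max n N) (le_max_right _ _)]

/-- The digits of the integer part of `2 ^ N * x`, in order of significance. -/
def revBits (N : ℕ) (m : Fin (2 ^ N)) : Cube N := fun i => (m : ℕ).testBit (N - 1 - i)

theorem revBits_injective : Function.Injective (revBits N) := by
  intro m m' h
  refine Fin.ext (Nat.eq_of_testBit_eq fun j => ?_)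
  by_cases hj : j < N
  · have := congrFun h ⟨N - 1 - j, by omega⟩
    simp only [revBits] at this
    rwa [show N - 1 - (N - 1 - j) = j by omega] at this
  · have h2 : 2 ^ N ≤ 2 ^ j := Nat.pow_le_pow_right (by norm_num) (by omega)
    rw [Nat.testBit_lt_two_pow (m.2.trans_le h2), Nat.testBit_lt_two_pow (m'.2.trans_le h2)]

theorem revBits_surjective : Function.Surjective (revBits N) :=
  ((Fintype.bijective_iff_injective_and_card _).2 ⟨revBits_injective, by simp⟩).2

theorem floor_lt_two_pow {x : ℝ} (hx : x ∈ Set.Ico (0 : ℝ) 1) : ⌊(2 : ℝ) ^ N * x⌋₊ < 2 ^ N := by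
  rw [Nat.floor_lt (mul_nonneg (by positivity) hx.1)]
  push_cast
  exact mul_lt_of_lt_one_right (by positivity) hx.2

theorem code_eq_revBits {x : ℝ} (hx : x ∈ Set.Ico (0 : ℝ) 1) :
    code N x = revBits N ⟨⌊(2 : ℝ) ^ N * x⌋₊, floor_lt_two_pow hx⟩ := by
  funext i
  have h1 : (2 : ℝ) ^ ((i : ℕ) + 1) * x = 2 ^ N * x / ((2 ^ (N - 1 - i) : ℕ) : ℝ) := by
    push_cast
    rw [eq_div_iff (by positivity), mul_right_comm, ← pow_add]
    congr 3
    omega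
  simp only [code, dig, revBits]
  rw [h1, Nat.floor_div_natCast, Nat.testBit_div_two_pow, zero_add]

theorem code_fiber (m : Fin (2 ^ N)) : code N ⁻¹' {revBits N m} ∩ Set.Ico (0 : ℝ) 1
    = Set.Ico ((m : ℝ) / 2 ^ N) ((m + 1) / 2 ^ N) := by
  have hp : (0 : ℝ) < 2 ^ N := by positivity
  ext x
  constructor
  · rintro ⟨h1, h2⟩
    have h1 : code N x = revBits N m := h1
    rw [code_eq_revBits h2] at h1
    have h3 := congrArg Fin.val (revBits_injective h1)
    simp only at h3
    rw [Nat.floor_eq_iff (mul_nonneg hp.le h2.1)] at h3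
    rw [Set.mem_Ico, div_le_iff₀ hp, lt_div_iff₀ hp]
    exact ⟨by linarith [h3.1], by linarith [h3.2]⟩
  · rintro ⟨h1, h2⟩
    have hx : x ∈ Set.Ico (0 : ℝ) 1 := by
      refine ⟨le_trans (by positivity) h1, h2.trans_le ?_⟩
      rw [div_le_one hp]
      exact_mod_cast m.2
    refine ⟨?_, hx⟩
    rw [Set.mem_preimage, Set.mem_singleton_iff, code_eq_revBits hx]
    congr 1
    refine Fin.ext ?_
    simp only
    rw [div_le_iff₀ hp] at h1
    rw [lt_div_iff₀ hp] at h2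
    rw [Nat.floor_eq_iff (mul_nonneg hp.le hx.1)]
    exact ⟨by linarith, by linarith⟩

theorem measurable_code (N : ℕ) : Measurable (code N) := by
  refine measurable_pi_lambda _ fun i => ?_
  have h1 : Measurable fun x : ℝ => ⌊(2 : ℝ) ^ ((i : ℕ) + 1) * x⌋₊ :=
    Nat.measurable_floor.comp (measurable_const_mul _)
  exact (measurable_from_top (f := fun m : ℕ => m.testBit 0)).comp h1

theorem μT_code_fiber (y : Cube N) : μT (code N ⁻¹' {y}) = ENNReal.ofReal (1 / 2 ^ N) := by
  obtain ⟨m, rfl⟩ := revBits_surjective y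
  unfold μT
  rw [Measure.restrict_apply (measurable_code N (measurableSet_singleton _)), code_fiber,
    Real.volume_Ico]
  congr 1
  ring

instance : IsProbabilityMeasure μT := ⟨by simp [μT]⟩

theorem μT_code_preimage (S : Finset (Cube N)) :
    μT (code N ⁻¹' S) = ENNReal.ofReal (S.card * (1 / 2 ^ N)) := by
  have h1 : code N ⁻¹' (S : Set (Cube N)) = ⋃ y ∈ S, code N ⁻¹' {y} := by
    ext x; simp
  rw [h1, measure_biUnion_finset]
  · simp only [μT_code_fiber, Finset.sum_const, nsmul_eq_mul]
    rw [ENNReal.ofReal_mul (Nat.cast_nonneg _), ENNReal.ofReal_natCast]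
  · intro y _ y' _ hne
    refine Set.disjoint_left.2 fun x hx hx' => hne ?_
    exact (show code N x = y from hx).symm.trans hx'
  · exact fun y _ => measurable_code N (measurableSet_singleton _)

/-- The averages of `f` over the dyadic intervals of level `N`. -/
def cellAvg (f : ℝ → ℝ) (N : ℕ) (y : Cube N) : ℝ := 2 ^ N * ∫ t in code N ⁻¹' {y}, f t ∂μT

theorem integral_mul_code {f : ℝ → ℝ} (hf : Integrable f μT) (φ : Cube N → ℝ) :
    ∫ t, f t * φ (code N t) ∂μT = 1 / 2 ^ N * ∑ y, cellAvg f N y * φ y := by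
  have h1 : ∀ t, f t * φ (code N t) = ∑ y, φ y * (code N ⁻¹' {y}).indicator f t := by
    intro t
    rw [Finset.sum_eq_single (code N t)]
    · rw [Set.indicator_of_mem (by simp), mul_comm]
    · intro y _ hy
      rw [Set.indicator_of_notMem (by simpa using hy.symm), mul_zero]
    · simp
  have hm : ∀ y : Cube N, MeasurableSet (code N ⁻¹' {y}) :=
    fun y => measurable_code N (measurableSet_singleton _)
  simp_rw [h1]
  rw [integral_finsetSum _ fun y _ => (hf.indicator (hm y)).const_mul _, Finset.mul_sum]
  refine Finset.sum_congr rfl fun y _ => ?_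
  rw [integral_const_mul, integral_indicator (hm y), cellAvg]
  field_simp

theorem walshSum_eq_cubeSum {f : ℝ → ℝ} (hf : Integrable f μT) {n : ℕ} (hn : n < 2 ^ N) {x : ℝ}
    (hx : Regular x) : walshSum f n x = cubeSum (cellAvg f N) (bits N n) (code N x) := by
  rw [← sum_wal_eq_cubeSum _ hn]
  unfold walshSum
  refine Finset.sum_congr rfl fun m hm => ?_
  have hm' : m < 2 ^ N := (Finset.mem_range.1 hm).trans hn
  rw [hx.walsh_eq hm', ← integral_mul_code hf]
  congr 1
  refine integral_congr_ae ?_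
  filter_upwards [ae_regular] with t ht
  rw [ht.walsh_eq hm']

theorem abs_cellAvg_le (f : ℝ → ℝ) (N : ℕ) (y : Cube N) :
    |cellAvg f N y| ≤ cellAvg (fun t => |f t|) N y := by
  unfold cellAvg
  rw [abs_mul, abs_of_nonneg (by positivity : (0 : ℝ) ≤ 2 ^ N)]
  exact mul_le_mul_of_nonneg_left abs_integral_le_integral_abs (by positivity)

theorem sum_abs_cellAvg_le {f : ℝ → ℝ} (hf : Integrable f μT) :
    ∑ y, |cellAvg f N y| ≤ (∫ t, |f t| ∂μT) * 2 ^ N := by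
  have h := integral_mul_code hf.abs (fun _ : Cube N => 1)
  simp only [mul_one] at h
  rw [h, one_div, inv_mul_eq_div, div_mul_cancel₀ _ (by positivity)]
  exact Finset.sum_le_sum fun y _ => abs_cellAvg_le f N y

theorem abs_cellAvg_le_one {f : ℝ → ℝ} (hf : ∀ t, |f t| ≤ 1) (y : Cube N) :
    |cellAvg f N y| ≤ 1 := by
  unfold cellAvg
  have h := norm_setIntegral_le_of_norm_le_const (μ := μT) (s := code N ⁻¹' {y}) (f := f) (C := 1)
    (measure_lt_top _ _) (fun t _ => hf t)
  rw [Measure.real, μT_code_fiber, ENNReal.toReal_ofReal (by positivity), one_mul,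
    Real.norm_eq_abs] at h
  rw [abs_mul, abs_of_nonneg (by positivity : (0 : ℝ) ≤ 2 ^ N)]
  calc (2 : ℝ) ^ N * _ ≤ 2 ^ N * (1 / 2 ^ N) := mul_le_mul_of_nonneg_left h (by positivity)
    _ = 1 := by field_simp

/-- The restricted weak type estimate for the maximal Walsh partial sums. -/
theorem mul_μT_walshSum_le_of_bounded {f : ℝ → ℝ} (hf : Integrable f μT) (hf1 : ∀ t, |f t| ≤ 1)
    {α : ℝ} (hα : 0 < α) (hfα : ∫ t, |f t| ∂μT ≤ α) {i₀ : ℕ} (hi₀ : 1 ≤ 2 ^ i₀ * α) {lam : ℝ}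
    (hlam : 0 ≤ lam) :
    ENNReal.ofReal lam * μT {x | ∃ n, lam < |walshSum f n x|}
      ≤ ENNReal.ofReal (400 * α * (i₀ + 1)) := by
  set E : ℕ → Set ℝ := fun K => {x | ∃ n < 2 ^ K, lam < |walshSum f n x|} with hE
  have hmono : Monotone E := by
    rintro K K' hK x ⟨n, hn, h⟩
    exact ⟨n, hn.trans_le (Nat.pow_le_pow_right (by norm_num) hK), h⟩
  have hU : {x | ∃ n, lam < |walshSum f n x|} = ⋃ K, E K := by
    ext x
    simp only [hE, Set.mem_ofPred_eq, Set.mem_iUnion]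
    exact ⟨fun ⟨n, h⟩ => ⟨n, n, Nat.lt_two_pow_self, h⟩, fun ⟨_, n, _, h⟩ => ⟨n, h⟩⟩
  rw [hU, hmono.measure_iUnion, ENNReal.mul_iSup]
  refine iSup_le fun K => ?_
  set S := Finset.univ.filter fun y : Cube K => ∃ n, lam < |cubeSum (cellAvg f K) n y| with hS
  have h1 : μT (E K) ≤ μT (code K ⁻¹' S) := by
    refine measure_mono_ae ?_
    filter_upwards [ae_regular] with x hx
    rintro ⟨n, hn, h⟩
    rw [walshSum_eq_cubeSum hf hn hx] at h
    exact Finset.mem_coe.2 (Finset.mem_filter.2 ⟨Finset.mem_univ _, _, h⟩)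
  have h2 := mul_card_cubeSum_le hα (abs_cellAvg_le_one hf1)
    ((sum_abs_cellAvg_le hf (N := K)).trans (mul_le_mul_of_nonneg_right hfα (by positivity)))
    hi₀ hlam
  rw [← hS] at h2
  refine (mul_le_mul_right h1 _).trans ?_
  rw [μT_code_preimage, ← ENNReal.ofReal_mul hlam]
  refine ENNReal.ofReal_le_ofReal ?_
  rw [← mul_assoc, mul_one_div, div_le_iff₀ (by positivity)]
  exact h2

theorem walshSum_const_mul (c : ℝ) (f : ℝ → ℝ) (n : ℕ) (x : ℝ) :
    walshSum (fun t => c * f t) n x = c * walshSum f n x := by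
  unfold walshSum
  rw [Finset.mul_sum]
  refine Finset.sum_congr rfl fun m _ => ?_
  simp only [mul_assoc]
  rw [integral_const_mul]
  ring

theorem mul_μT_walshSum_le {f : ℝ → ℝ} (hf : Integrable f μT) {R : ℝ} (hR : 0 < R)
    (hfR : ∀ t, |f t| ≤ R) {β : ℝ} (hβ : 0 < β) (hfβ : ∫ t, |f t| ∂μT ≤ β) {i₀ : ℕ}
    (hi₀ : R ≤ 2 ^ i₀ * β) {lam : ℝ} (hlam : 0 ≤ lam) :
    ENNReal.ofReal lam * μT {x | ∃ n, lam < |walshSum f n x|}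
      ≤ ENNReal.ofReal (400 * β * (i₀ + 1)) := by
  have habs : ∀ t, |R⁻¹ * f t| = R⁻¹ * |f t| := fun t => by
    rw [abs_mul, abs_of_pos (inv_pos.2 hR)]
  have h := mul_μT_walshSum_le_of_bounded (f := fun t => R⁻¹ * f t) (hf.const_mul _)
    (fun t => by rw [habs, inv_mul_le_iff₀ hR, mul_one]; exact hfR t) (α := R⁻¹ * β) (by positivity)
    (by simp only [habs]; rw [integral_const_mul]
        exact mul_le_mul_of_nonneg_left hfβ (by positivity)) (i₀ := i₀)
    (by rw [mul_left_comm, le_inv_mul_iff₀ hR, mul_one]; exact hi₀) (lam := R⁻¹ * lam)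
    (by positivity)
  have hset : {x | ∃ n, R⁻¹ * lam < |walshSum (fun t => R⁻¹ * f t) n x|}
      = {x | ∃ n, lam < |walshSum f n x|} := by
    ext x
    refine exists_congr fun n => ?_
    rw [walshSum_const_mul, abs_mul, abs_of_pos (inv_pos.2 hR), mul_lt_mul_iff_right₀ (inv_pos.2 hR)]
  rw [hset] at h
  have h2 := mul_le_mul_right h (ENNReal.ofReal R)
  rw [← mul_assoc, ← ENNReal.ofReal_mul hR.le, ← ENNReal.ofReal_mul hR.le,
    mul_inv_cancel_left₀ hR.ne'] at h2
  refine h2.trans (le_of_eq ?_)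
  congr 1
  field_simp

/-- Dyadic truncation of a nonnegative number below a level `t`. -/
theorem le_sum_dyadic_add {G t : ℝ≥0∞} (h : G ≤ t) (m : ℕ) :
    G ≤ (∑ i ∈ Finset.range m, if t * 2⁻¹ ^ (i + 1) < G then t * 2⁻¹ ^ i else 0)
      + t * 2⁻¹ ^ m := by
  induction m with
  | zero => simpa using h
  | succ m ih =>
    by_cases h1 : t * 2⁻¹ ^ (m + 1) < G
    · rw [Finset.sum_range_succ, if_pos h1]
      exact ih.trans le_self_add
    · exact (not_lt.1 h1).trans le_add_self

/-- Summation of functions in weak `L¹`. -/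
theorem mul_measure_tsum_le {α : Type*} [MeasurableSpace α] (μ : Measure α)
    {G : ℕ → α → ℝ≥0∞} (hG : ∀ k, Measurable (G k)) {a : ℕ → ℝ≥0∞}
    (ha : ∀ k (t : ℝ≥0∞), t ≠ ∞ → t * μ {x | t < G k x} ≤ a k) {m : ℕ → ℕ} (hm : ∀ k, 1 ≤ m k)
    (hm2 : ∑' k, (2⁻¹ : ℝ≥0∞) ^ m k ≤ 2⁻¹) {t : ℝ≥0∞} (ht : t ≠ ∞) :
    t * μ {x | t < ∑' k, G k x} ≤ 5 * ∑' k, m k * a k := by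
  rcases eq_or_ne t 0 with rfl | ht0
  · simp
  set H : α → ℝ≥0∞ := fun x => ∑' k, ∑ i ∈ Finset.range (m k),
    {x | t * 2⁻¹ ^ (i + 1) < G k x}.indicator (fun _ => t * 2⁻¹ ^ i) x with hH
  have hset : ∀ (s : ℝ≥0∞) k, MeasurableSet {x | s < G k x} :=
    fun s k => measurableSet_lt measurable_const (hG k)
  have hHm : Measurable H := Measurable.tsum fun k =>
    Finset.measurable_sum _ fun i _ => measurable_const.indicator (hset _ _)
  have hsub : {x | t < ∑' k, G k x} ⊆ (⋃ k, {x | t < G k x}) ∪ {x | t * 2⁻¹ ≤ H x} := by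
    intro x hx
    by_cases h1 : ∃ k, t < G k x
    · exact Or.inl (Set.mem_iUnion.2 h1)
    · push Not at h1
      right
      have h2 : ∑' k, G k x ≤ H x + t * 2⁻¹ := by
        calc ∑' k, G k x ≤ ∑' k, ((∑ i ∈ Finset.range (m k),
              {x | t * 2⁻¹ ^ (i + 1) < G k x}.indicator (fun _ => t * 2⁻¹ ^ i) x)
              + t * 2⁻¹ ^ m k) := by
              refine ENNReal.tsum_le_tsum fun k => (le_sum_dyadic_add (h1 k) (m k)).trans ?_
              refine le_of_eq ?_
              congr 1
              exact Finset.sum_congr rfl fun i _ => by simp [Set.indicator_apply]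
          _ ≤ _ := by
              rw [ENNReal.tsum_add, ENNReal.tsum_mul_left]
              gcongr
      have h3 : t * 2⁻¹ + t * 2⁻¹ < H x + t * 2⁻¹ := by
        rw [← mul_add, ENNReal.inv_two_add_inv_two, mul_one]
        exact lt_of_lt_of_le hx h2
      exact (lt_of_add_lt_add_right h3).le
  have h1 : t * μ (⋃ k, {x | t < G k x}) ≤ ∑' k, m k * a k := by
    calc t * μ (⋃ k, {x | t < G k x}) ≤ t * ∑' k, μ {x | t < G k x} := by
          gcongr; exact measure_iUnion_le _
      _ = ∑' k, t * μ {x | t < G k x} := ENNReal.tsum_mul_left.symm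
      _ ≤ _ := ENNReal.tsum_le_tsum fun k => (ha k t ht).trans (by
          nth_rewrite 1 [← one_mul (a k)]
          gcongr
          exact_mod_cast hm k)
  have h2 : t * μ {x | t * 2⁻¹ ≤ H x} ≤ 4 * ∑' k, m k * a k := by
    have h3 := mul_meas_ge_le_lintegral (μ := μ) hHm (t * 2⁻¹)
    have h4 : ∫⁻ x, H x ∂μ ≤ 2 * ∑' k, m k * a k := by
      rw [hH, lintegral_tsum fun k => (Finset.measurable_sum _ fun i _ =>
        measurable_const.indicator (hset _ _)).aemeasurable, ← ENNReal.tsum_mul_left]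
      refine ENNReal.tsum_le_tsum fun k => ?_
      rw [lintegral_finsetSum _ fun i _ => measurable_const.indicator (hset _ _)]
      calc ∑ i ∈ Finset.range (m k), _ ≤ ∑ i ∈ Finset.range (m k), 2 * a k := by
            refine Finset.sum_le_sum fun i _ => ?_
            rw [lintegral_indicator (hset _ _), setLIntegral_const]
            have h5 := ha k (t * 2⁻¹ ^ (i + 1)) (ENNReal.mul_ne_top ht (by simp))
            refine le_trans (le_of_eq ?_) (mul_le_mul_right h5 2)
            rw [pow_succ, ← mul_assoc, ← mul_assoc]
            congr 1
            rw [mul_comm 2, mul_assoc _ _ (2 : ℝ≥0∞), ENNReal.inv_mul_cancel (by simp) (by simp),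
              mul_one]
        _ = _ := by
            rw [Finset.sum_const, Finset.card_range, nsmul_eq_mul]
            ring
    calc t * μ {x | t * 2⁻¹ ≤ H x} = 2 * (t * 2⁻¹ * μ {x | t * 2⁻¹ ≤ H x}) := by
          rw [← mul_assoc, mul_comm 2, mul_assoc t, ENNReal.inv_mul_cancel (by simp) (by simp),
            mul_one]
      _ ≤ 2 * (2 * ∑' k, m k * a k) := mul_le_mul_right (h3.trans h4) 2
      _ = _ := by rw [← mul_assoc]; norm_num
  calc t * μ {x | t < ∑' k, G k x}
      ≤ t * (μ (⋃ k, {x | t < G k x}) + μ {x | t * 2⁻¹ ≤ H x}) := by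
        gcongr
        exact (measure_mono hsub).trans (measure_union_le _ _)
    _ ≤ ∑' k, m k * a k + 4 * ∑' k, m k * a k := by
        rw [mul_add]
        exact add_le_add h1 h2
    _ = _ := by ring

/-- The number of dyadic scales kept at the `k`-th level. -/
def scaleCount (k : ℕ) : ℕ := 2 * Nat.clog 2 (k + 2) + 1

theorem one_le_scaleCount (k : ℕ) : 1 ≤ scaleCount k := by unfold scaleCount; omega

theorem tsum_scaleCount_le : ∑' k, (2⁻¹ : ℝ≥0∞) ^ scaleCount k ≤ 2⁻¹ := by
  have h1 : ∀ k : ℕ, (1 / 2 : ℝ) ^ scaleCount k ≤ 1 / 2 * (1 / (k + 1) - 1 / (k + 2)) := by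
    intro k
    have h2 : ((k : ℝ) + 2) ≤ 2 ^ Nat.clog 2 (k + 2) := by
      exact_mod_cast Nat.le_pow_clog (by norm_num) (k + 2)
    have h3 : (0 : ℝ) < k + 2 := by positivity
    calc (1 / 2 : ℝ) ^ scaleCount k = 1 / 2 * (1 / (2 ^ Nat.clog 2 (k + 2)) ^ 2) := by
          rw [scaleCount, pow_succ, mul_comm 2, pow_mul, one_div_pow, one_div_pow, mul_comm]
      _ ≤ 1 / 2 * (1 / ((k : ℝ) + 2) ^ 2) := by gcongr
      _ ≤ _ := by
          gcongr
          rw [div_sub_div _ _ (by positivity) (by positivity), div_le_div_iff₀ (by positivity)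
            (by positivity)]
          nlinarith
  refine ENNReal.tsum_le_of_sum_range_le fun n => ?_
  have h4 : ∑ k ∈ Finset.range n, (1 / 2 : ℝ) ^ scaleCount k ≤ 1 / 2 := by
    calc _ ≤ ∑ k ∈ Finset.range n, (1 / 2 * (1 / ((k : ℝ) + 1) - 1 / (k + 2))) :=
          Finset.sum_le_sum fun k _ => h1 k
      _ = 1 / 2 * (1 - 1 / (n + 1)) := by
          rw [← Finset.mul_sum]
          congr 1
          have := Finset.sum_range_sub' (fun k : ℕ => 1 / ((k : ℝ) + 1)) n
          simp only [Nat.cast_add, Nat.cast_one, Nat.cast_zero] at this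
          rw [zero_add, div_one] at this
          rw [← this]
          refine Finset.sum_congr rfl fun k _ => ?_
          ring
      _ ≤ _ := by
          have : (0 : ℝ) ≤ 1 / (n + 1) := by positivity
          linarith
  have h5 : (2⁻¹ : ℝ≥0∞) = ENNReal.ofReal (1 / 2) := by
    rw [one_div, ENNReal.ofReal_inv_of_pos (by norm_num)]; simp
  rw [h5]
  simp_rw [← ENNReal.ofReal_pow (show (0 : ℝ) ≤ 1 / 2 by norm_num)]
  rw [← ENNReal.ofReal_sum_of_nonneg fun i _ => by positivity]
  exact ENNReal.ofReal_le_ofReal h4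

theorem le_log_e_add {v : ℝ} (hv : 0 ≤ v) : 1 ≤ Real.log (Real.exp 1 + v) := by
  rw [Real.le_log_iff_exp_le (by positivity)]
  linarith

theorem exp_one_le_loglog {v : ℝ} (hv : 0 ≤ v) :
    Real.exp 1 ≤ Real.log (Real.log (Real.exp (Real.exp (Real.exp 1)) + v)) := by
  have h1 : Real.exp (Real.exp 1) ≤ Real.log (Real.exp (Real.exp (Real.exp 1)) + v) := by
    rw [Real.le_log_iff_exp_le (by positivity)]
    linarith
  rwa [Real.le_log_iff_exp_le ((Real.exp_pos _).trans_le h1)]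

theorem one_le_logloglog {v : ℝ} (hv : 0 ≤ v) :
    1 ≤ Real.log (Real.log (Real.log (Real.exp (Real.exp (Real.exp 1)) + v))) := by
  have h1 := exp_one_le_loglog hv
  rwa [Real.le_log_iff_exp_le ((Real.exp_pos _).trans_le h1)]

theorem le_PhiA {v : ℝ} (hv : 0 ≤ v) : v ≤ PhiA v := by
  unfold PhiA
  have h1 := le_log_e_add hv
  have h2 := one_le_logloglog hv
  rw [mul_assoc]
  exact le_mul_of_one_le_right hv (one_le_mul_of_one_le_of_one_le h1 h2)

theorem scaleCount_le_log (k : ℕ) : (scaleCount k : ℝ) ≤ 3 * Real.log (k + 2) + 3 := by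
  have hc : 1 ≤ Nat.clog 2 (k + 2) := Nat.clog_pos (by norm_num) (by omega)
  have h1 : 2 ^ (Nat.clog 2 (k + 2) - 1) < k + 2 := 
    Nat.pow_pred_clog_lt_self (by norm_num) (by omega : 1 < k + 2)
  obtain ⟨c, hc2⟩ : ∃ c, Nat.clog 2 (k + 2) = c + 1 := ⟨_, (Nat.sub_add_cancel hc).symm⟩
  rw [hc2, Nat.add_sub_cancel] at h1
  have h2 : (2 : ℝ) ^ c ≤ k + 2 := by exact_mod_cast h1.le
  have h3 := Real.log_le_log (by positivity) h2
  rw [Real.log_pow] at h3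
  have h4 := Real.log_two_gt_d9
  unfold scaleCount
  rw [hc2]
  push_cast
  nlinarith [Nat.cast_nonneg (α := ℝ) c]

/-- The weights of the level decomposition are controlled by Antonov's Young function. -/
theorem scaleCount_mul_le_PhiA {v : ℝ} (hv : 0 ≤ v) {k : ℕ}
    (hk : ∀ j < k, (2 : ℝ) ^ 2 ^ j < v) :
    scaleCount k * (2 ^ (k + 1) + 1) * v ≤ 132 * PhiA v := by
  rcases k with _ | j
  · have h0 : scaleCount 0 = 3 := by
      unfold scaleCount
      rw [show Nat.clog 2 (0 + 2) = 1 by rw [Nat.clog_eq_one (by norm_num) (by norm_num)]]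
    have := le_PhiA hv
    rw [h0]
    norm_num
    linarith
  · have hj := hk j (Nat.lt_succ_self j)
    have hvp : 0 < v := lt_trans (by positivity) hj
    have hl2 := Real.log_two_gt_d9
    have hl2' := Real.log_two_lt_d9
    have hlogv : (2 : ℝ) ^ j * (1 / 2) ≤ Real.log v := by
      have h1 := Real.log_le_log (by positivity) hj.le
      rw [Real.log_pow] at h1
      push_cast at h1
      refine le_trans ?_ h1
      gcongr
      linarith
    set A := Real.log (Real.exp 1 + v) with hA
    set Y := Real.log (Real.log (Real.exp (Real.exp (Real.exp 1)) + v)) with hY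
    have hA1 : (2 : ℝ) ^ j * (1 / 2) ≤ A :=
      hlogv.trans (Real.log_le_log hvp (by linarith [Real.exp_pos 1]))
    have hY0 : Real.exp 1 ≤ Y := exp_one_le_loglog hv
    have he := Real.exp_one_gt_d9
    have hYp : 0 < Y := by linarith
    have hY1 : ((j : ℝ) - 1) * (1 / 2) ≤ Y := by
      have h1 : (2 : ℝ) ^ j * (1 / 2) ≤ Real.log (Real.exp (Real.exp (Real.exp 1)) + v) :=
        hlogv.trans (Real.log_le_log hvp (by linarith [Real.exp_pos (Real.exp (Real.exp 1))]))
      have h2 := Real.log_le_log (by positivity) h1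
      rw [Real.log_mul (by positivity) (by norm_num), Real.log_pow, one_div, Real.log_inv] at h2
      rw [← hY] at h2
      rcases Nat.eq_zero_or_pos j with rfl | hjp
      · norm_num; linarith
      · have : (1 : ℝ) ≤ j := by exact_mod_cast hjp
        nlinarith
    have hL : 1 ≤ Real.log Y := one_le_logloglog hv
    have hm : (scaleCount (j + 1) : ℝ) ≤ 11 * Real.log Y := by
      have h1 := scaleCount_le_log (j + 1)
      have h2 : ((j + 1 : ℕ) : ℝ) + 2 ≤ 2 ^ 2 * Y := by push_cast; linarith
      have h3 := Real.log_le_log (by positivity) h2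
      rw [Real.log_mul (by positivity) hYp.ne', Real.log_pow] at h3
      push_cast at h3 h1
      linarith
    have h2 : (2 : ℝ) ^ (j + 1 + 1) + 1 ≤ 12 * A := by
      have : (1 : ℝ) ≤ 2 ^ j := one_le_pow₀ (by norm_num)
      rw [pow_succ, pow_succ]
      linarith
    have hA0 : 0 ≤ A := zero_le_one.trans (le_log_e_add hv)
    calc (scaleCount (j + 1) : ℝ) * (2 ^ (j + 1 + 1) + 1) * v
        ≤ (11 * Real.log Y) * (12 * A) * v := by gcongr
      _ = 132 * PhiA v := by rw [PhiA, ← hA, ← hY]; ring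

theorem scaleCount_le (k : ℕ) : scaleCount k ≤ 3 * 2 ^ k := by
  have h1 : Nat.clog 2 (k + 2) ≤ k + 1 := by
    refine Nat.clog_le_of_le_pow ?_
    have := Nat.lt_two_pow_self (n := k + 1)
    omega
  have h2 := Nat.lt_two_pow_self (n := k)
  unfold scaleCount
  rcases k with _ | _ | k
  · simp at h1 ⊢; omega
  · simp at h1 ⊢; omega
  · have h3 := Nat.lt_two_pow_self (n := k)
    have h4 : 2 ^ (k + 1 + 1) = 4 * 2 ^ k := by ring
    rw [h4]
    omega

theorem two_pow_two_pow_ge (k : ℕ) : (8 : ℝ) ^ k ≤ 4 * 2 ^ 2 ^ k := by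
  have h : 3 * k ≤ 2 + 2 ^ k := by
    rcases k with _ | _ | k
    · norm_num
    · norm_num
    · induction k with
      | zero => norm_num
      | succ k ih =>
        have h4 : 2 ^ (k + 1 + 1 + 1) = 2 * 2 ^ (k + 1 + 1) := by ring
        rw [h4]
        omega
  calc (8 : ℝ) ^ k = 2 ^ (3 * k) := by rw [pow_mul]; norm_num
    _ ≤ 2 ^ (2 + 2 ^ k) := pow_le_pow_right₀ (by norm_num) h
    _ = _ := by rw [pow_add]; norm_num

theorem scaleCount_mul_error_le (k : ℕ) :
    scaleCount k * (2 ^ (k + 1) + 1) * ((2 : ℝ) ^ 2 ^ k)⁻¹ ≤ 36 * (1 / 2) ^ k := by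
  have h1 : (scaleCount k : ℝ) ≤ 3 * 2 ^ k := by exact_mod_cast scaleCount_le k
  have h2 : (2 : ℝ) ^ (k + 1) + 1 ≤ 3 * 2 ^ k := by
    have : (1 : ℝ) ≤ 2 ^ k := one_le_pow₀ (by norm_num)
    rw [pow_succ]; linarith
  have h3 : ((2 : ℝ) ^ 2 ^ k)⁻¹ ≤ 4 / 8 ^ k := by
    rw [inv_le_comm₀ (by positivity) (by positivity), inv_div, div_le_iff₀ (by norm_num), mul_comm]
    exact two_pow_two_pow_ge k
  calc _ ≤ (3 * 2 ^ k) * (3 * 2 ^ k) * (4 / 8 ^ k : ℝ) := by gcongr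
    _ = 36 * (1 / 2) ^ k := by
      rw [show (8 : ℝ) = 2 * 2 * 2 by norm_num, mul_pow, mul_pow, one_div_pow]
      field_simp
      ring

theorem measurable_rademacher (k : ℕ) : Measurable (rademacher k) := by
  have h1 : Measurable Real.sign := by
    unfold Real.sign
    exact Measurable.ite measurableSet_Iio measurable_const
      (Measurable.ite measurableSet_Ioi measurable_const measurable_const)
  unfold rademacher
  exact h1.comp (Real.measurable_sin.comp (measurable_const.mul measurable_id))

theorem measurable_walsh (n : ℕ) : Measurable (walsh n) := by
  unfold walsh
  refine Finset.measurable_prod _ fun k _ => ?_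
  split_ifs
  · exact measurable_rademacher k
  · exact measurable_const

theorem abs_walsh_le (n : ℕ) (x : ℝ) : |walsh n x| ≤ 1 := by
  unfold walsh
  rw [Finset.abs_prod]
  refine Finset.prod_le_one (fun _ _ => abs_nonneg _) fun k _ => ?_
  split_ifs
  · unfold rademacher
    rcases Real.sign_apply_eq (Real.sin (2 ^ (k + 1) * Real.pi * x)) with h | h | h <;>
      rw [h] <;> norm_num
  · norm_num

theorem integrable_mul_walsh {f : ℝ → ℝ} (hf : Integrable f μT) (n : ℕ) :
    Integrable (fun t => f t * walsh n t) μT := by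
  refine Integrable.mono hf (hf.1.mul (measurable_walsh n).aestronglyMeasurable)
    (Eventually.of_forall fun t => ?_)
  rw [norm_mul]
  exact mul_le_of_le_one_right (norm_nonneg _) (abs_walsh_le n t)

theorem measurable_walshSum (f : ℝ → ℝ) (n : ℕ) : Measurable (walshSum f n) := by
  unfold walshSum
  exact Finset.measurable_sum _ fun m _ => (measurable_walsh m).const_mul _

theorem walshSum_congr_ae {f g : ℝ → ℝ} (h : f =ᵐ[μT] g) (n : ℕ) (x : ℝ) :
    walshSum f n x = walshSum g n x := by
  unfold walshSum
  refine Finset.sum_congr rfl fun m _ => ?_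
  congr 1
  refine integral_congr_ae ?_
  filter_upwards [h] with t ht
  rw [ht]

theorem walshSum_add {f g : ℝ → ℝ} (hf : Integrable f μT) (hg : Integrable g μT) (n : ℕ) (x : ℝ) :
    walshSum (fun t => f t + g t) n x = walshSum f n x + walshSum g n x := by
  unfold walshSum
  rw [← Finset.sum_add_distrib]
  refine Finset.sum_congr rfl fun m _ => ?_
  simp only [add_mul]
  rw [integral_add (integrable_mul_walsh hf m) (integrable_mul_walsh hg m), add_mul]

/-- The maximal Walsh partial sum with values in `[0,∞]`. -/
def maxSum (f : ℝ → ℝ) (x : ℝ) : ℝ≥0∞ := ⨆ n, ‖walshSum f n x‖ₑ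

theorem measurable_maxSum (f : ℝ → ℝ) : Measurable (maxSum f) :=
  Measurable.iSup fun n => (measurable_walshSum f n).enorm

theorem lt_maxSum_iff {f : ℝ → ℝ} {x : ℝ} {t : ℝ≥0∞} (ht : t ≠ ∞) :
    t < maxSum f x ↔ ∃ n, t.toReal < |walshSum f n x| := by
  unfold maxSum
  rw [lt_iSup_iff]
  refine exists_congr fun n => ?_
  rw [Real.enorm_eq_ofReal_abs, ENNReal.lt_ofReal_iff_toReal_lt ht]

theorem mul_maxSum_le {f : ℝ → ℝ} (hf : Integrable f μT) {R : ℝ} (hR : 0 < R)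
    (hfR : ∀ t, |f t| ≤ R) {β : ℝ} (hβ : 0 < β) (hfβ : ∫ t, |f t| ∂μT ≤ β) {i₀ : ℕ}
    (hi₀ : R ≤ 2 ^ i₀ * β) {t : ℝ≥0∞} (ht : t ≠ ∞) :
    t * μT {x | t < maxSum f x} ≤ ENNReal.ofReal (400 * β * (i₀ + 1)) := by
  have h := mul_μT_walshSum_le hf hR hfR hβ hfβ hi₀ (lam := t.toReal) ENNReal.toReal_nonneg
  rw [ENNReal.ofReal_toReal ht] at h
  simp_rw [lt_maxSum_iff ht]
  exact h

theorem walshSum_zero (n : ℕ) (x : ℝ) : walshSum (fun _ => 0) n x = 0 := by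
  simp [walshSum]

theorem maxSum_indicator_iUnion_le {f : ℝ → ℝ} (hf : Integrable f μT) {B : ℕ → Set ℝ}
    (hB : ∀ k, MeasurableSet (B k)) (hd : Pairwise (Function.onFun Disjoint B)) (x : ℝ) :
    maxSum ((⋃ k, B k).indicator f) x ≤ ∑' k, maxSum ((B k).indicator f) x := by
  refine iSup_le fun n => ?_
  have hcoef : ∀ {s : Set ℝ}, MeasurableSet s → ∀ m,
      ∫ t, s.indicator f t * walsh m t ∂μT = ∫ t in s, f t * walsh m t ∂μT := by
    intro s hs m
    rw [← integral_indicator hs]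
    refine integral_congr_ae (Eventually.of_forall fun t => ?_)
    by_cases h : t ∈ s <;> simp [h]
  have h1 : HasSum (fun k => walshSum ((B k).indicator f) n x)
      (walshSum ((⋃ k, B k).indicator f) n x) := by
    unfold walshSum
    refine hasSum_sum fun m _ => HasSum.mul_right _ ?_
    simp only [hcoef (hB _), hcoef (MeasurableSet.iUnion hB)]
    exact hasSum_integral_iUnion hB hd (integrable_mul_walsh hf m).integrableOn
  rw [← h1.tsum_eq]
  refine enorm_tsum_le_tsum_enorm.trans (ENNReal.tsum_le_tsum fun k => ?_)
  exact le_iSup (fun n => ‖walshSum ((B k).indicator f) n x‖ₑ) n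

/-- The set where `|f|` is of size about `2 ^ 2 ^ k`. -/
def levelSet (f : ℝ → ℝ) (k : ℕ) : Set ℝ :=
  {x | |f x| ≤ 2 ^ 2 ^ k ∧ ∀ j < k, (2 : ℝ) ^ 2 ^ j < |f x|}

theorem measurableSet_levelSet {f : ℝ → ℝ} (hf : Measurable f) (k : ℕ) :
    MeasurableSet (levelSet f k) := by
  have h1 : levelSet f k = {x | |f x| ≤ 2 ^ 2 ^ k} ∩
      ⋂ j, ⋂ (_ : j < k), {x | (2 : ℝ) ^ 2 ^ j < |f x|} := by
    ext x; simp [levelSet]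
  rw [h1]
  have ha : Measurable fun x => |f x| := hf.abs
  exact (measurableSet_le ha measurable_const).inter
    (MeasurableSet.iInter fun j => MeasurableSet.iInter fun _ =>
      measurableSet_lt measurable_const ha)

theorem disjoint_levelSet (f : ℝ → ℝ) : Pairwise (Function.onFun Disjoint (levelSet f)) := by
  have h : ∀ k l, k < l → Disjoint (levelSet f k) (levelSet f l) := fun k l hkl =>
    Set.disjoint_left.2 fun x hx hx' => absurd hx.1 (not_le.2 (hx'.2 k hkl))
  intro k l hkl
  rcases lt_or_gt_of_ne hkl with h1 | h1
  · exact h k l h1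
  · exact (h l k h1).symm

theorem exists_mem_levelSet (f : ℝ → ℝ) (x : ℝ) : ∃ k, x ∈ levelSet f k := by
  have h : ∃ k : ℕ, |f x| ≤ 2 ^ 2 ^ k := by
    obtain ⟨n, hn⟩ := pow_unbounded_of_one_lt |f x| (one_lt_two : (1 : ℝ) < 2)
    exact ⟨n, hn.le.trans (pow_le_pow_right₀ (by norm_num) Nat.lt_two_pow_self.le)⟩
  exact ⟨Nat.find h, Nat.find_spec h, fun j hj => not_le.1 (Nat.find_min h hj)⟩

/-- The weak-type constant of the part of `f` on its `k`-th level set. -/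
def levelCoef (f : ℝ → ℝ) (k : ℕ) : ℝ :=
  400 * ((∫ t in levelSet f k, |f t| ∂μT) + (2 ^ 2 ^ k)⁻¹) * (2 ^ (k + 1) + 1)

theorem levelCoef_nonneg (f : ℝ → ℝ) (k : ℕ) : 0 ≤ levelCoef f k := by
  unfold levelCoef
  have : 0 ≤ ∫ t in levelSet f k, |f t| ∂μT := integral_nonneg fun t => abs_nonneg _
  positivity

theorem mul_maxSum_levelSet_le {f : ℝ → ℝ} (hfm : Measurable f) (hf : Integrable f μT) (k : ℕ)
    {t : ℝ≥0∞} (ht : t ≠ ∞) :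
    t * μT {x | t < maxSum ((levelSet f k).indicator f) x} ≤ ENNReal.ofReal (levelCoef f k) := by
  have hm := measurableSet_levelSet hfm k
  have habs : ∀ t, |(levelSet f k).indicator f t| = (levelSet f k).indicator (fun t => |f t|) t := by
    intro t
    by_cases h : t ∈ levelSet f k <;> simp [h]
  have h0 : 0 ≤ ∫ t in levelSet f k, |f t| ∂μT := integral_nonneg fun t => abs_nonneg _
  have h := mul_maxSum_le (hf.indicator hm) (R := 2 ^ 2 ^ k) (by positivity)
    (fun t => by
      rw [habs]
      by_cases h : t ∈ levelSet f k
      · rw [Set.indicator_of_mem h]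
        exact h.1
      · rw [Set.indicator_of_notMem h]
        positivity)
    (β := (∫ t in levelSet f k, |f t| ∂μT) + (2 ^ 2 ^ k)⁻¹) (by positivity)
    (by
      simp only [habs]
      rw [integral_indicator hm]
      have : (0 : ℝ) < (2 ^ 2 ^ k)⁻¹ := by positivity
      linarith) (i₀ := 2 ^ (k + 1))
    (by
      have h1 : (2 : ℝ) ^ 2 ^ (k + 1) * (2 ^ 2 ^ k)⁻¹ = 2 ^ 2 ^ k := by
        rw [pow_succ 2 k, mul_two, pow_add]
        field_simp
      have h2 : (0 : ℝ) ≤ 2 ^ 2 ^ (k + 1) * ∫ t in levelSet f k, |f t| ∂μT := by positivity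
      rw [mul_add, h1]
      linarith) ht
  refine h.trans (le_of_eq ?_)
  rw [levelCoef]
  push_cast
  rfl

/-- The part of `f` on the levels in `S`. -/
def levelPart (f : ℝ → ℝ) (S : Set ℕ) : ℝ → ℝ :=
  (⋃ k, if k ∈ S then levelSet f k else ∅).indicator f

theorem mul_maxSum_levelPart_le {f : ℝ → ℝ} (hfm : Measurable f) (hf : Integrable f μT) (S : Set ℕ)
    {t : ℝ≥0∞} (ht : t ≠ ∞) :
    t * μT {x | t < maxSum (levelPart f S) x}
      ≤ 5 * ∑' k, S.indicator (fun k => ENNReal.ofReal (scaleCount k * levelCoef f k)) k := by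
  set B : ℕ → Set ℝ := fun k => if k ∈ S then levelSet f k else ∅ with hB
  have hBm : ∀ k, MeasurableSet (B k) := by
    intro k
    simp only [hB]
    split_ifs
    · exact measurableSet_levelSet hfm k
    · exact MeasurableSet.empty
  have hBd : Pairwise (Function.onFun Disjoint B) := by
    intro k l hkl
    have := disjoint_levelSet f hkl
    simp only [Function.onFun, hB] at this ⊢
    split_ifs <;> simp [this]
  have h1 := mul_measure_tsum_le μT (G := fun k => maxSum ((B k).indicator f))
    (fun k => measurable_maxSum _)
    (a := S.indicator fun k => ENNReal.ofReal (levelCoef f k)) (fun k t ht => by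
      by_cases hk : k ∈ S
      · simp only [hB, hk, if_true, Set.indicator_of_mem]
        exact mul_maxSum_levelSet_le hfm hf k ht
      · have h0 : ∀ x, maxSum (fun _ => (0 : ℝ)) x = 0 := fun x => by
          simp [maxSum, walshSum_zero]
        simp [hB, hk, h0]) one_le_scaleCount tsum_scaleCount_le ht
  calc t * μT {x | t < maxSum (levelPart f S) x}
      ≤ t * μT {x | t < ∑' k, maxSum ((B k).indicator f) x} := by
        refine mul_le_mul_right (measure_mono fun x hx => ?_) t
        exact lt_of_lt_of_le hx (maxSum_indicator_iUnion_le hf hBm hBd x)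
    _ ≤ _ := h1
    _ = _ := by
        congr 2
        funext k
        by_cases hk : k ∈ S
        · simp only [hk, Set.indicator_of_mem]
          rw [ENNReal.ofReal_mul (by positivity), ENNReal.ofReal_natCast]
        · simp [hk]

theorem PhiA_nonneg {v : ℝ} (hv : 0 ≤ v) : 0 ≤ PhiA v := hv.trans (le_PhiA hv)

theorem tsum_levelCoef_le {f : ℝ → ℝ} (hfm : Measurable f) (hf : Integrable f μT)
    (hΦ : Integrable (fun x => PhiA |f x|) μT) :
    ∑' k, ENNReal.ofReal (scaleCount k * levelCoef f k)
      ≤ ENNReal.ofReal (400 * 132 * (∫ x, PhiA |f x| ∂μT) + 400 * 72) := by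
  have hterm : ∀ k, (scaleCount k : ℝ) * levelCoef f k
      ≤ 400 * 132 * (∫ x in levelSet f k, PhiA |f x| ∂μT) + 400 * 36 * (1 / 2) ^ k := by
    intro k
    have h1 : (scaleCount k : ℝ) * (2 ^ (k + 1) + 1) * (∫ t in levelSet f k, |f t| ∂μT)
        ≤ 132 * (∫ x in levelSet f k, PhiA |f x| ∂μT) := by
      rw [← integral_const_mul, ← integral_const_mul]
      refine setIntegral_mono_on (hf.abs.integrableOn.const_mul _) (hΦ.integrableOn.const_mul _)
        (measurableSet_levelSet hfm k) fun x hx => ?_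
      exact scaleCount_mul_le_PhiA (abs_nonneg _) hx.2
    have h2 := scaleCount_mul_error_le k
    unfold levelCoef
    nlinarith
  have hint : ∀ k, 0 ≤ ∫ x in levelSet f k, PhiA |f x| ∂μT := fun k =>
    integral_nonneg fun x => PhiA_nonneg (abs_nonneg _)
  have hs1 : HasSum (fun k => ∫ x in levelSet f k, PhiA |f x| ∂μT) (∫ x, PhiA |f x| ∂μT) := by
    have h := hasSum_integral_iUnion (μ := μT) (f := fun x => PhiA |f x|)
      (measurableSet_levelSet hfm) (disjoint_levelSet f) hΦ.integrableOn
    rwa [show ⋃ k, levelSet f k = Set.univ from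
      Set.eq_univ_of_forall fun x => Set.mem_iUnion.2 (exists_mem_levelSet f x),
      setIntegral_univ] at h
  have hs2 : HasSum (fun k : ℕ => (1 / 2 : ℝ) ^ k) 2 := hasSum_geometric_two
  have hs3 := (hs1.mul_left (400 * 132)).add (hs2.mul_left (400 * 36))
  have hnn : ∀ k : ℕ, 0 ≤ 400 * 132 * (∫ x in levelSet f k, PhiA |f x| ∂μT)
      + 400 * 36 * (1 / 2) ^ k := fun k => by
    have := hint k
    positivity
  calc _ ≤ ∑' k : ℕ, ENNReal.ofReal (400 * 132 * (∫ x in levelSet f k, PhiA |f x| ∂μT)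
        + 400 * 36 * (1 / 2) ^ k) :=
        ENNReal.tsum_le_tsum fun k => ENNReal.ofReal_le_ofReal (hterm k)
    _ = ENNReal.ofReal (400 * 132 * (∫ x, PhiA |f x| ∂μT) + 400 * 36 * 2) := by
        rw [← ENNReal.ofReal_tsum_of_nonneg hnn hs3.summable, hs3.tsum_eq]
    _ = _ := by norm_num

theorem levelPart_univ (f : ℝ → ℝ) : levelPart f Set.univ = f := by
  unfold levelPart
  simp only [Set.mem_univ, if_true]
  rw [show ⋃ k, levelSet f k = Set.univ from
      Set.eq_univ_of_forall fun x => Set.mem_iUnion.2 (exists_mem_levelSet f x), Set.indicator_univ]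

theorem mul_maxSum_le_of_PhiA {f : ℝ → ℝ} (hfm : Measurable f) (hf : Integrable f μT)
    (hΦ : Integrable (fun x => PhiA |f x|) μT) (hΦ1 : ∫ x, PhiA |f x| ∂μT ≤ 1)
    {t : ℝ≥0∞} (ht : t ≠ ∞) :
    t * μT {x | t < maxSum f x} ≤ ENNReal.ofReal 500000 := by
  have h := mul_maxSum_levelPart_le hfm hf Set.univ ht
  rw [levelPart_univ] at h
  simp only [Set.indicator_univ] at h
  refine h.trans ?_
  calc 5 * ∑' k, ENNReal.ofReal (scaleCount k * levelCoef f k)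
      ≤ 5 * ENNReal.ofReal (400 * 132 + 400 * 72) := by
        refine mul_le_mul_right ((tsum_levelCoef_le hfm hf hΦ).trans ?_) 5
        refine ENNReal.ofReal_le_ofReal ?_
        linarith
    _ ≤ _ := by
        rw [show (5 : ℝ≥0∞) = ENNReal.ofReal 5 by simp, ← ENNReal.ofReal_mul (by norm_num)]
        exact ENNReal.ofReal_le_ofReal (by norm_num)

theorem integrable_comp_code (φ : Cube N → ℝ) : Integrable (fun t => φ (code N t)) μT := by
  refine Integrable.of_bound (C := ∑ y, |φ y|)
    ((measurable_of_countable φ).comp (measurable_code N)).aestronglyMeasurable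
    (Eventually.of_forall fun t => ?_)
  exact Finset.single_le_sum (f := fun y => |φ y|) (fun y _ => abs_nonneg _) (Finset.mem_univ _)

theorem cellAvg_const (c : ℝ) (y : Cube N) : cellAvg (fun _ => c) N y = c := by
  unfold cellAvg
  rw [setIntegral_const, Measure.real, μT_code_fiber, ENNReal.toReal_ofReal (by positivity),
    smul_eq_mul]
  field_simp

theorem cellAvg_sub {f g : ℝ → ℝ} (hf : Integrable f μT) (hg : Integrable g μT) (y : Cube N) :
    cellAvg (fun t => f t - g t) N y = cellAvg f N y - cellAvg g N y := by
  unfold cellAvg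
  rw [integral_sub hf.integrableOn hg.integrableOn, mul_sub]

theorem integral_comp_code (φ : Cube N → ℝ) :
    ∫ t, φ (code N t) ∂μT = 1 / 2 ^ N * ∑ y, φ y := by
  have h := integral_mul_code (integrable_const (1 : ℝ)) φ
  simpa only [one_mul, cellAvg_const] using h

theorem sum_wal_mul_wal {b c : Cube N} (h : b ≠ c) : ∑ y, wal b y * wal c y = 0 := by
  obtain ⟨k, hk⟩ := Function.ne_iff.1 h
  refine sum_eq_zero_of_flip k fun y => ?_
  rw [wal_flip, wal_flip]
  cases hb : b k <;> cases hc : c k <;> simp_all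

theorem bits_injOn {m n : ℕ} (hm : m < 2 ^ N) (hn : n < 2 ^ N) (h : bits N m = bits N n) :
    m = n := by
  refine Nat.eq_of_testBit_eq fun i => ?_
  by_cases hi : i < N
  · exact congrFun h ⟨i, hi⟩
  · have h2 : 2 ^ N ≤ 2 ^ i := Nat.pow_le_pow_right (by norm_num) (not_lt.1 hi)
    rw [Nat.testBit_lt_two_pow (hm.trans_le h2), Nat.testBit_lt_two_pow (hn.trans_le h2)]

/-- The Walsh system is orthonormal. -/
theorem integral_walsh_mul_walsh (m n : ℕ) :
    ∫ t, walsh m t * walsh n t ∂μT = if m = n then 1 else 0 := by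
  obtain ⟨N, hm, hn⟩ : ∃ N, m < 2 ^ N ∧ n < 2 ^ N :=
    ⟨m + n, lt_of_lt_of_le Nat.lt_two_pow_self (Nat.pow_le_pow_right (by norm_num) (by omega)),
      lt_of_lt_of_le Nat.lt_two_pow_self (Nat.pow_le_pow_right (by norm_num) (by omega))⟩
  have h1 : ∫ t, walsh m t * walsh n t ∂μT
      = ∫ t, wal (bits N m) (code N t) * wal (bits N n) (code N t) ∂μT := by
    refine integral_congr_ae ?_
    filter_upwards [ae_regular] with t ht
    rw [ht.walsh_eq hm, ht.walsh_eq hn]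
  rw [h1, integral_comp_code fun y => wal (bits N m) y * wal (bits N n) y]
  split_ifs with h
  · subst h
    simp [wal_mul_self]
  · rw [sum_wal_mul_wal fun h2 => h (bits_injOn hm hn h2), mul_zero]

theorem integrable_walsh (n : ℕ) : Integrable (walsh n) μT := by
  simpa using integrable_mul_walsh (integrable_const (1 : ℝ)) n

/-- Partial sums are projections. -/
theorem walshSum_walshSum (f : ℝ → ℝ) {k n : ℕ} (hkn : k ≤ n) (x : ℝ) :
    walshSum (walshSum f k) n x = walshSum f k x := by
  have h1 : ∀ m, ∫ t, walshSum f k t * walsh m t ∂μT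
      = if m < k then ∫ t, f t * walsh m t ∂μT else 0 := by
    intro m
    unfold walshSum
    simp only [Finset.sum_mul, mul_assoc]
    rw [integral_finsetSum _ fun j _ => (integrable_mul_walsh (integrable_walsh j) m).const_mul _]
    simp only [integral_const_mul, integral_walsh_mul_walsh]
    simp
  rw [walshSum]
  simp only [h1]
  unfold walshSum
  rw [← Finset.sum_subset (Finset.range_subset_range.2 hkn)]
  · refine Finset.sum_congr rfl fun m hm => ?_
    rw [if_pos (Finset.mem_range.1 hm)]
  · intro m _ hm
    rw [if_neg (by simpa using hm), zero_mul]

theorem sum_two_pow_walProd (K : ℕ) : ∀ r : ℕ → ℝ,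
    ∑ m ∈ Finset.range (2 ^ K), walProd K r m = ∏ i ∈ Finset.range K, (1 + r i) := by
  induction K with
  | zero => intro r; simp [walProd]
  | succ K ih =>
    intro r
    rw [pow_succ', sum_range_two_mul, Finset.prod_range_succ', ← ih, Finset.sum_mul]
    refine Finset.sum_congr rfl fun m _ => ?_
    rw [walProd_succ_even, walProd_succ_odd]
    ring

/-- Partial sums of dyadic order are averages over dyadic intervals. -/
theorem walshSum_two_pow {f : ℝ → ℝ} (hf : Integrable f μT) {x : ℝ} (hx : Regular x) :
    walshSum f (2 ^ N) x = cellAvg f N (code N x) := by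
  have h1 : walshSum f (2 ^ N) x = ∑ m ∈ Finset.range (2 ^ N),
      (1 / 2 ^ N * ∑ y, cellAvg f N y * wal (bits N m) y) * wal (bits N m) (code N x) := by
    unfold walshSum
    refine Finset.sum_congr rfl fun m hm => ?_
    have hm' : m < 2 ^ N := Finset.mem_range.1 hm
    rw [hx.walsh_eq hm', ← integral_mul_code hf]
    congr 1
    refine integral_congr_ae ?_
    filter_upwards [ae_regular] with t ht
    rw [ht.walsh_eq hm']
  have h2 : ∀ y, ∑ m ∈ Finset.range (2 ^ N), wal (bits N m) (code N x) * wal (bits N m) y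
      = if code N x = y then 2 ^ N else 0 := by
    intro y
    have h3 := sum_two_pow_walProd N (radSeq (code N x) y)
    rw [prod_one_add_radSeq _ _ le_rfl] at h3
    simp only [walProd_radSeq] at h3
    rw [h3]
    have h4 : Agree N (code N x) y ↔ code N x = y :=
      ⟨fun h => funext fun i => h i i.2, fun h => h ▸ Agree.refl _ _⟩
    simp only [h4]
  calc walshSum f (2 ^ N) x = ∑ y, 1 / 2 ^ N * cellAvg f N y *
        ∑ m ∈ Finset.range (2 ^ N), wal (bits N m) (code N x) * wal (bits N m) y := by
        rw [h1]
        simp_rw [Finset.mul_sum, Finset.sum_mul]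
        rw [Finset.sum_comm]
        exact Finset.sum_congr rfl fun y _ => Finset.sum_congr rfl fun m _ => by ring
    _ = _ := by
        simp only [h2]
        simp
        field_simp

theorem abs_cellAvg_le_of_bound {f : ℝ → ℝ} {R : ℝ} (hR : 0 < R) (hf : ∀ t, |f t| ≤ R)
    (y : Cube N) : |cellAvg f N y| ≤ R := by
  have h1 := abs_cellAvg_le_one (N := N) (f := fun t => R⁻¹ * f t) (fun t => by
    rw [abs_mul, abs_of_pos (inv_pos.2 hR), inv_mul_le_iff₀ hR, mul_one]; exact hf t) y
  have h2 : cellAvg (fun t => R⁻¹ * f t) N y = R⁻¹ * cellAvg f N y := by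
    unfold cellAvg
    rw [integral_const_mul, mul_left_comm]
  rw [h2, abs_mul, abs_of_pos (inv_pos.2 hR), inv_mul_le_iff₀ hR, mul_one] at h1
  exact h1

theorem abs_sub_lt_of_code_eq {x t : ℝ} (hx : x ∈ Set.Ico (0 : ℝ) 1) (ht : t ∈ Set.Ico (0 : ℝ) 1)
    (h : code N t = code N x) : |x - t| < 1 / 2 ^ N := by
  obtain ⟨m, hm⟩ := revBits_surjective (code N x)
  have h1 : x ∈ code N ⁻¹' {revBits N m} ∩ Set.Ico (0 : ℝ) 1 := ⟨hm.symm, hx⟩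
  have h2 : t ∈ code N ⁻¹' {revBits N m} ∩ Set.Ico (0 : ℝ) 1 := ⟨h.trans hm.symm, ht⟩
  rw [code_fiber] at h1 h2
  have h3 : ((m : ℝ) + 1) / 2 ^ N = m / 2 ^ N + 1 / 2 ^ N := add_div _ _ _
  rw [abs_lt]
  constructor <;> linarith [h1.1, h1.2, h2.1, h2.2]

theorem exists_abs_sub_cellAvg_le {g : ℝ → ℝ} (hg : Continuous g) (hgi : Integrable g μT) {ε : ℝ}
    (hε : 0 < ε) : ∃ N, ∀ x ∈ Set.Ico (0 : ℝ) 1, |g x - cellAvg g N (code N x)| ≤ ε := by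
  have hu := isCompact_Icc.uniformContinuousOn_of_continuous (hg.continuousOn (s := Set.Icc 0 1))
  obtain ⟨δ, hδ, h⟩ := Metric.uniformContinuousOn_iff_le.1 hu ε hε
  obtain ⟨N, hN⟩ := exists_pow_lt_of_lt_one hδ (by norm_num : (1 / 2 : ℝ) < 1)
  refine ⟨N, fun x hx => ?_⟩
  have h1 : g x - cellAvg g N (code N x) = 2 ^ N * ∫ t in code N ⁻¹' {code N x}, (g x - g t) ∂μT := by
    have h2 := cellAvg_sub (integrable_const (g x)) hgi (code N x)
    rw [cellAvg_const] at h2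
    rw [← h2, cellAvg]
  have h3 : ‖∫ t in code N ⁻¹' {code N x}, (g x - g t) ∂μT‖
      ≤ ε * μT.real (code N ⁻¹' {code N x}) := by
    refine norm_setIntegral_le_of_norm_le_const_ae' (measure_lt_top _ _) ?_
    filter_upwards [ae_regular] with t ht htx
    have h4 := abs_sub_lt_of_code_eq hx ht.1 htx
    refine h x (Set.Ico_subset_Icc_self hx) t (Set.Ico_subset_Icc_self ht.1) ?_
    rw [Real.dist_eq]
    rw [one_div_pow] at hN
    linarith
  rw [Measure.real, μT_code_fiber, ENNReal.toReal_ofReal (by positivity), Real.norm_eq_abs] at h3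
  rw [h1, abs_mul, abs_of_pos (by positivity : (0 : ℝ) < 2 ^ N)]
  calc (2 : ℝ) ^ N * _ ≤ 2 ^ N * (ε * (1 / 2 ^ N)) := by gcongr
    _ = ε := by field_simp

theorem integral_abs_cellAvg_le {f : ℝ → ℝ} (hf : Integrable f μT) (N : ℕ) :
    ∫ t, |cellAvg f N (code N t)| ∂μT ≤ ∫ t, |f t| ∂μT := by
  rw [integral_comp_code fun y => |cellAvg f N y|, one_div, inv_mul_le_iff₀ (by positivity),
    mul_comm]
  exact sum_abs_cellAvg_le hf

/-- Dyadic averages converge in `L¹`. -/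
theorem exists_integral_abs_sub_cellAvg_le {f : ℝ → ℝ} (hf : Integrable f μT) {ε : ℝ}
    (hε : 0 < ε) : ∃ N, ∫ t, |f t - cellAvg f N (code N t)| ∂μT ≤ ε := by
  obtain ⟨g, -, hfg, hg, hgi⟩ := hf.exists_hasCompactSupport_integral_sub_le
    (show 0 < ε / 3 by positivity)
  obtain ⟨N, hN⟩ := exists_abs_sub_cellAvg_le hg hgi (show 0 < ε / 3 by positivity)
  refine ⟨N, ?_⟩
  simp only [Real.norm_eq_abs] at hfg
  have h1 := integral_abs_cellAvg_le (hf.sub hgi) N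
  simp only [Pi.sub_apply] at h1
  have i1 : Integrable (fun t => |f t - g t|) μT := (hf.sub hgi).abs
  have i2 : Integrable (fun t => |cellAvg (f - g) N (code N t)|) μT :=
    (integrable_comp_code (cellAvg (f - g) N)).abs
  have i3 : Integrable (fun t => |f t - g t| + ε / 3) μT := i1.add (integrable_const _)
  calc ∫ t, |f t - cellAvg f N (code N t)| ∂μT
      ≤ ∫ t, (|f t - g t| + ε / 3 + |cellAvg (f - g) N (code N t)|) ∂μT := by
        refine integral_mono_ae (hf.sub (integrable_comp_code _)).abs
          (i3.add i2) ?_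
        filter_upwards [ae_regular] with t ht
        have h2 := hN t ht.1
        have h3 : cellAvg (f - g) N (code N t) = cellAvg f N (code N t) - cellAvg g N (code N t) :=
          cellAvg_sub hf hgi _
        rw [h3]
        have h4 : f t - cellAvg f N (code N t) = (f t - g t) + (g t - cellAvg g N (code N t))
          - (cellAvg f N (code N t) - cellAvg g N (code N t)) := by ring
        rw [h4]
        refine (abs_sub _ _).trans (add_le_add ((abs_add_le _ _).trans ?_) le_rfl)
        linarith
    _ = (∫ t, |f t - g t| ∂μT) + ε / 3 + ∫ t, |cellAvg (f - g) N (code N t)| ∂μT := by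
        rw [integral_add i3 i2, integral_add i1 (integrable_const _)]
        simp
    _ ≤ ε := by linarith

theorem integrable_of_PhiA {f : ℝ → ℝ} (hf : AEStronglyMeasurable f μT)
    (hΦ : Integrable (fun x => PhiA |f x|) μT) : Integrable f μT := by
  refine Integrable.mono hΦ hf (Eventually.of_forall fun x => ?_)
  rw [Real.norm_eq_abs, Real.norm_eq_abs, abs_of_nonneg (PhiA_nonneg (abs_nonneg _))]
  exact le_PhiA (abs_nonneg _)

theorem lintegral_levelPart_le {f : ℝ → ℝ} (hfm : Measurable f) (hf : Integrable f μT)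
    (S : Set ℕ) : ∫⁻ x, ‖levelPart f S x‖ₑ ∂μT
      ≤ ∑' k, S.indicator (fun k => ENNReal.ofReal (scaleCount k * levelCoef f k)) k := by
  have hBm : ∀ k, MeasurableSet (if k ∈ S then levelSet f k else ∅) := by
    intro k
    split_ifs
    · exact measurableSet_levelSet hfm k
    · exact MeasurableSet.empty
  have h1 : ∀ x, ‖levelPart f S x‖ₑ
      = (⋃ k, if k ∈ S then levelSet f k else ∅).indicator (fun x => ‖f x‖ₑ) x := fun x => by
    unfold levelPart
    rw [enorm_indicator_eq_indicator_enorm]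
  simp_rw [h1]
  rw [lintegral_indicator (MeasurableSet.iUnion hBm)]
  refine (lintegral_iUnion_le _ _).trans (ENNReal.tsum_le_tsum fun k => ?_)
  by_cases hk : k ∈ S
  · simp only [hk, if_true, Set.indicator_of_mem]
    have h2 := ofReal_integral_norm_eq_lintegral_enorm (hf.integrableOn (s := levelSet f k))
    rw [← h2]
    refine ENNReal.ofReal_le_ofReal ?_
    have h3 : (1 : ℝ) ≤ scaleCount k := by exact_mod_cast one_le_scaleCount k
    have h4 : 0 ≤ ∫ t in levelSet f k, |f t| ∂μT := integral_nonneg fun t => abs_nonneg _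
    have h5 : (0 : ℝ) < (2 ^ 2 ^ k)⁻¹ := by positivity
    have h6 : (1 : ℝ) ≤ 2 ^ (k + 1) := one_le_pow₀ (by norm_num)
    have h7 : ∫ t in levelSet f k, |f t| ∂μT ≤ levelCoef f k := by
      unfold levelCoef
      nlinarith
    exact h7.trans (le_mul_of_one_le_left (levelCoef_nonneg f k) h3)
  · simp [hk]

theorem integrable_levelPart {f : ℝ → ℝ} (hfm : Measurable f) (hf : Integrable f μT)
    (S : Set ℕ) : Integrable (levelPart f S) μT := by
  refine hf.indicator (MeasurableSet.iUnion fun k => ?_)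
  split_ifs
  · exact measurableSet_levelSet hfm k
  · exact MeasurableSet.empty

theorem abs_sub_levelPart_le (f : ℝ → ℝ) {S : Set ℕ} {K : ℕ} (hS : ∀ k, K ≤ k → k ∈ S)
    (x : ℝ) : |f x - levelPart f S x| ≤ 2 ^ 2 ^ K := by
  obtain ⟨k, hk⟩ := exists_mem_levelSet f x
  by_cases hx : x ∈ ⋃ k, if k ∈ S then levelSet f k else ∅
  · rw [levelPart, Set.indicator_of_mem hx, sub_self, abs_zero]
    positivity
  · rw [levelPart, Set.indicator_of_notMem hx, sub_zero]
    have hkK : k < K := by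
      by_contra h
      refine hx (Set.mem_iUnion.2 ⟨k, ?_⟩)
      rw [if_pos (hS k (not_lt.1 h))]
      exact hk
    exact hk.1.trans (pow_le_pow_right₀ (by norm_num)
      (Nat.pow_le_pow_right (by norm_num) hkK.le))

theorem exists_tail_le {c : ℕ → ℝ≥0∞} (hc : ∑' k, c k ≠ ∞) {η : ℝ≥0∞} (hη : 0 < η) :
    ∃ K : ℕ, ∑' k, (Set.Ici K).indicator c k ≤ η := by
  have h := (ENNReal.tendsto_sum_nat_add c hc).eventually (ge_mem_nhds hη)
  obtain ⟨K, hK⟩ := h.exists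
  refine ⟨K, le_trans (le_of_eq ?_) hK⟩
  have hsupp : Function.support ((Set.Ici K).indicator c) ⊆ Set.range fun k => k + K := by
    intro k hk
    have : k ∈ Set.Ici K := Set.mem_of_indicator_ne_zero hk
    exact ⟨k - K, Nat.sub_add_cancel this⟩
  rw [← (add_left_injective K).tsum_eq hsupp]
  exact tsum_congr fun k => Set.indicator_of_mem (Nat.le_add_left K k) _

theorem exists_add_one_div_two_pow_le {ε : ℝ} (hε : 0 < ε) :
    ∃ i : ℕ, ((i : ℝ) + 1) / 2 ^ i ≤ ε := by
  have h := (tendsto_self_mul_const_pow_of_lt_one (r := (1 / 2 : ℝ)) (by norm_num)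
    (by norm_num)).comp (tendsto_add_atTop_nat 1)
  obtain ⟨i, hi⟩ := (h.eventually (ge_mem_nhds (show (0 : ℝ) < ε / 2 by positivity))).exists
  refine ⟨i, ?_⟩
  simp only [Function.comp_apply, Nat.cast_add, Nat.cast_one, one_div_pow, pow_succ] at hi
  have h2 : ((i : ℝ) + 1) / 2 ^ i = 2 * (((i : ℝ) + 1) * (1 / (2 ^ i * 2))) := by
    field_simp
  rw [h2]
  linarith

/-- A decomposition of `f` into a Walsh polynomial and two small parts. -/
theorem exists_small_decomposition {f : ℝ → ℝ} (hfm : Measurable f) (hf : Integrable f μT)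
    (hΦ : Integrable (fun x => PhiA |f x|) μT) {η : ℝ} (hη : 0 < η) :
    ∃ (s h₁ h₂ : ℝ → ℝ) (M : ℕ), Integrable s μT ∧ Integrable h₁ μT ∧ Integrable h₂ μT ∧
      (∀ x, f x = s x + h₁ x + h₂ x) ∧
      (∀ x, Regular x → ∀ n, M ≤ n → walshSum s n x = s x) ∧
      (∀ t : ℝ≥0∞, t ≠ ∞ → t * μT {x | t < maxSum h₁ x} ≤ ENNReal.ofReal η) ∧
      ∫⁻ x, ‖h₁ x‖ₑ ∂μT ≤ ENNReal.ofReal η ∧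
      (∀ t : ℝ≥0∞, t ≠ ∞ → t * μT {x | t < maxSum h₂ x} ≤ ENNReal.ofReal η) ∧
      ∫⁻ x, ‖h₂ x‖ₑ ∂μT ≤ ENNReal.ofReal η := by
  have hfin : ∑' k, ENNReal.ofReal (scaleCount k * levelCoef f k) ≠ ∞ :=
    ne_top_of_le_ne_top ENNReal.ofReal_ne_top (tsum_levelCoef_le hfm hf hΦ)
  obtain ⟨K, hK⟩ := exists_tail_le hfin
    (show 0 < ENNReal.ofReal (η / 5) from ENNReal.ofReal_pos.2 (by positivity))
  set h₂ := levelPart f (Set.Ici K) with hh2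
  have ih2 : Integrable h₂ μT := integrable_levelPart hfm hf _
  set f₁ : ℝ → ℝ := fun x => f x - h₂ x with hf1
  have if1 : Integrable f₁ μT := hf.sub ih2
  set R : ℝ := 2 ^ 2 ^ K with hR
  have hR0 : 0 < R := by positivity
  have hf1R : ∀ x, |f₁ x| ≤ R := abs_sub_levelPart_le f fun _ h => h
  obtain ⟨i, hi⟩ := exists_add_one_div_two_pow_le (show 0 < η / (800 * R) by positivity)
  rw [le_div_iff₀ (by positivity)] at hi
  have hi' : 400 * (2 * R / 2 ^ i) * (i + 1) ≤ η := by
    refine le_trans (le_of_eq ?_) hi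
    ring
  have hβ : 0 < 2 * R / 2 ^ i := by positivity
  obtain ⟨N, hN⟩ := exists_integral_abs_sub_cellAvg_le if1 hβ
  set s : ℝ → ℝ := fun x => cellAvg f₁ N (code N x) with hs
  have is : Integrable s μT := integrable_comp_code _
  have ih1 : Integrable (fun x => f₁ x - s x) μT := if1.sub is
  refine ⟨s, fun x => f₁ x - s x, h₂, 2 ^ N, is, ih1, ih2, fun x => ?_, fun x hx n hn => ?_,
    fun t ht => ?_, ?_, fun t ht => ?_, ?_⟩
  · simp only [hf1]; ring
  · have h1 : s =ᵐ[μT] walshSum f₁ (2 ^ N) := by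
      filter_upwards [ae_regular] with y hy
      exact (walshSum_two_pow if1 hy).symm
    rw [walshSum_congr_ae h1, walshSum_walshSum _ hn, walshSum_two_pow if1 hx]
  · refine (mul_maxSum_le ih1 (R := 2 * R) (by positivity) (fun x => ?_) hβ hN (i₀ := i) ?_
      ht).trans (ENNReal.ofReal_le_ofReal hi')
    · refine (abs_sub _ _).trans ?_
      have := abs_cellAvg_le_of_bound hR0 hf1R (code N x)
      linarith [hf1R x]
    · rw [mul_div_cancel₀ _ (by positivity)]
  · rw [← ofReal_integral_norm_eq_lintegral_enorm ih1]
    refine ENNReal.ofReal_le_ofReal (le_trans hN (le_trans ?_ hi'))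
    have : (0 : ℝ) ≤ i := Nat.cast_nonneg i
    nlinarith
  · refine (mul_maxSum_levelPart_le hfm hf _ ht).trans ?_
    refine (mul_le_mul_right hK 5).trans (le_of_eq ?_)
    rw [show (5 : ℝ≥0∞) = ENNReal.ofReal 5 by simp, ← ENNReal.ofReal_mul (by norm_num)]
    congr 1
    ring
  · exact ((lintegral_levelPart_le hfm hf _).trans hK).trans
      (ENNReal.ofReal_le_ofReal (by linarith))

theorem measure_frequently_eq_zero {f : ℝ → ℝ} (hfm : Measurable f) (hf : Integrable f μT)
    (hΦ : Integrable (fun x => PhiA |f x|) μT) {δ : ℝ} (hδ : 0 < δ) :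
    μT {x | ∃ᶠ n in atTop, 4 * δ < |walshSum f n x - f x|} = 0 := by
  set D := ENNReal.ofReal δ with hD
  have hD0 : D ≠ 0 := (ENNReal.ofReal_pos.2 hδ).ne'
  have hDt : D ≠ ∞ := ENNReal.ofReal_ne_top
  have key : ∀ η : ℝ, 0 < η → D * μT {x | ∃ᶠ n in atTop, 4 * δ < |walshSum f n x - f x|}
      ≤ ENNReal.ofReal (4 * η) := by
    intro η hη
    obtain ⟨s, h₁, h₂, M, is, i1, i2, hsum, hs, hm1, hl1, hm2, hl2⟩ :=
      exists_small_decomposition hfm hf hΦ hη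
    have i3 : Integrable (fun t => s t + h₁ t) μT := is.add i1
    have hsub : μT {x | ∃ᶠ n in atTop, 4 * δ < |walshSum f n x - f x|}
        ≤ μT (({x | D < maxSum h₁ x} ∪ {x | D ≤ ‖h₁ x‖ₑ})
          ∪ ({x | D < maxSum h₂ x} ∪ {x | D ≤ ‖h₂ x‖ₑ})) := by
      refine measure_mono_ae ?_
      filter_upwards [ae_regular] with x hx hfr
      obtain ⟨n, hn, hnM⟩ := (hfr.and_eventually (eventually_ge_atTop M)).exists
      by_contra hcon
      have hc : ¬ (((∃ n, D.toReal < |walshSum h₁ n x|) ∨ D ≤ ‖h₁ x‖ₑ)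
          ∨ ((∃ n, D.toReal < |walshSum h₂ n x|) ∨ D ≤ ‖h₂ x‖ₑ)) := by
        rw [← lt_maxSum_iff hDt, ← lt_maxSum_iff hDt]
        exact hcon
      push Not at hc
      obtain ⟨⟨c1, c2⟩, c3, c4⟩ := hc
      have hDr : D.toReal = δ := ENNReal.toReal_ofReal hδ.le
      rw [hDr] at c1 c3
      rw [Real.enorm_eq_ofReal_abs, hD, ENNReal.ofReal_lt_ofReal_iff hδ] at c2 c4
      have hw : walshSum f n x = s x + walshSum h₁ n x + walshSum h₂ n x := by
        rw [show f = fun x => s x + h₁ x + h₂ x from funext hsum,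
          walshSum_add i3 i2 n x, walshSum_add is i1 n x, hs x hx n hnM]
      have h4 : walshSum f n x - f x
          = (walshSum h₁ n x - h₁ x) + (walshSum h₂ n x - h₂ x) := by
        rw [hw, hsum x]; ring
      rw [h4] at hn
      have h5 := abs_add_le (walshSum h₁ n x - h₁ x) (walshSum h₂ n x - h₂ x)
      have h6 := abs_sub (walshSum h₁ n x) (h₁ x)
      have h7 := abs_sub (walshSum h₂ n x) (h₂ x)
      linarith [c1 n, c3 n]
    calc D * μT {x | ∃ᶠ n in atTop, 4 * δ < |walshSum f n x - f x|}
        ≤ D * ((μT {x | D < maxSum h₁ x} + μT {x | D ≤ ‖h₁ x‖ₑ})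
          + (μT {x | D < maxSum h₂ x} + μT {x | D ≤ ‖h₂ x‖ₑ})) := by
          refine mul_le_mul_right (hsub.trans ((measure_union_le _ _).trans ?_)) D
          exact add_le_add (measure_union_le _ _) (measure_union_le _ _)
      _ ≤ (ENNReal.ofReal η + ENNReal.ofReal η) + (ENNReal.ofReal η + ENNReal.ofReal η) := by
          rw [mul_add, mul_add, mul_add]
          refine add_le_add (add_le_add (hm1 D hDt) ?_) (add_le_add (hm2 D hDt) ?_)
          · exact (mul_meas_ge_le_lintegral₀ i1.1.enorm D).trans hl1
          · exact (mul_meas_ge_le_lintegral₀ i2.1.enorm D).trans hl2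
      _ = _ := by
          rw [← ENNReal.ofReal_add hη.le hη.le, ← ENNReal.ofReal_add (by positivity)
            (by positivity)]
          congr 1
          ring
  have h0 : D * μT {x | ∃ᶠ n in atTop, 4 * δ < |walshSum f n x - f x|} ≤ 0 := by
    refine ENNReal.le_of_forall_pos_le_add fun ε hε _ => ?_
    rw [zero_add]
    refine (key (ε / 4) (by positivity)).trans (le_of_eq ?_)
    rw [mul_div_cancel₀ _ (by norm_num), ENNReal.ofReal_coe_nnreal]
  exact (mul_eq_zero.1 (le_antisymm h0 zero_le)).resolve_left hD0

theorem ae_tendsto_walshSum {f : ℝ → ℝ} (hfm : Measurable f) (hf : Integrable f μT)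
    (hΦ : Integrable (fun x => PhiA |f x|) μT) :
    ∀ᵐ x ∂μT, Tendsto (fun n => walshSum f n x) atTop (nhds (f x)) := by
  have h1 : ∀ j : ℕ, ∀ᵐ x ∂μT,
      ¬ ∃ᶠ n in atTop, 4 * (1 / ((j : ℝ) + 1)) < |walshSum f n x - f x| := by
    intro j
    rw [ae_iff]
    simp only [not_not]
    exact measure_frequently_eq_zero hfm hf hΦ (by positivity)
  filter_upwards [ae_all_iff.2 h1] with x hx
  rw [Metric.tendsto_nhds]
  intro ε hε
  obtain ⟨j, hj⟩ := exists_nat_one_div_lt (show 0 < ε / 4 by positivity)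
  filter_upwards [not_frequently.1 (hx j)] with n hn
  rw [Real.dist_eq]
  linarith [not_lt.1 hn]

theorem mul_walshCarleson_le {f : ℝ → ℝ} (hf : AEStronglyMeasurable f μT) {lam : ℝ}
    (hlam : 0 < lam) (hΦ : Integrable (fun x => PhiA (|f x| / lam)) μT)
    (hΦ1 : ∫ x, PhiA (|f x| / lam) ∂μT ≤ 1) {t : ℝ} (ht : 0 < t) :
    ENNReal.ofReal t * μT {x | t < walshCarleson f x} ≤ ENNReal.ofReal (500000 * lam) := by
  set h : ℝ → ℝ := fun x => lam⁻¹ * hf.mk f x with hh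
  have hhm : Measurable h := hf.stronglyMeasurable_mk.measurable.const_mul _
  have hae : h =ᵐ[μT] fun x => lam⁻¹ * f x := by
    filter_upwards [hf.ae_eq_mk] with x hx
    rw [hh, hx]
  have hΦae : (fun x => PhiA (|f x| / lam)) =ᵐ[μT] fun x => PhiA |h x| := by
    filter_upwards [hae] with x hx
    rw [hx, abs_mul, abs_of_pos (inv_pos.2 hlam), inv_mul_eq_div]
  have hΦh := hΦ.congr hΦae
  have hΦh1 : ∫ x, PhiA |h x| ∂μT ≤ 1 := by rwa [← integral_congr_ae hΦae]
  have hi := integrable_of_PhiA hhm.aestronglyMeasurable hΦh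
  have hw := mul_maxSum_le_of_PhiA hhm hi hΦh hΦh1 (t := ENNReal.ofReal (t / lam))
    ENNReal.ofReal_ne_top
  have hsub : {x | t < walshCarleson f x} ⊆ {x | ENNReal.ofReal (t / lam) < maxSum h x} := by
    intro x hx
    obtain ⟨n, hn⟩ := exists_lt_of_lt_ciSup (show t < ⨆ n, |walshSum f n x| from hx)
    refine (lt_maxSum_iff ENNReal.ofReal_ne_top).2 ⟨n, ?_⟩
    rw [ENNReal.toReal_ofReal (by positivity), walshSum_congr_ae hae, walshSum_const_mul, abs_mul,
      abs_of_pos (inv_pos.2 hlam), div_eq_inv_mul]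
    exact mul_lt_mul_of_pos_left hn (inv_pos.2 hlam)
  calc ENNReal.ofReal t * μT {x | t < walshCarleson f x}
      = ENNReal.ofReal lam * (ENNReal.ofReal (t / lam) * μT {x | t < walshCarleson f x}) := by
        rw [← mul_assoc, ← ENNReal.ofReal_mul hlam.le, mul_div_cancel₀ _ hlam.ne']
    _ ≤ ENNReal.ofReal lam * ENNReal.ofReal 500000 :=
        mul_le_mul_right ((mul_le_mul_right (measure_mono hsub) _).trans hw) _
    _ = _ := by rw [← ENNReal.ofReal_mul hlam.le, mul_comm]

end

end DyadicModel

open DyadicModel in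
/-- **The Walsh-Carleson operator on Antonov's space.** With
`Φ(t) = t log(e+t) logloglog(e^{e^e}+t)`, there is an absolute constant `c > 0`
such that `‖W f‖_{1,∞} ≤ c ‖f‖_{L^Φ(𝕋)}` for every `f ∈ L^Φ(𝕋)`; in
particular the Walsh-Fourier sums of such `f` converge to `f` a.e. on `𝕋`. -/
theorem walshCarleson_Antonov :
    ∃ c : ℝ, 0 < c ∧
      ∀ f : ℝ → ℝ, AEStronglyMeasurable f μT →
        (∃ lam : ℝ, 0 < lam ∧ Integrable (fun x => PhiA (|f x| / lam)) μT ∧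
          (∫ x, PhiA (|f x| / lam) ∂μT) ≤ 1) →
        (∀ lam : ℝ, 0 < lam →
          ENNReal.ofReal lam * μT {x | lam < walshCarleson f x} ≤
            ENNReal.ofReal (c * luxemburgNorm PhiA f)) ∧
        (∀ᵐ x ∂μT, Filter.Tendsto (fun n => walshSum f n x)
          Filter.atTop (nhds (f x))) := by
  refine ⟨500000, by norm_num, fun f hf hex => ⟨fun t ht => ?_, ?_⟩⟩
  · have htop : ENNReal.ofReal t * μT {x | t < walshCarleson f x} ≠ ⊤ :=
      ENNReal.mul_ne_top ENNReal.ofReal_ne_top (measure_ne_top _ _)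
    rw [← ENNReal.ofReal_toReal htop]
    refine ENNReal.ofReal_le_ofReal ?_
    rw [← div_le_iff₀' (by norm_num)]
    refine le_csInf hex ?_
    rintro lam ⟨hlam, hΦ, hΦ1⟩
    rw [div_le_iff₀' (by norm_num)]
    exact ENNReal.toReal_le_of_le_ofReal (by positivity) (mul_walshCarleson_le hf hlam hΦ hΦ1 ht)
  · obtain ⟨lam, hlam, hΦ, -⟩ := hex
    have hae : (fun x => lam⁻¹ * hf.mk f x) =ᵐ[μT] fun x => lam⁻¹ * f x := by
      filter_upwards [hf.ae_eq_mk] with x hx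
      rw [hx]
    have hm : Measurable fun x => lam⁻¹ * hf.mk f x :=
      hf.stronglyMeasurable_mk.measurable.const_mul _
    have hΦ' : Integrable (fun x => PhiA |lam⁻¹ * hf.mk f x|) μT := by
      refine hΦ.congr ?_
      filter_upwards [hae] with x hx
      rw [hx, abs_mul, abs_of_pos (inv_pos.2 hlam), inv_mul_eq_div]
    filter_upwards [ae_tendsto_walshSum hm (integrable_of_PhiA hm.aestronglyMeasurable hΦ') hΦ',
      hae] with x hx hxe
    have h2 := hx.const_mul lam
    rw [hxe, mul_inv_cancel_left₀ hlam.ne'] at h2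
    refine h2.congr fun n => ?_
    rw [walshSum_congr_ae hae, walshSum_const_mul, mul_inv_cancel_left₀ hlam.ne']
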